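/- arXiv:0710.3637 — 2 statements merged into one kernel-verified Lean document; each statement's English description precedes it below -/
import Mathlib

section
/- Let n ≥ 2 and let u : ℝⁿ → ℝ be a C^∞ strictly convex function (its Hessian (∂²u/∂ξ_i∂ξ_j) is positive definite at every point) that satisfies det(∂²u/∂ξ_i∂ξ_j) = exp(−Σ_{i=1}^n d_i ∂u/∂ξ_i − d_0) on all of ℝⁿ, where d_0, d_1, …, d_n are real constants. Then u is a quadratic polynomial (a polynomial of degree at most 2). -/
noncomputable section

/-- The `i`-th partial derivative of a function on `ℝⁿ`. -/
def pd {n : ℕ} (i : Fin n) (f : (Fin n → ℝ) → ℝ) : (Fin n → ℝ) → ℝ :=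
  fun x => fderiv ℝ f x (Pi.single i 1)

/-- The Hessian matrix `(∂²f/∂x_i∂x_j)`. -/
def hess {n : ℕ} (f : (Fin n → ℝ) → ℝ) (x : Fin n → ℝ) : Matrix (Fin n) (Fin n) ℝ :=
  Matrix.of fun i j => pd i (pd j f) x

namespace JCP

open Filter Topology

variable {n : ℕ}

/-- Smooth functions on `ℝⁿ`. -/
def Sm (f : (Fin n → ℝ) → ℝ) : Prop := ContDiff ℝ (⊤ : ℕ∞) f

/-- Directional derivative. -/
def dd (v : Fin n → ℝ) (f : (Fin n → ℝ) → ℝ) : (Fin n → ℝ) → ℝ :=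
  fun x => fderiv ℝ f x v

theorem Sm.differentiable {f : (Fin n → ℝ) → ℝ} (hf : Sm f) : Differentiable ℝ f :=
  ContDiff.differentiable hf (by simp)

theorem Sm.continuous {f : (Fin n → ℝ) → ℝ} (hf : Sm f) : Continuous f :=
  ContDiff.continuous hf

theorem Sm.dd {f : (Fin n → ℝ) → ℝ} (hf : Sm f) (v : Fin n → ℝ) : Sm (dd v f) := by
  have h : ContDiff ℝ (⊤ : ℕ∞) (fderiv ℝ f) := ContDiff.fderiv_right hf (by simp)
  exact h.clm_apply contDiff_const

theorem dd_comm {f : (Fin n → ℝ) → ℝ} (hf : Sm f) (v w : Fin n → ℝ) :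
    dd v (dd w f) = dd w (dd v f) := by
  have h : Differentiable ℝ (fderiv ℝ f) :=
    (ContDiff.fderiv_right (m := (⊤ : ℕ∞)) hf (by simp)).differentiable (by simp)
  funext x
  have key : ∀ a b : Fin n → ℝ, dd a (dd b f) x = fderiv ℝ (fderiv ℝ f) x a b := by
    intro a b
    unfold dd
    rw [fderiv_clm_apply (h x) (differentiableAt_const b)]
    simp
  rw [key, key]
  have hs : IsSymmSndFDerivAt ℝ f x :=
    ContDiffAt.isSymmSndFDerivAt (ContDiff.contDiffAt hf)
      (by simp only [minSmoothness_of_isRCLikeNormedField]; exact WithTop.coe_le_coe.2 le_top)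
  exact hs.eq v w

theorem dd_add_dir (v w : Fin n → ℝ) (f : (Fin n → ℝ) → ℝ) :
    dd (v + w) f = dd v f + dd w f := by
  funext x; simp [dd]

theorem dd_smul_dir (c : ℝ) (v : Fin n → ℝ) (f : (Fin n → ℝ) → ℝ) :
    dd (c • v) f = c • dd v f := by
  funext x; simp [dd]

theorem dd_zero_dir (f : (Fin n → ℝ) → ℝ) :
    dd 0 f = 0 := by
  funext x; simp [dd]

theorem dd_add_fun {f g : (Fin n → ℝ) → ℝ} (hf : Sm f) (hg : Sm g) (v : Fin n → ℝ) :
    dd v (f + g) = dd v f + dd v g := by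
  funext x
  simp only [dd, Pi.add_apply]
  rw [fderiv_add (hf.differentiable x) (hg.differentiable x)]; simp

theorem dd_smul_fun {f : (Fin n → ℝ) → ℝ} (hf : Sm f) (c : ℝ) (v : Fin n → ℝ) :
    dd v (c • f) = c • dd v f := by
  funext x
  simp only [dd, Pi.smul_apply]
  rw [fderiv_const_smul (hf.differentiable x)]; simp

theorem Sm.add {f g : (Fin n → ℝ) → ℝ} (hf : Sm f) (hg : Sm g) : Sm (f + g) :=
  ContDiff.add hf hg

theorem Sm.smul {f : (Fin n → ℝ) → ℝ} (hf : Sm f) (c : ℝ) : Sm (c • f) :=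
  contDiff_const.smul hf

theorem dd_sum_dir {ι : Type*} (s : Finset ι) (c : ι → ℝ) (b : ι → Fin n → ℝ)
    (f : (Fin n → ℝ) → ℝ) (x : Fin n → ℝ) :
    dd (∑ i ∈ s, c i • b i) f x = ∑ i ∈ s, c i * dd (b i) f x := by
  simp [dd]

/-- derivative along a line -/
theorem hasDerivAt_line {g : (Fin n → ℝ) → ℝ} (hg : Sm g) (x b : Fin n → ℝ) (s : ℝ) :
    HasDerivAt (fun s : ℝ => g (x + s • b)) (dd b g (x + s • b)) s := by
  have h1 : HasFDerivAt g (fderiv ℝ g (x + s • b)) (x + s • b) :=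
    (hg.differentiable _).hasFDerivAt
  have h2 : HasDerivAt (fun s : ℝ => x + s • b) b s := by
    simpa using ((hasDerivAt_id s).smul_const b).const_add x
  exact h1.comp_hasDerivAt s h2

/-! ### Two-jets of functions of one real variable -/

/-- `f` is twice differentiable at `0` with the given value and derivatives. -/
def Jet (f : ℝ → ℝ) (a0 a1 a2 : ℝ) : Prop :=
  ∃ f' : ℝ → ℝ, (∀ᶠ s in 𝓝 (0:ℝ), HasDerivAt f (f' s) s) ∧ f 0 = a0 ∧ f' 0 = a1 ∧
    HasDerivAt f' a2 0

theorem Jet.congr {f : ℝ → ℝ} {a0 a1 a2 b0 b1 b2 : ℝ} (h : Jet f a0 a1 a2)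
    (h0 : a0 = b0) (h1 : a1 = b1) (h2 : a2 = b2) : Jet f b0 b1 b2 := by
  subst h0 h1 h2; exact h

theorem Jet.const (c : ℝ) : Jet (fun _ => c) c 0 0 :=
  ⟨fun _ => 0, Eventually.of_forall fun s => hasDerivAt_const s c, rfl, rfl, hasDerivAt_const _ _⟩

theorem Jet.id : Jet (fun s => s) 0 1 0 :=
  ⟨fun _ => 1, Eventually.of_forall fun s => hasDerivAt_id s, rfl, rfl, hasDerivAt_const _ _⟩

theorem Jet.continuousAt {f : ℝ → ℝ} {a0 a1 a2 : ℝ} (h : Jet f a0 a1 a2) :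
    ContinuousAt f 0 := by
  obtain ⟨f', h1, -⟩ := h
  exact h1.self_of_nhds.continuousAt

theorem Jet.add {f g : ℝ → ℝ} {a0 a1 a2 b0 b1 b2 : ℝ} (hf : Jet f a0 a1 a2)
    (hg : Jet g b0 b1 b2) : Jet (fun s => f s + g s) (a0 + b0) (a1 + b1) (a2 + b2) := by
  obtain ⟨f', f1, rfl, rfl, f4⟩ := hf
  obtain ⟨g', g1, rfl, rfl, g4⟩ := hg
  refine ⟨fun s => f' s + g' s, ?_, rfl, rfl, f4.add g4⟩
  filter_upwards [f1, g1] with s h1 h2 using h1.add h2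

theorem Jet.mul {f g : ℝ → ℝ} {a0 a1 a2 b0 b1 b2 : ℝ} (hf : Jet f a0 a1 a2)
    (hg : Jet g b0 b1 b2) : Jet (fun s => f s * g s) (a0 * b0) (a1 * b0 + a0 * b1)
      (a2 * b0 + 2 * a1 * b1 + a0 * b2) := by
  obtain ⟨f', f1, rfl, rfl, f4⟩ := hf
  obtain ⟨g', g1, rfl, rfl, g4⟩ := hg
  refine ⟨fun s => f' s * g s + f s * g' s, ?_, rfl, rfl, ?_⟩
  · filter_upwards [f1, g1] with s h1 h2 using h1.mul h2
  · have := (f4.mul g1.self_of_nhds).add (f1.self_of_nhds.mul g4)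
    refine this.congr_deriv ?_
    ring

theorem Jet.smul {f : ℝ → ℝ} {a0 a1 a2 : ℝ} (hf : Jet f a0 a1 a2) (c : ℝ) :
    Jet (fun s => c * f s) (c * a0) (c * a1) (c * a2) :=
  ((Jet.const c).mul hf).congr rfl (by ring) (by ring)

theorem Jet.exp {f : ℝ → ℝ} {a0 a1 a2 : ℝ} (hf : Jet f a0 a1 a2) :
    Jet (fun s => Real.exp (f s)) (Real.exp a0) (Real.exp a0 * a1)
      (Real.exp a0 * (a1 ^ 2 + a2)) := by
  obtain ⟨f', f1, rfl, rfl, f4⟩ := hf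
  refine ⟨fun s => Real.exp (f s) * f' s, ?_, rfl, rfl, ?_⟩
  · filter_upwards [f1] with s h1 using h1.exp
  · have := f1.self_of_nhds.exp.mul f4
    refine this.congr_deriv ?_
    ring

theorem Jet.log {f : ℝ → ℝ} {a0 a1 a2 : ℝ} (hf : Jet f a0 a1 a2) (h0 : 0 < a0) :
    Jet (fun s => Real.log (f s)) (Real.log a0) (a1 / a0) (a2 / a0 - (a1 / a0) ^ 2) := by
  have hc := hf.continuousAt
  obtain ⟨f', f1, rfl, rfl, f4⟩ := hf
  refine ⟨fun s => f' s / f s, ?_, rfl, rfl, ?_⟩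
  · filter_upwards [f1, hc.eventually (lt_mem_nhds h0)] with s h1 h2
    exact h1.log h2.ne'
  · have := f4.div f1.self_of_nhds h0.ne'
    refine this.congr_deriv ?_
    field_simp

theorem Jet.line {g : (Fin n → ℝ) → ℝ} (hg : Sm g) (x b : Fin n → ℝ) :
    Jet (fun s : ℝ => g (x + s • b)) (g x) (dd b g x) (dd b (dd b g) x) :=
  ⟨fun s => dd b g (x + s • b), Eventually.of_forall fun s => hasDerivAt_line hg x b s,
    by simp, by simp, by simpa using hasDerivAt_line (hg.dd b) x b 0⟩

theorem Jet.max {f : ℝ → ℝ} {a0 a1 a2 : ℝ} (hf : Jet f a0 a1 a2)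
    (hm : ∀ᶠ s in 𝓝 (0:ℝ), f s ≤ a0) : a1 = 0 ∧ a2 ≤ 0 := by
  obtain ⟨f', f1, rfl, rfl, f4⟩ := hf
  have hmax : IsLocalMax f 0 := hm
  have h1 : f' 0 = 0 := hmax.hasDerivAt_eq_zero f1.self_of_nhds
  refine ⟨h1, ?_⟩
  by_contra hpos
  push Not at hpos
  have hd : deriv f =ᶠ[𝓝 0] f' := f1.mono fun s hs => hs.deriv
  have hdd : deriv (deriv f) 0 = a2 := by
    rw [hd.deriv_eq]; exact f4.deriv
  have hmin : IsLocalMin f 0 := isLocalMin_of_deriv_deriv_pos (by rw [hdd]; exact hpos)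
    (by rw [f1.self_of_nhds.deriv, h1]) f1.self_of_nhds.continuousAt
  have hconst : f =ᶠ[𝓝 0] fun _ => f 0 := by
    filter_upwards [hmin, hm] with s h1 h2 using le_antisymm h2 h1
  have h2 : deriv f =ᶠ[𝓝 0] deriv (fun _ => f 0) := hconst.deriv
  have h3 : deriv (deriv f) 0 = 0 := by
    rw [h2.deriv_eq]; simp
  rw [hdd] at h3
  exact hpos.ne' h3

end JCP

namespace JCP

open Filter Topology

section DetDeriv

open Matrix
open scoped Matrix.Norms.Operator

variable {n : ℕ}

theorem hasDerivAt_matrix {M M1 : ℝ → Matrix (Fin n) (Fin n) ℝ} {s : ℝ}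
    (h : ∀ i j, HasDerivAt (fun s => M s i j) (M1 s i j) s) : HasDerivAt M (M1 s) s := by
  have e : ∀ A : Matrix (Fin n) (Fin n) ℝ,
      A = ∑ i, ∑ j, (A i j) • Matrix.single i j (1:ℝ) := by
    intro A
    conv_lhs => rw [Matrix.matrix_eq_sum_single A]
    simp [Matrix.smul_single]
  have h2 : HasDerivAt (fun s => ∑ i, ∑ j, (M s i j) • Matrix.single i j (1:ℝ))
      (∑ i, ∑ j, (M1 s i j) • Matrix.single i j (1:ℝ)) s := by
    refine HasDerivAt.fun_sum fun i _ => HasDerivAt.fun_sum fun j _ => ?_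
    exact (h i j).smul_const _
  rw [← e] at h2
  have e2 : M = (fun s => ∑ i, ∑ j, (M s i j) • Matrix.single i j (1:ℝ)) := by
    funext s; exact e (M s)
  rw [e2]; exact h2

theorem hasDerivAt_entry {M : ℝ → Matrix (Fin n) (Fin n) ℝ} {M1 : Matrix (Fin n) (Fin n) ℝ}
    {s : ℝ} (h : HasDerivAt M M1 s) (i j : Fin n) :
    HasDerivAt (fun s => M s i j) (M1 i j) s := by
  have hc : HasFDerivAt (fun A : Matrix (Fin n) (Fin n) ℝ => A i j)
      (LinearMap.toContinuousLinearMap (Matrix.entryLinearMap ℝ ℝ i j)) (M s) :=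
    (LinearMap.toContinuousLinearMap (Matrix.entryLinearMap ℝ ℝ i j)).hasFDerivAt
  exact hc.comp_hasDerivAt s h

theorem hasDerivAt_trace {M : ℝ → Matrix (Fin n) (Fin n) ℝ} {M1 : Matrix (Fin n) (Fin n) ℝ}
    {s : ℝ} (h : HasDerivAt M M1 s) :
    HasDerivAt (fun s => (M s).trace) M1.trace s := by
  simp only [Matrix.trace, Matrix.diag]
  exact HasDerivAt.fun_sum fun i _ => hasDerivAt_entry h i i

theorem hasDerivAt_matrix_inv {M : ℝ → Matrix (Fin n) (Fin n) ℝ} {M1 : Matrix (Fin n) (Fin n) ℝ}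
    {s : ℝ} (h : HasDerivAt M M1 s) (hu : IsUnit (M s)) :
    HasDerivAt (fun s => (M s)⁻¹) (-((M s)⁻¹ * M1 * (M s)⁻¹)) s := by
  obtain ⟨U, hU⟩ := hu
  have h1 := hasFDerivAt_ringInverse (𝕜 := ℝ) U
  rw [hU] at h1
  have h2 := h1.comp_hasDerivAt s h
  have e : (fun s => (M s)⁻¹) = Ring.inverse ∘ M := by
    funext t; simp [Matrix.nonsing_inv_eq_ringInverse]
  rw [e]
  refine h2.congr_deriv ?_
  have : (↑U⁻¹ : Matrix (Fin n) (Fin n) ℝ) = (M s)⁻¹ := by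
    rw [← hU, Matrix.coe_units_inv]
  simp [this]

theorem hasDerivAt_det_one {M : ℝ → Matrix (Fin n) (Fin n) ℝ} {M1 : Matrix (Fin n) (Fin n) ℝ}
    {s : ℝ} (h : HasDerivAt M M1 s) (h1 : M s = 1) :
    HasDerivAt (fun s => (M s).det) M1.trace s := by
  have hd : Differentiable ℝ (fun A : Matrix (Fin n) (Fin n) ℝ => A.det) := by
    simp only [Matrix.det_apply]
    refine Differentiable.fun_sum fun σ _ => ?_
    refine Differentiable.const_smul ?_ _
    exact (contDiff_prod (𝕜 := ℝ) (n := 1) fun i _ => (LinearMap.toContinuousLinearMap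
      (Matrix.entryLinearMap ℝ ℝ (σ i) i)).contDiff).differentiable (by simp)
  have hline : ∀ N : Matrix (Fin n) (Fin n) ℝ,
      fderiv ℝ (fun A : Matrix (Fin n) (Fin n) ℝ => A.det) 1 N = N.trace := by
    intro N
    have a1 : HasDerivAt (fun r : ℝ => (1 + r • N)) N 0 := by
      have := ((hasDerivAt_id (0:ℝ)).smul_const N).const_add (1 : Matrix (Fin n) (Fin n) ℝ)
      simp only [id, one_smul] at this
      exact this
    have a2 : HasFDerivAt (fun A : Matrix (Fin n) (Fin n) ℝ => A.det)
        (fderiv ℝ (fun A : Matrix (Fin n) (Fin n) ℝ => A.det) 1) (1 + (0:ℝ) • N) := by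
      simpa using (hd 1).hasFDerivAt
    have a3 := a2.comp_hasDerivAt (0:ℝ) a1
    have a4 : HasDerivAt ((fun A : Matrix (Fin n) (Fin n) ℝ => A.det) ∘ fun r : ℝ => 1 + r • N)
        N.trace 0 := by
      have e : ((fun A : Matrix (Fin n) (Fin n) ℝ => A.det) ∘ fun r : ℝ => 1 + r • N) =
        fun r => 1 + N.trace * r +
          (Polynomial.eval r (Matrix.det (1 + (Polynomial.X : Polynomial ℝ) •
            N.map Polynomial.C)).divX.divX) * r ^ 2 := by
        funext r
        exact Matrix.det_one_add_smul r N
      rw [e]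
      have b1 : HasDerivAt (fun r : ℝ => 1 + N.trace * r) N.trace 0 := by
        simpa using ((hasDerivAt_id (0:ℝ)).const_mul N.trace).const_add 1
      have b2 := (Polynomial.hasDerivAt (Matrix.det (1 + (Polynomial.X : Polynomial ℝ) •
            N.map Polynomial.C)).divX.divX (0:ℝ)).mul (hasDerivAt_pow 2 (0:ℝ))
      have b3 := b1.add b2
      refine b3.congr_deriv ?_
      simp
    exact a3.unique a4
  have a2 : HasFDerivAt (fun A : Matrix (Fin n) (Fin n) ℝ => A.det)
      (fderiv ℝ (fun A : Matrix (Fin n) (Fin n) ℝ => A.det) 1) (M s) := by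
    rw [h1]; exact (hd 1).hasFDerivAt
  have := a2.comp_hasDerivAt s h
  exact this.congr_deriv (hline M1)

theorem hasDerivAt_det {M : ℝ → Matrix (Fin n) (Fin n) ℝ} {M1 : Matrix (Fin n) (Fin n) ℝ}
    {s : ℝ} (h : HasDerivAt M M1 s) (hu : IsUnit (M s).det) :
    HasDerivAt (fun s => (M s).det) ((M s).det * ((M s)⁻¹ * M1).trace) s := by
  have h1 : HasDerivAt (fun t => (M s)⁻¹ * M t) ((M s)⁻¹ * M1) s := h.const_mul _
  have h2 := hasDerivAt_det_one h1 (Matrix.nonsing_inv_mul _ hu)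
  have h3 := h2.const_mul (M s).det
  have e : (fun t => (M t).det) = fun t => (M s).det * ((M s)⁻¹ * M t).det := by
    funext t
    rw [← Matrix.det_mul, ← mul_assoc, Matrix.mul_nonsing_inv _ hu, one_mul]
  rw [e]; exact h3

/-- Derivatives of `log det` up to order three at a point where `M = 1` and `M'` is diagonal. -/
theorem logdet_jet {M M1 M2 M3 : ℝ → Matrix (Fin n) (Fin n) ℝ} {l l1 l2 l3 : ℝ → ℝ}
    (h1 : ∀ s i j, HasDerivAt (fun s => M s i j) (M1 s i j) s)
    (h2 : ∀ s i j, HasDerivAt (fun s => M1 s i j) (M2 s i j) s)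
    (h3 : ∀ s i j, HasDerivAt (fun s => M2 s i j) (M3 s i j) s)
    (g1 : ∀ s, HasDerivAt l (l1 s) s) (g2 : ∀ s, HasDerivAt l1 (l2 s) s)
    (g3 : ∀ s, HasDerivAt l2 (l3 s) s)
    (hdet : ∀ s, (M s).det = Real.exp (l s)) (hM : M 0 = 1) (lam : Fin n → ℝ)
    (hM1 : M1 0 = Matrix.diagonal lam) :
    l1 0 = ∑ i, lam i ∧ l2 0 = ∑ i, M2 0 i i - ∑ i, lam i ^ 2 ∧
    l3 0 = ∑ i, M3 0 i i - 3 * ∑ i, lam i * M2 0 i i + 2 * ∑ i, lam i ^ 3 := by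
  have hu : ∀ s, IsUnit (M s).det := fun s => by
    rw [hdet]; exact (Real.exp_pos _).ne'.isUnit
  have hU : ∀ s, IsUnit (M s) := fun s => (Matrix.isUnit_iff_isUnit_det _).2 (hu s)
  have H1 : ∀ s, HasDerivAt M (M1 s) s := fun s => hasDerivAt_matrix (h1 s)
  have H2 : ∀ s, HasDerivAt M1 (M2 s) s := fun s => hasDerivAt_matrix (h2 s)
  have H3 : ∀ s, HasDerivAt M2 (M3 s) s := fun s => hasDerivAt_matrix (h3 s)
  have HI : ∀ s, HasDerivAt (fun s => (M s)⁻¹) (-((M s)⁻¹ * M1 s * (M s)⁻¹)) s := fun s =>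
    hasDerivAt_matrix_inv (H1 s) (hU s)
  have e1 : l1 = fun s => ((M s)⁻¹ * M1 s).trace := by
    funext s
    have a := hasDerivAt_det (H1 s) (hu s)
    have b := (g1 s).exp
    have c : (fun s => (M s).det) = fun s => Real.exp (l s) := funext hdet
    rw [c, hdet] at a
    have := a.unique b
    exact (mul_left_cancel₀ (Real.exp_pos _).ne' this).symm
  have e2 : l2 = fun s => (-((M s)⁻¹ * M1 s * (M s)⁻¹) * M1 s + (M s)⁻¹ * M2 s).trace := by
    funext s
    have a := hasDerivAt_trace ((HI s).mul (H2 s))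
    have b := g2 s
    rw [e1] at b
    exact b.unique a
  have e3 : l3 0 = ((-((-((M 0)⁻¹ * M1 0 * (M 0)⁻¹) * M1 0 + (M 0)⁻¹ * M2 0) * (M 0)⁻¹
      + ((M 0)⁻¹ * M1 0) * -((M 0)⁻¹ * M1 0 * (M 0)⁻¹))) * M1 0
      + -((M 0)⁻¹ * M1 0 * (M 0)⁻¹) * M2 0
      + (-((M 0)⁻¹ * M1 0 * (M 0)⁻¹) * M2 0 + (M 0)⁻¹ * M3 0)).trace := by
    have a := hasDerivAt_trace ((((((HI 0).mul (H2 0)).mul (HI 0)).neg).mul (H2 0)).add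
      ((HI 0).mul (H3 0)))
    have b := g3 0
    rw [e2] at b
    exact b.unique a
  refine ⟨?_, ?_, ?_⟩
  · rw [e1]; simp [hM, hM1, Matrix.trace]
  · rw [e2]; simp [hM, hM1, Matrix.trace, Matrix.diagonal_mul_diagonal]
    rw [← Finset.sum_sub_distrib]
    refine Finset.sum_congr rfl fun i _ => by ring
  · rw [e3, hM, hM1]
    simp only [inv_one, one_mul, mul_one]
    have : ∀ D X Y : Matrix (Fin n) (Fin n) ℝ,
      (-(-D * D + X + D * -D) * D + -D * X + (-D * X + Y)).trace =
        2 * (D * D * D).trace - (X * D).trace - 2 * (D * X).trace + Y.trace := by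
      intro D X Y
      rw [show -(-D * D + X + D * -D) * D + -D * X + (-D * X + Y) =
        D * D * D + D * D * D - X * D - D * X - D * X + Y by noncomm_ring]
      simp only [Matrix.trace_add, Matrix.trace_sub]; ring
    rw [this, Matrix.trace_mul_comm (M2 0)]
    simp only [Matrix.diagonal_mul_diagonal, Matrix.trace_diagonal]
    have t : (Matrix.diagonal lam * M2 0).trace = ∑ i, lam i * M2 0 i i := by
      simp [Matrix.trace]
    rw [t]
    simp only [Matrix.trace, Matrix.diag]
    have : ∑ i, lam i ^ 3 = ∑ i, lam i * lam i * lam i := by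
      refine Finset.sum_congr rfl fun i _ => by ring
    rw [this]; ring

end DetDeriv

section Diag

open Matrix

variable {n : ℕ}

/-- Simultaneous diagonalisation. -/
theorem simul_diag (H A : Matrix (Fin n) (Fin n) ℝ) (hH : H.PosDef) (hA : A.IsSymm) :
    ∃ (B : Matrix (Fin n) (Fin n) ℝ) (lam : Fin n → ℝ),
      Bᵀ * H * B = 1 ∧ Bᵀ * A * B = Matrix.diagonal lam := by
  obtain ⟨C, hC, hHC⟩ : ∃ C : Matrix (Fin n) (Fin n) ℝ, IsUnit C.det ∧ H = Cᵀ * C := by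
    have h1 := hH.1.spectral_theorem
    rw [Unitary.conjStarAlgAut_apply] at h1
    set V : Matrix (Fin n) (Fin n) ℝ := (hH.1.eigenvectorUnitary : Matrix (Fin n) (Fin n) ℝ)
    have hE : diagonal ((RCLike.ofReal : ℝ → ℝ) ∘ hH.1.eigenvalues) =
        diagonal (fun i => √(hH.1.eigenvalues i)) * diagonal (fun i => √(hH.1.eigenvalues i)) := by
      rw [diagonal_mul_diagonal]
      congr 1; funext i
      simp [Real.mul_self_sqrt (hH.eigenvalues_pos i).le]
    have hHC : H = (diagonal (fun i => √(hH.1.eigenvalues i)) * Vᵀ)ᵀ *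
        (diagonal (fun i => √(hH.1.eigenvalues i)) * Vᵀ) := by
      rw [Matrix.transpose_mul, Matrix.transpose_transpose, diagonal_transpose]
      conv_lhs => rw [h1, hE]
      simp only [Matrix.mul_assoc, Matrix.star_eq_conjTranspose, conjTranspose_eq_transpose_of_trivial]
    refine ⟨_, ?_, hHC⟩
    have h2 := hH.det_pos
    rw [hHC, det_mul, det_transpose] at h2
    exact (ne_of_apply_ne (fun x => x * x) (by simpa using h2.ne')).isUnit
  have hA' : ((C⁻¹)ᵀ * A * C⁻¹).IsHermitian := by
    rw [Matrix.IsHermitian, conjTranspose_eq_transpose_of_trivial]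
    simp only [Matrix.transpose_mul, Matrix.transpose_transpose, hA.eq, Matrix.mul_assoc]
  have h1 := hA'.spectral_theorem
  rw [Unitary.conjStarAlgAut_apply] at h1
  have hU1 : star (hA'.eigenvectorUnitary : Matrix (Fin n) (Fin n) ℝ) *
    (hA'.eigenvectorUnitary : Matrix (Fin n) (Fin n) ℝ) = 1 := by simp
  set U : Matrix (Fin n) (Fin n) ℝ := (hA'.eigenvectorUnitary : Matrix (Fin n) (Fin n) ℝ) with hU
  rw [Matrix.star_eq_conjTranspose, conjTranspose_eq_transpose_of_trivial] at hU1 h1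
  have hCC : C * C⁻¹ = 1 := Matrix.mul_nonsing_inv _ hC
  refine ⟨C⁻¹ * U, hA'.eigenvalues, ?_, ?_⟩
  · calc (C⁻¹ * U)ᵀ * H * (C⁻¹ * U) = Uᵀ * ((C * C⁻¹)ᵀ * (C * C⁻¹)) * U := by
          rw [hHC]; simp only [Matrix.transpose_mul, Matrix.mul_assoc]
      _ = 1 := by rw [hCC]; simp [hU1]
  · calc (C⁻¹ * U)ᵀ * A * (C⁻¹ * U) = Uᵀ * ((C⁻¹)ᵀ * A * C⁻¹) * U := by
          simp only [Matrix.transpose_mul, Matrix.mul_assoc]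
      _ = (Uᵀ * U) * diagonal (RCLike.ofReal ∘ hA'.eigenvalues) * (Uᵀ * U) := by
          conv_lhs => rw [h1]
          simp only [Matrix.mul_assoc]
      _ = _ := by rw [hU1]; simp

end Diag

end JCP

namespace JCP

open Filter Topology

variable {n : ℕ}

/-- Normalised form of the hypotheses of the theorem. -/
structure Sol (u : (Fin n → ℝ) → ℝ) (d : Fin n → ℝ) (d0 : ℝ) : Prop where
  sm : Sm u
  pos : ∀ x v, v ≠ 0 → 0 < dd v (dd v u) x
  hsymm : ∀ x, (hess u x).PosDef
  pde : ∀ x, (hess u x).det = Real.exp (-(dd d u x) - d0)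

theorem dir_eq_sum (v : Fin n → ℝ) : v = ∑ i, v i • (Pi.single i 1 : Fin n → ℝ) := by
  conv_lhs => rw [← Finset.univ_sum_single v]
  refine Finset.sum_congr rfl fun i _ => ?_
  rw [← Pi.single_smul]; simp

theorem dd_eq_sum (v : Fin n → ℝ) (f : (Fin n → ℝ) → ℝ) (x : Fin n → ℝ) :
    dd v f x = ∑ i, v i * pd i f x := by
  conv_lhs => rw [dir_eq_sum v]
  rw [dd_sum_dir]; rfl

theorem hess_apply {f : (Fin n → ℝ) → ℝ} (x : Fin n → ℝ) (i j : Fin n) :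
    hess f x i j = dd (Pi.single i 1) (dd (Pi.single j 1) f) x := rfl

theorem hess_form {f : (Fin n → ℝ) → ℝ} (hf : Sm f) (x v w : Fin n → ℝ) :
    dd v (dd w f) x = ∑ i, ∑ j, v i * hess f x i j * w j := by
  rw [dd_eq_sum]
  refine Finset.sum_congr rfl fun i _ => ?_
  change v i * dd (Pi.single i 1) (dd w f) x = _
  rw [dd_comm hf, dd_eq_sum, Finset.mul_sum]
  refine Finset.sum_congr rfl fun j _ => ?_
  change v i * (w j * dd (Pi.single j 1) (dd (Pi.single i 1) f) x) = _
  rw [dd_comm hf, hess_apply]; ring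

theorem hess_conj {f : (Fin n → ℝ) → ℝ} (hf : Sm f) (x : Fin n → ℝ)
    (B : Matrix (Fin n) (Fin n) ℝ) (i j : Fin n) :
    (B.transpose * hess f x * B) i j = dd (fun k => B k i) (dd (fun k => B k j) f) x := by
  rw [hess_form hf]
  simp only [Matrix.mul_apply, Matrix.transpose_apply, Finset.sum_mul]
  rw [Finset.sum_comm]

theorem hess_symm {f : (Fin n → ℝ) → ℝ} (hf : Sm f) (x : Fin n → ℝ) : (hess f x).IsSymm := by
  ext i j
  rw [Matrix.transpose_apply, hess_apply, hess_apply, dd_comm hf]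

/-- The adapted frame at a point, and the differentiated equation in this frame. -/
theorem Sol.frame {u : (Fin n → ℝ) → ℝ} {d : Fin n → ℝ} {d0 : ℝ} (hS : Sol u d d0)
    (x v : Fin n → ℝ) :
    ∃ (b : Fin n → Fin n → ℝ) (lam : Fin n → ℝ),
      (∀ i j, dd (b i) (dd (b j) u) x = if i = j then 1 else 0) ∧
      (∀ i j, dd (b i) (dd (b j) (dd v u)) x = if i = j then lam i else 0) ∧
      (∀ w, w = ∑ i, (dd (b i) (dd w u) x) • b i) ∧
      (∑ i, lam i = -dd v (dd d u) x) ∧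
      (∑ i, dd (b i) (dd (b i) (dd v (dd v u))) x = ∑ i, lam i ^ 2 - dd v (dd v (dd d u)) x) ∧
      (∑ i, dd (b i) (dd (b i) (dd v (dd v (dd v u)))) x =
        3 * ∑ i, lam i * dd (b i) (dd (b i) (dd v (dd v u))) x - 2 * ∑ i, lam i ^ 3
          - dd v (dd v (dd v (dd d u))) x) := by
  have hu := hS.sm
  obtain ⟨B, lam, hB1, hB2⟩ := simul_diag (hess u x) (hess (dd v u) x) (hS.hsymm x)
    (hess_symm (hu.dd v) x)
  set b : Fin n → Fin n → ℝ := fun i k => B k i with hb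
  have c1 : ∀ i j, dd (b i) (dd (b j) u) x = if i = j then 1 else 0 := by
    intro i j
    rw [← hess_conj hu x B i j, hB1, Matrix.one_apply]
  have c2 : ∀ i j, dd (b i) (dd (b j) (dd v u)) x = if i = j then lam i else 0 := by
    intro i j
    rw [← hess_conj (hu.dd v) x B i j, hB2, Matrix.diagonal_apply]
  have c3 : ∀ w, w = ∑ i, (dd (b i) (dd w u) x) • b i := by
    intro w
    have h1 : B * (B.transpose * hess u x) = 1 := mul_eq_one_comm.1 hB1
    have h2 : B.mulVec ((B.transpose * hess u x).mulVec w) = w := by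
      rw [Matrix.mulVec_mulVec, h1, Matrix.one_mulVec]
    funext k
    conv_lhs => rw [← h2]
    rw [Finset.sum_apply, Matrix.mulVec, dotProduct]
    refine Finset.sum_congr rfl fun i _ => ?_
    rw [Pi.smul_apply, smul_eq_mul, hess_form hu, mul_comm]
    congr 1
    simp only [Matrix.mulVec, dotProduct, Matrix.mul_apply, Matrix.transpose_apply, Finset.sum_mul]
    rw [Finset.sum_comm]
  have key := logdet_jet (n := n)
    (M := fun s => B.transpose * hess u (x + s • v) * B)
    (M1 := fun s => Matrix.of fun i j => dd v (dd (b i) (dd (b j) u)) (x + s • v))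
    (M2 := fun s => Matrix.of fun i j => dd v (dd v (dd (b i) (dd (b j) u))) (x + s • v))
    (M3 := fun s => Matrix.of fun i j => dd v (dd v (dd v (dd (b i) (dd (b j) u)))) (x + s • v))
    (l := fun s => -dd d u (x + s • v) + dd d u x)
    (l1 := fun s => -dd v (dd d u) (x + s • v))
    (l2 := fun s => -dd v (dd v (dd d u)) (x + s • v))
    (l3 := fun s => -dd v (dd v (dd v (dd d u))) (x + s • v))
    (by
      intro s i j
      simp only [hess_conj hu]
      exact hasDerivAt_line ((hu.dd _).dd _) x v s)
    (fun s i j => hasDerivAt_line (((hu.dd _).dd _).dd _) x v s)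
    (fun s i j => hasDerivAt_line ((((hu.dd _).dd _).dd _).dd _) x v s)
    (fun s => (hasDerivAt_line (hu.dd _) x v s).neg.add_const _)
    (fun s => (hasDerivAt_line ((hu.dd _).dd _) x v s).neg)
    (fun s => (hasDerivAt_line (((hu.dd _).dd _).dd _) x v s).neg)
    (by
      intro s
      have h0 : (B.transpose * hess u x * B).det = 1 := by rw [hB1, Matrix.det_one]
      rw [Matrix.det_mul, Matrix.det_mul, hS.pde] at h0 ⊢
      rw [show -dd d u (x + s • v) + dd d u x =
        (-dd d u (x + s • v) - d0) - (-dd d u x - d0) by ring,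
        Real.exp_sub (-dd d u (x + s • v) - d0) (-dd d u x - d0),
        eq_div_iff (Real.exp_pos _).ne']
      linear_combination Real.exp (-dd d u (x + s • v) - d0) * h0)
    (by simpa using hB1) lam
    (by
      ext i j
      simp only [zero_smul, add_zero, Matrix.of_apply, Matrix.diagonal_apply]
      rw [← c2, dd_comm (hu.dd _), dd_comm hu v])
  simp only [zero_smul, add_zero, Matrix.of_apply] at key
  have s4 : ∀ i, dd v (dd v (dd (b i) (dd (b i) u))) = dd (b i) (dd (b i) (dd v (dd v u))) := by
    intro i
    rw [dd_comm (hu.dd _) v, dd_comm hu v, dd_comm ((hu.dd _).dd _) v, dd_comm (hu.dd _) v]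
  have s5 : ∀ i, dd v (dd (b i) (dd (b i) (dd v (dd v u)))) =
      dd (b i) (dd (b i) (dd v (dd v (dd v u)))) := by
    intro i
    rw [dd_comm (((hu.dd _).dd _).dd _) v, dd_comm ((hu.dd _).dd _) v]
  simp only [s4] at key
  simp only [s5] at key
  obtain ⟨k1, k2, k3⟩ := key
  exact ⟨b, lam, c1, c2, c3, k1.symm, by linarith, by linarith⟩

theorem Jet.tensor1 {u : (Fin n → ℝ) → ℝ} (hu : Sm u) (x b e c : Fin n → ℝ) :
    Jet (fun s : ℝ => dd (e + s • c) u (x + s • b)) (dd e u x)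
      (dd b (dd e u) x + dd c u x) (dd b (dd b (dd e u)) x + 2 * dd b (dd c u) x) := by
  have h := (Jet.line (hu.dd e) x b).add (Jet.id.mul (Jet.line (hu.dd c) x b))
  have e1 : (fun s : ℝ => dd (e + s • c) u (x + s • b)) =
      fun s : ℝ => dd e u (x + s • b) + s * dd c u (x + s • b) := by
    funext s
    rw [dd_add_dir, dd_smul_dir]; simp
  rw [e1]
  exact h.congr (by ring) (by ring) (by ring)

theorem expand2 {u : (Fin n → ℝ) → ℝ} (hu : Sm u) (y e c : Fin n → ℝ) (s : ℝ) :
    dd (e + s • c) (dd (e + s • c) u) y =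
      dd e (dd e u) y + (2 * s) * dd e (dd c u) y + (s * s) * dd c (dd c u) y := by
  have e2 : dd (e + s • c) u = dd e u + s • dd c u := by rw [dd_add_dir, dd_smul_dir]
  rw [e2, dd_add_fun (hu.dd _) ((hu.dd _).smul _), dd_smul_fun (hu.dd _), dd_add_dir, dd_smul_dir,
    dd_add_dir, dd_smul_dir, dd_comm hu c e]
  simp only [Pi.add_apply, Pi.smul_apply, smul_eq_mul]; ring

theorem expand3 {u : (Fin n → ℝ) → ℝ} (hu : Sm u) (y e c : Fin n → ℝ) (s : ℝ) :
    dd (e + s • c) (dd (e + s • c) (dd (e + s • c) u)) y =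
      dd e (dd e (dd e u)) y + (3 * s) * dd e (dd e (dd c u)) y
        + (3 * (s * s)) * dd e (dd c (dd c u)) y + (s * s * s) * dd c (dd c (dd c u)) y := by
  have e2 : dd (e + s • c) u = dd e u + s • dd c u := by rw [dd_add_dir, dd_smul_dir]
  have e3 : dd (e + s • c) (dd (e + s • c) (dd (e + s • c) u)) y =
     dd (e + s • c) (dd (e + s • c) (dd e u)) y + s * dd (e + s • c) (dd (e + s • c) (dd c u)) y := by
    rw [e2, dd_add_fun (hu.dd _) ((hu.dd _).smul _), dd_smul_fun (hu.dd _),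
      dd_add_fun ((hu.dd _).dd _) (((hu.dd _).dd _).smul _), dd_smul_fun ((hu.dd _).dd _)]
    rfl
  rw [e3, expand2 (hu.dd _), expand2 (hu.dd _), dd_comm hu c e, dd_comm (hu.dd c) c e]
  ring

theorem Jet.tensor2 {u : (Fin n → ℝ) → ℝ} (hu : Sm u) (x b e c : Fin n → ℝ) :
    Jet (fun s : ℝ => dd (e + s • c) (dd (e + s • c) u) (x + s • b)) (dd e (dd e u) x)
      (dd b (dd e (dd e u)) x + 2 * dd e (dd c u) x)
      (dd b (dd b (dd e (dd e u))) x + 4 * dd b (dd e (dd c u)) x + 2 * dd c (dd c u) x) := by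
  have h := ((Jet.line ((hu.dd e).dd e) x b).add
    ((Jet.id.smul 2).mul (Jet.line ((hu.dd c).dd e) x b))).add
    ((Jet.id.mul Jet.id).mul (Jet.line ((hu.dd c).dd c) x b))
  have e1 : (fun s : ℝ => dd (e + s • c) (dd (e + s • c) u) (x + s • b)) =
      fun s : ℝ => dd e (dd e u) (x + s • b) + (2 * s) * dd e (dd c u) (x + s • b)
        + (s * s) * dd c (dd c u) (x + s • b) := by
    funext s
    rw [expand2 hu]
  rw [e1]
  exact h.congr (by ring) (by ring) (by ring)

theorem Jet.tensor3 {u : (Fin n → ℝ) → ℝ} (hu : Sm u) (x b e c : Fin n → ℝ) :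
    Jet (fun s : ℝ => dd (e + s • c) (dd (e + s • c) (dd (e + s • c) u)) (x + s • b))
      (dd e (dd e (dd e u)) x)
      (dd b (dd e (dd e (dd e u))) x + 3 * dd e (dd e (dd c u)) x)
      (dd b (dd b (dd e (dd e (dd e u)))) x + 6 * dd b (dd e (dd e (dd c u))) x
        + 6 * dd e (dd c (dd c u)) x) := by
  have h := (((Jet.line (((hu.dd e).dd e).dd e) x b).add
    ((Jet.id.smul 3).mul (Jet.line (((hu.dd c).dd e).dd e) x b))).add
    (((Jet.id.mul Jet.id).smul 3).mul (Jet.line (((hu.dd c).dd c).dd e) x b))).add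
    (((Jet.id.mul Jet.id).mul Jet.id).mul (Jet.line (((hu.dd c).dd c).dd c) x b))
  have e1 : (fun s : ℝ => dd (e + s • c) (dd (e + s • c) (dd (e + s • c) u)) (x + s • b)) =
      fun s : ℝ => dd e (dd e (dd e u)) (x + s • b)
        + (3 * s) * dd e (dd e (dd c u)) (x + s • b)
        + (3 * (s * s)) * dd e (dd c (dd c u)) (x + s • b)
        + (s * s * s) * dd c (dd c (dd c u)) (x + s • b) := by
    funext s
    rw [expand3 hu]
  rw [e1]
  exact h.congr (by ring) (by ring) (by ring)

/-- The maximum principle for a sum of logarithms. -/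
theorem log_max {f g r : ℝ → ℝ} {f0 f1 f2 g0 g1 g2 r0 r1 r2 a b c : ℝ}
    (hf : Jet f f0 f1 f2) (hg : Jet g g0 g1 g2) (hr : Jet r r0 r1 r2)
    (pf : 0 < f0) (pg : 0 < g0) (pr : 0 < r0)
    (hm : ∀ᶠ s in 𝓝 (0:ℝ), 0 < f s → 0 < g s → 0 < r s →
      a * Real.log (f s) + b * Real.log (g s) + c * Real.log (r s) ≤
      a * Real.log f0 + b * Real.log g0 + c * Real.log r0) :
    a * (f1 / f0) + b * (g1 / g0) + c * (r1 / r0) = 0 ∧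
    a * (f2 / f0 - (f1 / f0) ^ 2) + b * (g2 / g0 - (g1 / g0) ^ 2)
      + c * (r2 / r0 - (r1 / r0) ^ 2) ≤ 0 := by
  have hJ := (((hf.log pf).smul a).add ((hg.log pg).smul b)).add ((hr.log pr).smul c)
  refine hJ.max ?_
  have ef : f 0 = f0 := by obtain ⟨_, _, h, _⟩ := hf; exact h
  have eg : g 0 = g0 := by obtain ⟨_, _, h, _⟩ := hg; exact h
  have er : r 0 = r0 := by obtain ⟨_, _, h, _⟩ := hr; exact h
  have qf := hf.continuousAt.eventually (lt_mem_nhds (by rw [ef]; exact pf : 0 < f 0))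
  have qg := hg.continuousAt.eventually (lt_mem_nhds (by rw [eg]; exact pg : 0 < g 0))
  have qr := hr.continuousAt.eventually (lt_mem_nhds (by rw [er]; exact pr : 0 < r 0))
  filter_upwards [hm, qf, qg, qr] with s h h1 h2 h3 using h h1 h2 h3

end JCP

namespace JCP

open Filter Topology

variable {n : ℕ}

/-- A solution normalised at `x0`: value and gradient vanish there. -/
structure NSol (u : (Fin n → ℝ) → ℝ) (d : Fin n → ℝ) (d0 : ℝ) (x0 : Fin n → ℝ) : Prop where
  sol : Sol u d d0
  val : u x0 = 0
  grad : ∀ v, dd v u x0 = 0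

theorem NSol.ray {u : (Fin n → ℝ) → ℝ} {d : Fin n → ℝ} {d0 : ℝ} {x0 : Fin n → ℝ}
    (hN : NSol u d d0 x0) {v : Fin n → ℝ} (hv : v ≠ 0) :
    0 < u (x0 + v) ∧ ∀ t : ℝ, 1 ≤ t → t * u (x0 + v) ≤ u (x0 + t • v) := by
  have hu := hN.sol.sm
  have h1 := fun s => hasDerivAt_line hu x0 v s
  have h2 := fun s => hasDerivAt_line (hu.dd v) x0 v s
  have hd1 : deriv (fun s : ℝ => u (x0 + s • v)) = fun s : ℝ => dd v u (x0 + s • v) :=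
    funext fun s => (h1 s).deriv
  have hmono : StrictMono (fun s : ℝ => dd v u (x0 + s • v)) := by
    refine strictMono_of_deriv_pos fun s => ?_
    rw [(h2 s).deriv]; exact hN.sol.pos _ _ hv
  have hconv : ConvexOn ℝ Set.univ (fun s : ℝ => u (x0 + s • v)) := by
    refine Monotone.convexOn_univ_of_deriv (fun s => (h1 s).differentiableAt) ?_
    rw [hd1]; exact hmono.monotone
  have hstr : StrictMonoOn (fun s : ℝ => u (x0 + s • v)) (Set.Ici 0) := by
    refine strictMonoOn_of_deriv_pos (convex_Ici 0)
      (fun s _ => (h1 s).continuousAt.continuousWithinAt) ?_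
    intro s hs
    rw [interior_Ici] at hs
    rw [hd1]
    have := hmono (show (0:ℝ) < s from hs)
    simp only [zero_smul, add_zero] at this
    rw [hN.grad] at this
    exact this
  constructor
  · have := hstr (Set.mem_Ici.2 le_rfl) (Set.mem_Ici.2 zero_le_one) (zero_lt_one' ℝ)
    simpa [hN.val] using this
  · intro t ht
    have t0 : 0 < t := by linarith
    have := hconv.2 (Set.mem_univ t) (Set.mem_univ (0:ℝ)) 
      (show (0:ℝ) ≤ 1 / t by positivity)
      (show (0:ℝ) ≤ 1 - 1 / t by rw [sub_nonneg, div_le_one t0]; exact ht) (by ring)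
    simp only [smul_eq_mul, mul_zero, add_zero, zero_smul, hN.val] at this
    rw [one_div, inv_mul_cancel₀ t0.ne', one_smul, inv_mul_eq_div, le_div_iff₀ t0] at this
    linarith

theorem NSol.nonneg {u : (Fin n → ℝ) → ℝ} {d : Fin n → ℝ} {d0 : ℝ} {x0 : Fin n → ℝ}
    (hN : NSol u d d0 x0) (x : Fin n → ℝ) : 0 ≤ u x := by
  by_cases h : x - x0 = 0
  · rw [sub_eq_zero] at h; rw [h, hN.val]
  · have := (hN.ray h).1
    rw [add_sub_cancel] at this; exact this.le

theorem NSol.compact {u : (Fin n → ℝ) → ℝ} {d : Fin n → ℝ} {d0 : ℝ} {x0 : Fin n → ℝ}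
    (hN : NSol u d d0 x0) (h : ℝ) : IsCompact {x | u x ≤ h} := by
  have hu := hN.sol.sm
  refine Metric.isCompact_of_isClosed_isBounded
    (isClosed_le hu.continuous continuous_const) ?_
  obtain ⟨ε, hε, hb⟩ : ∃ ε > 0, ∀ v : Fin n → ℝ, ‖v‖ = 1 → ε ≤ u (x0 + v) := by
    by_cases hne : (Metric.sphere (0 : Fin n → ℝ) 1).Nonempty
    · obtain ⟨w, hw, hmin⟩ := (isCompact_sphere (0 : Fin n → ℝ) 1).exists_isMinOn hne
        (f := fun v => u (x0 + v)) (by have := hu.continuous; fun_prop)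
      refine ⟨u (x0 + w), (hN.ray ?_).1, fun v hv => hmin (by simpa using hv)⟩
      rintro rfl; simp at hw
    · refine ⟨1, one_pos, fun v hv => (hne ⟨v, by simpa using hv⟩).elim⟩
  refine (Metric.isBounded_closedBall (x := x0) (r := max 1 (h / ε))).subset ?_
  intro x hx
  rw [Metric.mem_closedBall, dist_eq_norm]
  by_cases h1 : ‖x - x0‖ ≤ 1
  · exact h1.trans (le_max_left _ _)
  · push Not at h1
    refine le_trans ?_ (le_max_right _ _)
    have tpos : 0 < ‖x - x0‖ := by linarith
    have hn1 : ‖(‖x - x0‖⁻¹) • (x - x0)‖ = 1 := by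
      rw [norm_smul, norm_inv, norm_norm, inv_mul_cancel₀ tpos.ne']
    have h2 := (hN.ray (v := (‖x - x0‖⁻¹) • (x - x0)) (by
      intro h0; rw [h0] at hn1; simp at hn1)).2 _ h1.le
    rw [smul_smul, mul_inv_cancel₀ tpos.ne', one_smul, add_sub_cancel] at h2
    have h3 := hb _ hn1
    rw [le_div_iff₀ hε]
    have : u x ≤ h := hx
    nlinarith

theorem cont1 {f : (Fin n → ℝ) → ℝ} (hf : Sm f) :
    Continuous (fun p : (Fin n → ℝ) × (Fin n → ℝ) => dd p.2 f p.1) := by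
  have h : Continuous (fderiv ℝ f) :=
    (ContDiff.fderiv_right (m := (⊤ : ℕ∞)) hf (by simp)).continuous
  exact (h.comp continuous_fst).clm_apply continuous_snd

theorem cont2 {f : (Fin n → ℝ) → ℝ} (hf : Sm f) :
    Continuous (fun p : (Fin n → ℝ) × (Fin n → ℝ) => dd p.2 (dd p.2 f) p.1) := by
  have e : (fun p : (Fin n → ℝ) × (Fin n → ℝ) => dd p.2 (dd p.2 f) p.1) =
      fun p => ∑ i, p.2 i * dd p.2 (dd (Pi.single i 1) f) p.1 := by
    funext p
    rw [dd_eq_sum]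
    refine Finset.sum_congr rfl fun i _ => ?_
    change _ * dd (Pi.single i 1) (dd p.2 f) p.1 = _
    rw [dd_comm hf]
  rw [e]
  refine continuous_finsetSum _ fun i _ => ?_
  have := cont1 (hf.dd (Pi.single i 1))
  fun_prop

theorem cont3 {f : (Fin n → ℝ) → ℝ} (hf : Sm f) :
    Continuous (fun p : (Fin n → ℝ) × (Fin n → ℝ) => dd p.2 (dd p.2 (dd p.2 f)) p.1) := by
  have e : (fun p : (Fin n → ℝ) × (Fin n → ℝ) => dd p.2 (dd p.2 (dd p.2 f)) p.1) =
      fun p => ∑ i, p.2 i * dd p.2 (dd p.2 (dd (Pi.single i 1) f)) p.1 := by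
    funext p
    rw [dd_eq_sum]
    refine Finset.sum_congr rfl fun i _ => ?_
    change _ * dd (Pi.single i 1) (dd p.2 (dd p.2 f)) p.1 = _
    rw [dd_comm (hf.dd _), dd_comm hf]
  rw [e]
  refine continuous_finsetSum _ fun i _ => ?_
  have := cont2 (hf.dd (Pi.single i 1))
  fun_prop

/-- Existence of a maximum of a degree-zero homogeneous function. -/
theorem exists_max (hn : 0 < n) {K : Set (Fin n → ℝ)} (hK : IsCompact K) (hne : K.Nonempty)
    (G : (Fin n → ℝ) → (Fin n → ℝ) → ℝ)
    (hc : ContinuousOn (fun p : (Fin n → ℝ) × (Fin n → ℝ) => G p.1 p.2) {p | p.2 ≠ 0})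
    (hom : ∀ x e, ∀ c : ℝ, c ≠ 0 → G x (c • e) = G x e) :
    ∃ x ∈ K, ∃ e ≠ 0, ∀ y ∈ K, ∀ w ≠ 0, G y w ≤ G x e := by
  have : Nonempty (Fin n) := ⟨⟨0, hn⟩⟩
  have hS : (Metric.sphere (0 : Fin n → ℝ) 1).Nonempty := NormedSpace.sphere_nonempty.2 zero_le_one
  obtain ⟨p, hp, hmax⟩ := (hK.prod (isCompact_sphere (0 : Fin n → ℝ) 1)).exists_isMaxOn
    (hne.prod hS) (hc.mono (by
      rintro ⟨a, b⟩ ⟨_, h2⟩ h0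
      simp only at h0 h2
      rw [h0] at h2; simp at h2))
  refine ⟨p.1, hp.1, p.2, ?_, ?_⟩
  · intro h0
    have := hp.2
    rw [h0] at this; simp at this
  · intro y hy w hw
    have hw' : ‖w‖ ≠ 0 := norm_ne_zero_iff.2 hw
    rw [← hom y w (‖w‖⁻¹) (inv_ne_zero hw')]
    exact hmax (a := (y, ‖w‖⁻¹ • w)) ⟨hy, by simp [norm_smul, hw']⟩

/-- Normalisation at a point. -/
theorem Sol.normalize {u : (Fin n → ℝ) → ℝ} {d : Fin n → ℝ} {d0 : ℝ} (hS : Sol u d d0)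
    (x0 : Fin n → ℝ) :
    ∃ u' d0', NSol u' d d0' x0 ∧ ∀ v w, dd v (dd w u') = dd v (dd w u) := by
  have hu := hS.sm
  set L := fderiv ℝ u x0 with hL
  set u' : (Fin n → ℝ) → ℝ := fun x => u x - u x0 - L (x - x0) with hu'
  have hsm : Sm u' := by
    unfold Sm at *
    have := L.contDiff (n := (⊤ : ℕ∞))
    exact (ContDiff.sub hu contDiff_const).sub (this.comp (contDiff_id.sub contDiff_const))
  have h1 : ∀ w x, dd w u' x = dd w u x - L w := by
    intro w x
    have e1 : HasFDerivAt u' (fderiv ℝ u x - L) x := by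
      have a1 := (hu.differentiable x).hasFDerivAt
      have a2 : HasFDerivAt (fun y => L (y - x0)) L x := by
        have a3 := L.hasFDerivAt.comp x ((hasFDerivAt_id x).sub_const x0)
        rw [ContinuousLinearMap.comp_id] at a3
        exact a3
      exact (a1.sub_const (u x0)).sub a2
    unfold dd
    rw [e1.fderiv]; rfl
  have h2 : ∀ v w, dd v (dd w u') = dd v (dd w u) := by
    intro v w
    funext x
    have : dd w u' = fun x => dd w u x - L w := funext (h1 w)
    rw [this]
    unfold dd
    rw [fderiv_sub_const]
  have h3 : ∀ x, hess u' x = hess u x := by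
    intro x
    ext i j
    rw [hess_apply, hess_apply, h2]
  refine ⟨u', d0 + L d, ⟨⟨hsm, ?_, ?_, ?_⟩, ?_, ?_⟩, h2⟩
  · intro x v hv; rw [h2]; exact hS.pos x v hv
  · intro x; rw [h3]; exact hS.hsymm x
  · intro x; rw [h3, hS.pde, h1]; congr 1; ring
  · simp [hu']
  · intro v; rw [h1]; simp [hL, dd]

end JCP

namespace JCP

open Filter Topology

variable {n : ℕ}

theorem scal_ineq {N t b k W V : ℝ} (hN : 1 ≤ N) (hb0 : 0 ≤ b) (hb1 : b ≤ 8 * N)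
    (htb : b ≤ t → 4 * N ≤ b) (hk : 16 * N * (1 + 8 * N) ^ 2 ≤ k)
    (hW : (1 + t) ^ 2 ≤ N * W) (hV : V ≤ 2 * W) :
    1 / (16 * N) ≤ W - t - b * (1 / (4 * N)) + b - (1 / k) * (V + (t - b) ^ 2) := by
  have hN0 : 0 < N := by linarith
  have h81 : (81:ℝ) ≤ (1 + 8 * N) ^ 2 := by nlinarith
  have hk2 : 16 * N ≤ k := by nlinarith
  have hk0 : 0 < k := by linarith
  obtain ⟨a, ha⟩ : ∃ a, a = 1 / k := ⟨_, rfl⟩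
  obtain ⟨m, hm⟩ : ∃ m, m = 1 / N := ⟨_, rfl⟩
  have hm0 : 0 < m := by rw [hm]; positivity
  have hmN : m * N = 1 := by rw [hm]; field_simp
  have ha0 : 0 < a := by rw [ha]; positivity
  have hak : a * k = 1 := by rw [ha]; field_simp
  have ha1 : a * (16 * N) ≤ 1 := by rw [← hak]; exact mul_le_mul_of_nonneg_left hk2 ha0.le
  have ha2 : a * (16 * (1 + 8 * N) ^ 2) ≤ m := by
    have : a * (16 * N * (1 + 8 * N) ^ 2) ≤ 1 := by
      have h := mul_le_mul_of_nonneg_left hk ha0.le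
      rw [hak] at h; exact h
    have := mul_le_mul_of_nonneg_left this hm0.le
    have e : m * (a * (16 * N * (1 + 8 * N) ^ 2)) = (m * N) * (a * (16 * (1 + 8 * N) ^ 2)) := by ring
    rw [e, hmN] at this
    linarith
  have ha3 : a * 16 ≤ m := by
    have := mul_le_mul_of_nonneg_left ha1 hm0.le
    have e : m * (a * (16 * N)) = (m * N) * (a * 16) := by ring
    rw [e, hmN] at this
    linarith
  have hm1 : m ≤ 1 := by nlinarith
  have hW' : m * (1 + t) ^ 2 ≤ W := by
    have := mul_le_mul_of_nonneg_left hW hm0.le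
    rw [← mul_assoc, hmN] at this; linarith
  have hW0 : 0 ≤ W := le_trans (by positivity) hW'
  have e1 : 1 / (16 * N) = m / 16 := by rw [hm]; field_simp
  have e2 : 1 / (4 * N) = m / 4 := by rw [hm]; field_simp
  rw [e1, e2, ← ha]
  have hVa : a * V ≤ W / 2 := by
    have : a * V ≤ a * (2 * W) := mul_le_mul_of_nonneg_left hV ha0.le
    nlinarith
  suffices h : m / 16 ≤ m * (1 + t) ^ 2 / 2 - t - b * (m / 4) + b - a * (t - b) ^ 2 by
    have : a * (V + (t - b) ^ 2) = a * V + a * (t - b) ^ 2 := by ring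
    linarith
  rcases lt_or_ge t b with hlt | hge
  · have hX : a * (16 * (1 + b) ^ 2) ≤ m := by
      refine le_trans ?_ ha2
      have : (1 + b) ^ 2 ≤ (1 + 8 * N) ^ 2 := by nlinarith
      nlinarith
    have h1 : (t - b) ^ 2 ≤ 2 * (1 + t) ^ 2 + 2 * (1 + b) ^ 2 := by nlinarith [sq_nonneg (t + b + 2)]
    have h2 : a * (t - b) ^ 2 ≤ m / 8 * (1 + t) ^ 2 + m / 8 := by
      have := mul_le_mul_of_nonneg_left h1 ha0.le
      have h3 : a * 16 * (1 + t) ^ 2 ≤ m * (1 + t) ^ 2 :=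
        mul_le_mul_of_nonneg_right ha3 (sq_nonneg _)
      linarith
    have h4 : m * (b - t) ≤ b - t := by nlinarith
    have h5 : 0 ≤ m * (3/8 * (1 + t) ^ 2 + (b - t) - b / 4 - 1/8 - 1/16) := by
      refine mul_nonneg hm0.le ?_
      nlinarith [sq_nonneg (1 + t - 4/3)]
    linarith
  · have hb4 := htb hge
    have h1 : (t - b) ^ 2 ≤ (1 + t) ^ 2 := by
      linarith [mul_nonneg (show 0 ≤ 1 + b by linarith) (show 0 ≤ 1 + 2 * t - b by linarith)]
    have h2 : a * (t - b) ^ 2 ≤ m / 16 * (1 + t) ^ 2 := by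
      have := mul_le_mul_of_nonneg_left h1 ha0.le
      have h3 : a * 16 * (1 + t) ^ 2 ≤ m * (1 + t) ^ 2 :=
        mul_le_mul_of_nonneg_right ha3 (sq_nonneg _)
      linarith
    have h3 : 4 * t ≤ m * (1 + t) ^ 2 := by
      have : 4 * N * t ≤ (1 + t) ^ 2 := by
        linarith [mul_nonneg (show 0 ≤ t by linarith) (show 0 ≤ t - 4 * N by linarith)]
      have := mul_le_mul_of_nonneg_left this hm0.le
      have e : m * (4 * N * t) = (m * N) * (4 * t) := by ring
      rw [e, hmN] at this; linarith
    have h6 : b * (m / 4) ≤ b := by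
      linarith [mul_nonneg hb0 (show 0 ≤ 1 - m / 4 by linarith)]
    linarith

theorem var_ineq (p μ : Fin n → ℝ) (hp : ∀ i, 0 ≤ p i) (hs : ∑ i, p i = 1) :
    ∑ i, p i * μ i ^ 2 - (∑ i, p i * μ i) ^ 2 ≤ 2 * (∑ i, μ i ^ 2 - ∑ i, p i * μ i ^ 2) := by
  have h1 : ∑ i, (4 * p i ^ 2 * μ i ^ 2) ≤ ∑ i, ∑ j, p i * p j * (μ i + μ j) ^ 2 := by
    refine Finset.sum_le_sum fun i _ => ?_
    refine le_trans (le_of_eq ?_) (Finset.single_le_sum (f := fun j => p i * p j * (μ i + μ j) ^ 2)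
      (fun j _ => mul_nonneg (mul_nonneg (hp i) (hp j)) (sq_nonneg _)) (Finset.mem_univ i))
    ring
  have h2 : ∑ i, ∑ j, p i * p j * (μ i + μ j) ^ 2 =
      2 * ∑ i, p i * μ i ^ 2 + 2 * (∑ i, p i * μ i) ^ 2 := by
    have e : ∀ i, ∑ j, p i * p j * (μ i + μ j) ^ 2 =
        p i * μ i ^ 2 + 2 * (p i * μ i) * ∑ j, p j * μ j + p i * ∑ j, p j * μ j ^ 2 := by
      intro i
      have : ∀ j, p i * p j * (μ i + μ j) ^ 2 = (p i * μ i ^ 2) * p j +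
        2 * (p i * μ i) * (p j * μ j) + p i * (p j * μ j ^ 2) := fun j => by ring
      simp only [this, Finset.sum_add_distrib, ← Finset.mul_sum, hs]; ring
    simp only [e, Finset.sum_add_distrib, ← Finset.sum_mul, ← Finset.mul_sum, hs]
    ring
  have h3 : ∑ i, (p i * μ i ^ 2 - p i ^ 2 * μ i ^ 2) ≤ ∑ i, (μ i ^ 2 - p i * μ i ^ 2) := by
    refine Finset.sum_le_sum fun i _ => ?_
    nlinarith [mul_nonneg (sq_nonneg (1 - p i)) (sq_nonneg (μ i))]
  rw [Finset.sum_sub_distrib, Finset.sum_sub_distrib] at h3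
  have h4 : ∑ i, (4 * p i ^ 2 * μ i ^ 2) = 4 * ∑ i, (p i ^ 2 * μ i ^ 2) := by
    rw [Finset.mul_sum]; exact Finset.sum_congr rfl fun i _ => by ring
  rw [h4, h2] at h1
  linarith

theorem main_ineq (hn : 1 ≤ n) (p μ : Fin n → ℝ) {t b k : ℝ} (hp : ∀ i, 0 ≤ p i)
    (hs : ∑ i, p i = 1) (hμ : ∑ i, μ i = -1) (ht : t = ∑ i, p i * μ i)
    (hb0 : 0 ≤ b) (hb1 : b ≤ 8 * n)
    (htb : b ≤ t → 4 * n ≤ b) (hk : 16 * (n:ℝ) * (1 + 8 * n) ^ 2 ≤ k) :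
    1 / (16 * (n:ℝ)) ≤ ∑ i, μ i ^ 2 - t - ∑ i, p i * μ i ^ 2 - b * (1 / (4 * n)) + b
      - (1 / k) * ∑ i, p i * (μ i - b) ^ 2 := by
  have hp1 : ∀ i, p i ≤ 1 := by
    intro i; rw [← hs]; exact Finset.single_le_sum (fun j _ => hp j) (Finset.mem_univ i)
  have hW : (1 + t) ^ 2 ≤ (n:ℝ) * (∑ i, μ i ^ 2 - ∑ i, p i * μ i ^ 2) := by
    have h1 : ∑ i, (1 - p i) * μ i = -(1 + t) := by
      simp only [sub_mul, one_mul, Finset.sum_sub_distrib, hμ, ← ht]; ring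
    have h2 : (∑ i, (1 - p i) * μ i) ^ 2 ≤ n * ∑ i, ((1 - p i) * μ i) ^ 2 := by
      simpa using sq_sum_le_card_mul_sum_sq (s := Finset.univ) (f := fun i => (1 - p i) * μ i)
    have h3 : ∑ i, ((1 - p i) * μ i) ^ 2 ≤ ∑ i, (μ i ^ 2 - p i * μ i ^ 2) := by
      refine Finset.sum_le_sum fun i _ => ?_
      have := mul_nonneg (mul_nonneg (hp i) (sub_nonneg.2 (hp1 i))) (sq_nonneg (μ i))
      nlinarith
    rw [Finset.sum_sub_distrib] at h3
    rw [h1] at h2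
    have : (0:ℝ) ≤ n := Nat.cast_nonneg n
    nlinarith
  have hV := var_ineq p μ hp hs
  rw [← ht] at hV
  have e : ∑ i, p i * (μ i - b) ^ 2 = (∑ i, p i * μ i ^ 2 - t ^ 2) + (t - b) ^ 2 := by
    have : ∀ i, p i * (μ i - b) ^ 2 = p i * μ i ^ 2 - 2 * b * (p i * μ i) + b ^ 2 * p i :=
      fun i => by ring
    simp only [this, Finset.sum_add_distrib, Finset.sum_sub_distrib, ← Finset.mul_sum, hs, ← ht]
    ring
  rw [e]
  have := scal_ineq (N := (n:ℝ)) (by exact_mod_cast hn) hb0 hb1 htb hk hW hV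
  linarith

end JCP

namespace JCP

open Filter Topology

variable {n : ℕ}

set_option maxHeartbeats 1000000 in
theorem alg_est (hn : 1 ≤ n) (dv uu lam F2 : Fin n → ℝ) {Φ r k E g K δ q : ℝ}
    (hΦ : 0 < Φ) (hr : 0 < r) (hk : 16 * (n:ℝ) * (1 + 8 * n) ^ 2 ≤ k)
    (hE : E = Real.exp (δ * q)) (hg : g = 1 + E) (hK : K = 32 * (n:ℝ) ^ 2)
    (hδ : δ = 1 / (4 * n))
    (hΦs : Φ = ∑ i, dv i * dv i) (hq : q = ∑ i, dv i * uu i) (hl : ∑ i, lam i = -Φ)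
    (hF : ∑ i, F2 i = ∑ i, lam i ^ 2 - ∑ i, dv i * (dv i * lam i))
    (h1 : ∀ i, 1 * (dv i * lam i / Φ) + (-K) * (E * (δ * dv i) / g) + k * (-uu i / r) = 0)
    (h2 : ∀ i, 1 * (F2 i / Φ - (dv i * lam i / Φ) ^ 2)
      + (-K) * (E * ((δ * dv i) ^ 2 + δ * lam i) / g - (E * (δ * dv i) / g) ^ 2)
      + k * (-1 / r - (-uu i / r) ^ 2) ≤ 0) :
    Φ * r ≤ 16 * (n:ℝ) ^ 2 * k := by
  have hN : (1:ℝ) ≤ n := by exact_mod_cast hn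
  have hN0 : (0:ℝ) < n := by linarith
  have hE0 : 0 < E := by rw [hE]; exact Real.exp_pos _
  have hg0 : 0 < g := by rw [hg]; linarith
  have hk0 : 0 < k := lt_of_lt_of_le (by positivity) hk
  have hδ0 : 0 < δ := by rw [hδ]; positivity
  obtain ⟨σ, hσ⟩ : ∃ σ, σ = E / g := ⟨_, rfl⟩
  have hσ0 : 0 < σ := by rw [hσ]; positivity
  have hσ1 : σ < 1 := by rw [hσ, div_lt_one hg0]; linarith
  have hKδ : K * δ = 8 * n := by rw [hK, hδ]; field_simp; norm_num
  obtain ⟨b, hb⟩ : ∃ b, b = K * δ * σ := ⟨_, rfl⟩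
  have hb' : b = 8 * n * σ := by rw [hb, hKδ]
  have hb0 : 0 ≤ b := by rw [hb']; positivity
  have hb1 : b ≤ 8 * n := by rw [hb']; nlinarith
  have hu : ∀ i, uu i / r = (1 / k) * (dv i * (lam i / Φ - b)) := by
    intro i
    have := h1 i
    have e : E * (δ * dv i) / g = σ * (δ * dv i) := by rw [hσ]; ring
    rw [e] at this
    have e2 : k * (uu i / r) = dv i * (lam i / Φ - b) := by
      rw [hb]; linear_combination -this
    rw [← e2]; field_simp
  obtain ⟨t, ht⟩ : ∃ t, t = ∑ i, (dv i * dv i / Φ) * (lam i / Φ) := ⟨_, rfl⟩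
  have hp1 : ∑ i, dv i * dv i / Φ = 1 := by
    rw [← Finset.sum_div, ← hΦs, div_self hΦ.ne']
  have hμ : ∑ i, lam i / Φ = -1 := by
    rw [← Finset.sum_div, hl, neg_div, div_self hΦ.ne']
  have hqt : q = r / k * Φ * (t - b) := by
    have e : ∀ i, dv i * uu i =
        r / k * Φ * ((dv i * dv i / Φ) * (lam i / Φ) - b * (dv i * dv i / Φ)) := by
      intro i
      have : uu i = r * (uu i / r) := by field_simp
      rw [this, hu i]; field_simp
    rw [hq, Finset.sum_congr rfl fun i _ => e i, ← Finset.mul_sum, Finset.sum_sub_distrib,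
      ← Finset.mul_sum, hp1, ← ht, mul_one]
  have htb : b ≤ t → 4 * n ≤ b := by
    intro h
    have hq0 : 0 ≤ q := by
      rw [hqt]; exact mul_nonneg (by positivity) (by linarith)
    have : 1 ≤ E := by rw [hE]; exact Real.one_le_exp (by positivity)
    have : 1 / 2 ≤ σ := by rw [hσ, div_le_div_iff₀ (by norm_num) hg0]; linarith
    rw [hb']; nlinarith
  have hmain := main_ineq hn (fun i => dv i * dv i / Φ) (fun i => lam i / Φ)
    (fun i => div_nonneg (mul_self_nonneg _) hΦ.le) hp1 hμ ht hb0 hb1 htb hk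
  -- summed second-order inequality
  have h3 : ∀ i, F2 i / Φ - Φ * ((dv i * dv i / Φ) * (lam i / Φ) ^ 2) - b * δ * (dv i * dv i)
      - b * lam i - k / r - (1 / k) * Φ * ((dv i * dv i / Φ) * (lam i / Φ - b) ^ 2) ≤ 0 := by
    intro i
    refine le_trans ?_ (h2 i)
    have e1 : -uu i / r = - (uu i / r) := by ring
    have e2 : E * ((δ * dv i) ^ 2 + δ * lam i) / g = σ * ((δ * dv i) ^ 2 + δ * lam i) := by
      rw [hσ]; ring
    have e3 : E * (δ * dv i) / g = σ * (δ * dv i) := by rw [hσ]; ring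
    rw [e1, hu, e2, e3]
    have e4 : k * (-1 / r - (-(1 / k * (dv i * (lam i / Φ - b)))) ^ 2) =
        -(k / r) - (1 / k) * (dv i * dv i * (lam i / Φ - b) ^ 2) := by field_simp
    have e5 : 1 / k * Φ * (dv i * dv i / Φ * (lam i / Φ - b) ^ 2) =
        (1 / k) * (dv i * dv i * (lam i / Φ - b) ^ 2) := by field_simp
    have e6 : Φ * (dv i * dv i / Φ * (lam i / Φ) ^ 2) = (dv i * lam i / Φ) ^ 2 := by
      field_simp
    rw [e4, e5, e6]
    have hK0 : 0 ≤ K := by rw [hK]; positivity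
    have : 0 ≤ K * (σ * δ * dv i) ^ 2 := by positivity
    rw [hb]
    linarith
  have h4 := Finset.sum_nonpos fun i (_ : i ∈ Finset.univ) => h3 i
  simp only [Finset.sum_sub_distrib, ← Finset.mul_sum, ← Finset.sum_div, hF, hl, ← hΦs,
    Finset.sum_const, Finset.card_univ, Fintype.card_fin, nsmul_eq_mul] at h4
  have hS1 : ∑ i, (lam i / Φ) ^ 2 = (∑ i, lam i ^ 2) / Φ ^ 2 := by
    simp only [div_pow, Finset.sum_div]
  have hS2 : t = (∑ i, dv i * (dv i * lam i)) / Φ ^ 2 := by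
    rw [ht, Finset.sum_div]
    exact Finset.sum_congr rfl fun i _ => by field_simp
  obtain ⟨A, hA⟩ : ∃ A, A = ∑ i, dv i * dv i / Φ * (lam i / Φ) ^ 2 := ⟨_, rfl⟩
  obtain ⟨B, hB⟩ : ∃ A, A = ∑ i, dv i * dv i / Φ * (lam i / Φ - b) ^ 2 := ⟨_, rfl⟩
  obtain ⟨S, hS⟩ : ∃ A, A = ∑ i, lam i ^ 2 := ⟨_, rfl⟩
  obtain ⟨R, hR⟩ : ∃ A, A = ∑ i, dv i * (dv i * lam i) := ⟨_, rfl⟩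
  rw [hS1, ← hA, ← hB, ← hS, hS2, ← hR, ← hδ] at hmain
  rw [← hA, ← hB, ← hS, ← hR] at h4
  have h5 : Φ * (1 / (16 * (n:ℝ))) ≤ n * (k / r) := by
    have := mul_le_mul_of_nonneg_left hmain hΦ.le
    refine this.trans ?_
    have e : Φ * (S / Φ ^ 2 - R / Φ ^ 2 - A - b * δ + b - 1 / k * B) =
      (S - R) / Φ - Φ * A - b * δ * Φ - b * (-Φ) - 1 / k * Φ * B := by field_simp; ring
    rw [e, ← mul_div_assoc]; linarith
  have h6 : Φ * r * (1 / (16 * (n:ℝ))) ≤ n * k := by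
    have := mul_le_mul_of_nonneg_left h5 hr.le
    have e : r * (n * (k / r)) = n * k := by field_simp
    rw [e] at this; linarith
  rw [mul_one_div, div_le_iff₀ (by positivity)] at h6
  linarith

theorem Sol.point_est {u : (Fin n → ℝ) → ℝ} {d : Fin n → ℝ} {d0 : ℝ} (hS : Sol u d d0)
    (hn : 1 ≤ n) (hd : d ≠ 0) {h δ : ℝ} {k K : ℕ} (hδ : δ = 1 / (4 * n)) (hK : K = 32 * n ^ 2)
    (hk : k = 16 * n * (1 + 8 * n) ^ 2) (x : Fin n → ℝ) (hx : u x < h)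
    (hm : ∀ y, u y < h →
      (h - u y) ^ k * dd d (dd d u) y / (1 + Real.exp (δ * dd d u y)) ^ K ≤
      (h - u x) ^ k * dd d (dd d u) x / (1 + Real.exp (δ * dd d u x)) ^ K) :
    dd d (dd d u) x * (h - u x) ≤ 16 * (n:ℝ) ^ 2 * k := by
  have hu := hS.sm
  have hlog : ∀ y, u y < h →
      Real.log ((h - u y) ^ k * dd d (dd d u) y / (1 + Real.exp (δ * dd d u y)) ^ K) =
      1 * Real.log (dd d (dd d u) y) + (-K) * Real.log (1 + Real.exp (δ * dd d u y))
        + k * Real.log (h - u y) := by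
    intro y hy
    have p1 : 0 < h - u y := by linarith
    have p2 := hS.pos y d hd
    have p3 : 0 < 1 + Real.exp (δ * dd d u y) := by positivity
    rw [Real.log_div (by positivity) (by positivity), Real.log_mul (by positivity) (by positivity),
      Real.log_pow, Real.log_pow]
    ring
  obtain ⟨b, lam, c1, c2, c3, k1, k2, -⟩ := hS.frame x d
  have hdd : ∀ f : (Fin n → ℝ) → ℝ, dd d f x = ∑ i, dd (b i) (dd d u) x * dd (b i) f x := by
    intro f
    conv_lhs => rw [c3 d]
    rw [dd_sum_dir]
  have hT : ∀ i, dd (b i) (dd d (dd d u)) x = dd (b i) (dd d u) x * lam i := by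
    intro i
    rw [dd_comm (hu.dd _), hdd]
    simp [c2]
  have hlm : ∀ i, _ := fun i => log_max (a := 1) (b := -(K:ℝ)) (c := k)
    (Jet.line ((hu.dd d).dd d) x (b i))
    ((Jet.const 1).add ((Jet.line (hu.dd d) x (b i)).smul δ).exp)
    ((Jet.const h).add ((Jet.line hu x (b i)).smul (-1)))
    (hS.pos x d hd) (by positivity) (by linarith) (by
      refine Eventually.of_forall fun s h1 h2 h3 => ?_
      have hy : u (x + s • b i) < h := by linarith
      have e : ∀ y, h + -1 * u y = h - u y := fun y => by ring
      rw [e, e, ← hlog x hx, ← hlog _ hy]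
      refine Real.log_le_log ?_ (hm _ hy)
      have p1 : 0 < h - u (x + s • b i) := by linarith
      positivity)
  refine alg_est hn (fun i => dd (b i) (dd d u) x) (fun i => dd (b i) u x) lam
    (fun i => dd (b i) (dd (b i) (dd d (dd d u))) x) (K := K) (δ := δ) (q := dd d u x)
    (hS.pos x d hd) (by linarith) (by rw [hk]; push_cast; exact le_rfl) rfl rfl
    (by rw [hK]; push_cast; rfl) hδ (hdd _) (hdd _) k1 ?_ ?_ ?_
  · rw [k2, hdd (dd d (dd d u))]
    simp only [hT]
  · intro i
    have := (hlm i).1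
    rw [hT] at this
    simp only [zero_add, neg_one_mul, ← sub_eq_add_neg h] at this
    exact this
  · intro i
    have := (hlm i).2
    have q1 := c1 i i
    have q2 := c2 i i
    rw [if_pos rfl] at q1 q2
    rw [hT, q1, q2] at this
    simp only [zero_add, neg_one_mul, ← sub_eq_add_neg h] at this
    exact this

theorem NSol.d_zero {u : (Fin n → ℝ) → ℝ} {d : Fin n → ℝ} {d0 : ℝ} {x0 : Fin n → ℝ}
    (hN : NSol u d d0 x0) (hn : 1 ≤ n) : d = 0 := by
  by_contra hd
  have hS := hN.sol
  have hu := hS.sm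
  obtain ⟨δ, hδ⟩ : ∃ δ : ℝ, δ = 1 / (4 * n) := ⟨_, rfl⟩
  obtain ⟨K, hK⟩ : ∃ K : ℕ, K = 32 * n ^ 2 := ⟨_, rfl⟩
  obtain ⟨k, hk⟩ : ∃ K : ℕ, K = 16 * n * (1 + 8 * n) ^ 2 := ⟨_, rfl⟩
  have hk0 : k ≠ 0 := by rw [hk]; positivity
  obtain ⟨C, hC⟩ : ∃ C : ℝ, C = 16 * (n:ℝ) ^ 2 * k := ⟨_, rfl⟩
  have hC0 : 0 ≤ C := by rw [hC]; positivity
  have hΦ := hS.pos x0 d hd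
  have key : ∀ h : ℝ, 0 < h → h * dd d (dd d u) x0 ≤ 2 ^ K * C := by
    intro h hh
    obtain ⟨x, hx, hmax⟩ := (hN.compact h).exists_isMaxOn (f := fun y =>
      (h - u y) ^ k * dd d (dd d u) y / (1 + Real.exp (δ * dd d u y)) ^ K)
      ⟨x0, by simp [hN.val, hh.le]⟩ (by
        have a1 := hu.continuous
        have a2 := (hu.dd d).continuous
        have a3 := ((hu.dd d).dd d).continuous
        refine Continuous.continuousOn ?_
        refine Continuous.div (by fun_prop) (by fun_prop) fun y => ?_
        positivity)
    have hx : u x ≤ h := hx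
    have h0 := hmax (a := x0) (by simp [hN.val, hh.le])
    simp only [Set.mem_ofPred_eq, hN.val, hN.grad, sub_zero, mul_zero, Real.exp_zero] at h0
    rw [show (1:ℝ) + 1 = 2 by norm_num] at h0
    have hpos : 0 < h ^ k * dd d (dd d u) x0 / 2 ^ K := by positivity
    have hlt : u x < h := by
      rcases hx.lt_or_eq with h1 | h1
      · exact h1
      · rw [h1, sub_self, zero_pow hk0, zero_mul, zero_div] at h0
        linarith
    have hest := hS.point_est hn hd hδ hK hk x hlt (fun y hy => hmax (a := y) hy.le)
    rw [← hC] at hest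
    obtain ⟨m, rfl⟩ : ∃ m, k = m + 1 := ⟨k - 1, by omega⟩
    have hr0 : 0 < h - u x := by linarith
    have hrh : h - u x ≤ h := by linarith [hN.nonneg x]
    have h2 : (h - u x) ^ (m + 1) * dd d (dd d u) x / (1 + Real.exp (δ * dd d u x)) ^ K
        ≤ h ^ m * C := by
      have g1 : (1:ℝ) ≤ (1 + Real.exp (δ * dd d u x)) ^ K :=
        one_le_pow₀ (by linarith [Real.exp_pos (δ * dd d u x)])
      have p2 := hS.pos x d hd
      refine (div_le_self (by positivity) g1).trans ?_
      rw [pow_succ, mul_assoc, mul_comm (h - u x)]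
      exact mul_le_mul (pow_le_pow_left₀ hr0.le hrh m) hest (by positivity) (by positivity)
    have h3 := h0.trans h2
    rw [div_le_iff₀ (by positivity), pow_succ] at h3
    have hp : 0 < h ^ m := by positivity
    refine le_of_mul_le_mul_left ?_ hp
    linarith
  have := key ((2 ^ K * C + 1) / dd d (dd d u) x0) (by positivity)
  rw [div_mul_cancel₀ _ hΦ.ne'] at this
  linarith

end JCP

namespace JCP

open Filter Topology

variable {n : ℕ}

theorem dd_zero_fun (v : Fin n → ℝ) : dd v (0 : (Fin n → ℝ) → ℝ) = 0 := by
  funext x; simp [dd]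

theorem scale2 {u : (Fin n → ℝ) → ℝ} (hu : Sm u) (c : ℝ) (e x : Fin n → ℝ) :
    dd (c • e) (dd (c • e) u) x = c ^ 2 * dd e (dd e u) x := by
  rw [dd_smul_dir c e u, dd_smul_fun (hu.dd _), dd_smul_dir]
  simp only [Pi.smul_apply, smul_eq_mul]; ring

theorem scale3 {u : (Fin n → ℝ) → ℝ} (hu : Sm u) (c : ℝ) (e x : Fin n → ℝ) :
    dd (c • e) (dd (c • e) (dd (c • e) u)) x = c ^ 3 * dd e (dd e (dd e u)) x := by
  rw [dd_smul_dir c e u, dd_smul_fun (hu.dd _), dd_smul_fun ((hu.dd _).dd _), Pi.smul_apply,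
    scale2 (hu.dd _), smul_eq_mul]; ring

theorem quad_lin {a c : ℝ} (h : ∀ s : ℝ, 0 ≤ 2 * s * a + s ^ 2 * c) : a = 0 := by
  by_contra ha
  have h1 := h (-a / (|c| + 1))
  have hc : 0 < |c| + 1 := by positivity
  have e : 2 * (-a / (|c| + 1)) * a + (-a / (|c| + 1)) ^ 2 * c =
      a ^ 2 * (c - 2 * (|c| + 1)) / (|c| + 1) ^ 2 := by field_simp; ring
  rw [e] at h1
  have h2 : a ^ 2 * (c - 2 * (|c| + 1)) / (|c| + 1) ^ 2 < 0 := by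
    refine div_neg_of_neg_of_pos ?_ (by positivity)
    refine mul_neg_of_pos_of_neg (by positivity) ?_
    have := le_abs_self c
    have := abs_nonneg c
    linarith
  linarith

theorem sum_sq_ge (lam : Fin n → ℝ) (hl : ∑ i, lam i = 0) (i : Fin n) :
    (n:ℝ) * lam i ^ 2 ≤ (n - 1) * ∑ j, lam j ^ 2 := by
  classical
  have hn : 1 ≤ n := by have := i.pos; omega
  have h1 := Finset.add_sum_erase Finset.univ lam (Finset.mem_univ i)
  have h2 := Finset.add_sum_erase Finset.univ (fun j => lam j ^ 2) (Finset.mem_univ i)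
  have h3 := sq_sum_le_card_mul_sum_sq (s := Finset.univ.erase i) (f := lam)
  rw [Finset.card_erase_of_mem (Finset.mem_univ i), Finset.card_univ, Fintype.card_fin,
    Nat.cast_sub hn, Nat.cast_one] at h3
  rw [hl] at h1
  have e : ∑ j ∈ Finset.univ.erase i, lam j = - lam i := by linarith
  rw [e] at h3
  rw [← h2]
  linarith

theorem algP (hn : 2 ≤ n) (v lam D4 : Fin n → ℝ) {P r : ℝ} (hP : 0 < P) (hr : 0 < r)
    (hPs : P = ∑ i, v i * v i) (hl : ∑ i, lam i = 0) (h4 : ∑ i, D4 i = ∑ i, lam i ^ 2)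
    (h1 : ∀ i, (2 - lam i) * v i / P + n * (-v i / r) = 0)
    (h2 : ∀ i, (2 - 2 * lam i + 2 * lam i ^ 2 - D4 i) / P - ((2 - lam i) * v i / P) ^ 2
      + n * (-1 / r - (-v i / r) ^ 2) ≤ 0) :
    P ≤ n * (n + 3) * r := by
  have hN : (2:ℝ) ≤ n := by exact_mod_cast hn
  obtain ⟨i, hi⟩ : ∃ i, v i ≠ 0 := by
    by_contra hcon
    push Not at hcon
    rw [hPs] at hP
    simp [hcon] at hP
  obtain ⟨σ, hσ⟩ : ∃ σ, σ = n * P / r := ⟨_, rfl⟩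
  have hσ0 : 0 < σ := by rw [hσ]; positivity
  have hli : lam i = 2 - σ := by
    have := h1 i
    have e : v i * ((2 - lam i) / P - n / r) = 0 := by rw [← this]; ring
    have e2 := (mul_eq_zero.1 e).resolve_left hi
    rw [hσ]
    field_simp at e2 ⊢
    linarith
  have h3 : ∀ j, (2 - 2 * lam j + 2 * lam j ^ 2 - D4 j) / P - (n ^ 2 + n) / r ^ 2 * (v j * v j)
      - n / r ≤ 0 := by
    intro j
    refine le_trans (le_of_eq ?_) (h2 j)
    have e : (2 - lam j) * v j / P = n * (v j / r) := by have := h1 j; linear_combination this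
    rw [e]; field_simp; ring
  have h5 := Finset.sum_nonpos fun i (_ : i ∈ Finset.univ) => h3 i
  simp only [Finset.sum_sub_distrib, Finset.sum_add_distrib, ← Finset.mul_sum, ← Finset.sum_div,
    hl, h4, ← hPs, Finset.sum_const, Finset.card_univ, Fintype.card_fin, nsmul_eq_mul] at h5
  have h6 := sum_sq_ge lam hl i
  rw [hli] at h6
  obtain ⟨S, hS⟩ : ∃ A, A = ∑ i, lam i ^ 2 := ⟨_, rfl⟩
  rw [← hS] at h5 h6
  have h7 : n * (2 * n + S) - (n + 1) * σ ^ 2 - n ^ 2 * σ ≤ 0 := by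
    have := mul_le_mul_of_nonneg_left h5 (show 0 ≤ n * P by positivity)
    rw [mul_zero (n * P)] at this
    refine le_trans (le_of_eq ?_) this
    rw [hσ]; field_simp; ring
  have h8 : σ ≤ n ^ 2 * (n + 3) := by
    have h9 := mul_le_mul_of_nonneg_left h7 (show (0:ℝ) ≤ n - 1 by linarith)
    have h10 := mul_le_mul_of_nonneg_left h6 (show (0:ℝ) ≤ n by linarith)
    have h11 : σ * (σ - n ^ 2 * (n + 3)) ≤ 0 := by
      have : (0:ℝ) ≤ (n - 1) * n * (2 * n) :=
        mul_nonneg (mul_nonneg (by linarith) (by linarith)) (by linarith)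
      have : (0:ℝ) ≤ n ^ 2 := by positivity
      linarith
    by_contra hcon
    push Not at hcon
    have := mul_pos hσ0 (sub_pos.2 hcon)
    linarith
  rw [hσ, div_le_iff₀ hr] at h8
  have hn0 : (0:ℝ) < n := by linarith
  refine le_of_mul_le_mul_left ?_ hn0
  linarith

theorem Sol.pointP {u : (Fin n → ℝ) → ℝ} {d0 : ℝ} (hS : Sol u 0 d0) (hn : 2 ≤ n)
    {h P : ℝ} (x v : Fin n → ℝ) (hx : u x < h) (hP : 0 < P) (hv1 : dd v u x = P)
    (hv2 : dd v (dd v u) x = P)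
    (hm : ∀ y w, u y < h → (h - u y) ^ n * (dd w u y) ^ 2 ≤
      (h - u x) ^ n * P * dd w (dd w u) y) :
    P ≤ n * (n + 3) * (h - u x) := by
  have hu := hS.sm
  have hr : 0 < h - u x := by linarith
  have hgrad : ∀ w, dd v (dd w u) x = dd w u x := by
    intro w
    have : P * (dd v (dd w u) x - dd w u x) = 0 := by
      refine quad_lin (c := P * dd w (dd w u) x - (dd w u x) ^ 2) fun s => ?_
      have h1 := hm x (v + s • w) hx
      rw [mul_assoc] at h1
      have h2 := le_of_mul_le_mul_left h1 (by positivity : 0 < (h - u x) ^ n)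
      rw [expand2 hu, dd_add_dir, dd_smul_dir, hv2] at h2
      simp only [Pi.add_apply, Pi.smul_apply, smul_eq_mul, hv1] at h2
      linarith
    have := (mul_eq_zero.1 this).resolve_left hP.ne'
    linarith
  obtain ⟨b, lam, c1, c2, c3, k1, k2, -⟩ := hS.frame x v
  rw [dd_zero_dir, dd_zero_fun] at k1 k2
  rw [dd_zero_fun] at k2
  simp only [Pi.zero_apply, neg_zero, sub_zero] at k1 k2
  have hdd : ∀ f : (Fin n → ℝ) → ℝ, dd v f x = ∑ i, dd (b i) u x * dd (b i) f x := by
    intro f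
    conv_lhs => rw [c3 v]
    rw [dd_sum_dir]
    refine Finset.sum_congr rfl fun i _ => ?_
    rw [dd_comm hu, hgrad]
  have hT : ∀ i, dd (b i) (dd v (dd v u)) x = dd (b i) u x * lam i := by
    intro i
    rw [dd_comm (hu.dd _), hdd]
    simp [c2]
  have cs : ∀ i, dd ((1 - lam i) • b i) u = (1 - lam i) • dd (b i) u := fun i => dd_smul_dir _ _ _
  have hlm : ∀ i, _ := fun i => log_max (a := 1) (b := 0) (c := n)
    (((Jet.tensor1 hu x (b i) v ((1 - lam i) • b i)).smul 2).add
      ((Jet.tensor2 hu x (b i) v ((1 - lam i) • b i)).smul (-1)))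
    (Jet.const 1)
    ((Jet.const h).add ((Jet.line hu x (b i)).smul (-1)))
    (by rw [hv1, hv2]; linarith) one_pos (by linarith) (by
      refine Eventually.of_forall fun s h1 _ h3 => ?_
      obtain ⟨y, hy⟩ : ∃ y, y = x + s • b i := ⟨_, rfl⟩
      obtain ⟨w, hw⟩ : ∃ y, y = v + s • ((1 - lam i) • b i) := ⟨_, rfl⟩
      rw [← hy, ← hw] at h1
      rw [← hy] at h3
      rw [← hy, ← hw, hv1, hv2]
      have hyh : u y < h := by linarith
      have hw0 : w ≠ 0 := by
        intro h0
        rw [h0, dd_zero_dir, dd_zero_dir] at h1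
        simp at h1
      have hp := hS.pos y w hw0
      have m1 := hm y w hyh
      have r1 : 0 < h - u y := by linarith
      have m2 : (h - u y) ^ n * (2 * dd w u y + -1 * dd w (dd w u) y) ≤ (h - u x) ^ n * P := by
        refine le_of_mul_le_mul_right ?_ hp
        refine le_trans ?_ m1
        rw [mul_assoc]
        refine mul_le_mul_of_nonneg_left ?_ (by positivity)
        nlinarith [sq_nonneg (dd w u y - dd w (dd w u) y)]
      have m3 := Real.log_le_log (mul_pos (by positivity) h1) m2
      rw [Real.log_mul (by positivity) h1.ne', Real.log_mul (by positivity) (by positivity),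
        Real.log_pow, Real.log_pow] at m3
      rw [show h + -1 * u y = h - u y by ring, show h + -1 * u x = h - u x by ring,
        show 2 * P + -1 * P = P by ring]
      linarith)
  refine algP hn (fun i => dd (b i) u x) lam (fun i => dd (b i) (dd (b i) (dd v (dd v u))) x)
    hP hr ?_ k1 k2 ?_ ?_
  · rw [← hdd, hv1]
  · intro i
    have := (hlm i).1
    rw [cs, dd_smul_fun (hu.dd _)] at this
    simp only [Pi.smul_apply, smul_eq_mul, hT, hgrad, hv1, hv2, dd_comm hu (b i) v] at this
    rw [show 2 * P + -1 * P = P by ring, show h + -1 * u x = h - u x by ring] at this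
    rw [← this]; ring
  · intro i
    have := (hlm i).2
    have q1 := c1 i i
    have q2 := c2 i i
    rw [if_pos rfl] at q1 q2
    have q3 : dd (b i) (dd v (dd (b i) u)) x = lam i := by rw [dd_comm hu v, q2]
    rw [cs, dd_smul_fun (hu.dd _), dd_smul_fun (hu.dd _), dd_smul_fun ((hu.dd _).dd _),
      dd_smul_fun (hu.dd _), dd_smul_dir] at this
    simp only [Pi.smul_apply, smul_eq_mul, hT, hgrad, hv1, hv2, dd_comm hu (b i) v, q1, q2, q3]
      at this
    rw [show 2 * P + -1 * P = P by ring, show h + -1 * u x = h - u x by ring] at this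
    refine le_trans (le_of_eq ?_) this
    ring

theorem NSol.estP {u : (Fin n → ℝ) → ℝ} {d0 : ℝ} {x0 : Fin n → ℝ}
    (hN : NSol u 0 d0 x0) (hn : 2 ≤ n) {h : ℝ} (hh : 0 < h) (y w : Fin n → ℝ) (hy : u y ≤ h) :
    (h - u y) ^ n * (dd w u y) ^ 2 ≤ n * (n + 3) * h ^ (n + 1) * dd w (dd w u) y := by
  have hS := hN.sol
  have hu := hS.sm
  by_cases hw : w = 0
  · rw [hw, dd_zero_dir, dd_zero_dir]; simp
  obtain ⟨x, hx, e, he, hmax⟩ := exists_max (by omega) (hN.compact h)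
    ⟨x0, by simp [hN.val, hh.le]⟩
    (fun x e => (h - u x) ^ n * (dd e u x) ^ 2 / dd e (dd e u) x) (by
      have a1 := hu.continuous
      have a2 := cont1 hu
      have a3 := cont2 hu
      refine ContinuousOn.div (by fun_prop) a3.continuousOn ?_
      rintro ⟨x, e⟩ he
      exact (hS.pos x e he).ne') (by
      intro x e c hc
      rw [scale2 hu, dd_smul_dir]
      simp only [Pi.smul_apply, smul_eq_mul]
      by_cases h0 : dd e (dd e u) x = 0
      · rw [h0]; simp
      · field_simp)
  have hx : u x ≤ h := hx
  have hpe := hS.pos x e he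
  obtain ⟨M, hM⟩ : ∃ M, M = (h - u x) ^ n * (dd e u x) ^ 2 / dd e (dd e u) x := ⟨_, rfl⟩
  have hall : ∀ y w, u y ≤ h → (h - u y) ^ n * (dd w u y) ^ 2 ≤ M * dd w (dd w u) y := by
    intro y w hy
    by_cases hw : w = 0
    · rw [hw, dd_zero_dir, dd_zero_dir]; simp
    · have := hmax y hy w hw
      rw [← hM, div_le_iff₀ (hS.pos y w hw)] at this
      exact this
  refine (hall y w hy).trans (mul_le_mul_of_nonneg_right ?_ (hS.pos y w hw).le)
  by_cases hM0 : M ≤ 0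
  · exact hM0.trans (by positivity)
  push Not at hM0
  have hr : 0 < h - u x := by
    rcases hx.lt_or_eq with h1 | h1
    · linarith
    · rw [hM, h1, sub_self, zero_pow (by omega), zero_mul, zero_div] at hM0
      exact absurd hM0 (lt_irrefl _)
  have hde : dd e u x ≠ 0 := by
    intro h0
    rw [hM, h0] at hM0; simp at hM0
  obtain ⟨P, hP⟩ : ∃ P, P = (dd e u x) ^ 2 / dd e (dd e u) x := ⟨_, rfl⟩
  have hP0 : 0 < P := by rw [hP]; positivity
  have hMP : M = (h - u x) ^ n * P := by rw [hM, hP, mul_div_assoc]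
  have := hS.pointP (h := h) hn x ((dd e u x / dd e (dd e u) x) • e) (by linarith) hP0
    (by rw [dd_smul_dir, hP]; simp only [Pi.smul_apply, smul_eq_mul]; field_simp)
    (by rw [scale2 hu, hP]; field_simp)
    (by intro y w hy; rw [← hMP]; exact hall y w hy.le)
  have hrh : h - u x ≤ h := by linarith [hN.nonneg x]
  rw [hMP]
  calc (h - u x) ^ n * P ≤ (h - u x) ^ n * (n * (n + 3) * (h - u x)) :=
        mul_le_mul_of_nonneg_left this (by positivity)
    _ = n * (n + 3) * (h - u x) ^ (n + 1) := by ring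
    _ ≤ n * (n + 3) * h ^ (n + 1) :=
        mul_le_mul_of_nonneg_left (pow_le_pow_left₀ hr.le hrh _) (by positivity)

end JCP

namespace JCP

open Filter Topology

variable {n : ℕ}

theorem algT (ev uu lam D4 D5 f1 : Fin n → ℝ) {τ r k : ℝ} (hτ : 0 < τ) (hr : 0 < r)
    (he : ∑ i, ev i * ev i = 1)
    (h4 : ∑ i, D4 i = ∑ i, lam i ^ 2)
    (h5 : ∑ i, D5 i = 3 * ∑ i, lam i * D4 i - 2 * ∑ i, lam i ^ 3)
    (hle : ∀ i, lam i ≤ τ) (heq : ∀ i, ev i ≠ 0 → lam i = τ)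
    (h1 : ∀ i, 2 * (f1 i / τ) + k * (-uu i / r) = 0)
    (h2 : ∀ i, 2 * ((D5 i - 3 * (lam i * D4 i) + 3 / 2 * lam i ^ 3) / τ - (f1 i / τ) ^ 2)
      - 3 * (D4 i - 3 / 2 * lam i ^ 2) + k * (-1 / r - (-uu i / r) ^ 2) ≤ 0) :
    τ ^ 2 ≤ (k ^ 2 + 2 * k) * (∑ i, uu i * uu i) / r ^ 2 + 2 * k * n / r := by
  obtain ⟨i, hi⟩ : ∃ i, ev i ≠ 0 := by
    by_contra hcon
    push Not at hcon
    simp [hcon] at he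
  have hτ2 : τ ^ 2 ≤ ∑ i, lam i ^ 2 := by
    rw [← heq i hi]
    exact Finset.single_le_sum (f := fun i => lam i ^ 2) (fun j _ => sq_nonneg _)
      (Finset.mem_univ i)
  have h3 : ∀ i, (2 * D5 i - 6 * (lam i * D4 i) + 4 * lam i ^ 3) / τ - 3 * D4 i
      + 7 / 2 * lam i ^ 2 - (k ^ 2 / 2 + k) / r ^ 2 * (uu i * uu i) - k / r ≤ 0 := by
    intro i
    refine le_trans ?_ (h2 i)
    have e : f1 i / τ = k / 2 * (uu i / r) := by have := h1 i; linear_combination this / 2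
    rw [e]
    have e2 : lam i ^ 3 / τ ≤ lam i ^ 2 := by
      rw [div_le_iff₀ hτ]
      nlinarith [mul_nonneg (sq_nonneg (lam i)) (sub_nonneg.2 (hle i))]
    have e3 : k * (-1 / r - (-uu i / r) ^ 2) = - (k / r) - k / r ^ 2 * (uu i * uu i) := by
      field_simp
    have e4 : (k / 2 * (uu i / r)) ^ 2 = k ^ 2 / 4 / r ^ 2 * (uu i * uu i) := by
      field_simp; ring
    rw [e3, e4]
    have e5 : (k ^ 2 / 2 + k) / r ^ 2 * (uu i * uu i) = 2 * (k ^ 2 / 4 / r ^ 2 * (uu i * uu i)) +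
      k / r ^ 2 * (uu i * uu i) := by ring
    rw [e5]
    have e6 : (2 * D5 i - 6 * (lam i * D4 i) + 4 * lam i ^ 3) / τ =
      2 * ((D5 i - 3 * (lam i * D4 i) + 3 / 2 * lam i ^ 3) / τ) + lam i ^ 3 / τ := by ring
    rw [e6]
    linarith
  have h6 := Finset.sum_nonpos fun i (_ : i ∈ Finset.univ) => h3 i
  simp only [Finset.sum_sub_distrib, Finset.sum_add_distrib, ← Finset.mul_sum, ← Finset.sum_div,
    h4, h5, Finset.sum_const, Finset.card_univ, Fintype.card_fin, nsmul_eq_mul] at h6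
  have e7 : (2 * (3 * ∑ i, lam i * D4 i - 2 * ∑ i, lam i ^ 3) - 6 * ∑ i, lam i * D4 i
    + 4 * ∑ i, lam i ^ 3) / τ = 0 := by
    rw [show 2 * (3 * ∑ i, lam i * D4 i - 2 * ∑ i, lam i ^ 3) - 6 * ∑ i, lam i * D4 i
      + 4 * ∑ i, lam i ^ 3 = 0 by ring, zero_div]
  rw [e7] at h6
  have e8 : (k ^ 2 + 2 * k) * (∑ i, uu i * uu i) / r ^ 2 + 2 * k * n / r =
    2 * ((k ^ 2 / 2 + k) / r ^ 2 * (∑ i, uu i * uu i) + n * k / r) := by ring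
  rw [e8]
  linarith

theorem Sol.pointT {u : (Fin n → ℝ) → ℝ} {d0 : ℝ} (hS : Sol u 0 d0)
    {h τ B : ℝ} (x e : Fin n → ℝ) (hx : u x < h) (hτ : 0 < τ)
    (he : dd e (dd e u) x = 1) (hT : dd e (dd e (dd e u)) x = τ)
    (hm : ∀ y w, u y < h → (h - u y) ^ (n + 2) * (dd w (dd w (dd w u)) y) ^ 2 ≤
      (h - u x) ^ (n + 2) * τ ^ 2 * (dd w (dd w u) y) ^ 3) (hB0 : 0 ≤ B)
    (hB : ∀ w, (h - u x) ^ n * (dd w u x) ^ 2 ≤ B * dd w (dd w u) x) :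
    (h - u x) ^ (n + 2) * τ ^ 2 ≤
      (((n + 2 : ℕ) : ℝ) ^ 2 + 2 * ((n + 2 : ℕ) : ℝ)) * B
        + 2 * ((n + 2 : ℕ) : ℝ) * n * (h - u x) ^ (n + 1) := by
  have hu := hS.sm
  have hr : 0 < h - u x := by linarith
  obtain ⟨k, hk⟩ : ∃ k : ℝ, k = ((n + 2 : ℕ) : ℝ) := ⟨_, rfl⟩
  have hlog : ∀ y w, 0 < dd w (dd w (dd w u)) y → 0 < dd w (dd w u) y → 0 < h + -1 * u y →
      2 * Real.log (dd w (dd w (dd w u)) y) + (-3) * Real.log (dd w (dd w u) y)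
        + k * Real.log (h + -1 * u y) ≤
      2 * Real.log (dd e (dd e (dd e u)) x) + (-3) * Real.log (dd e (dd e u) x)
        + k * Real.log (h + -1 * u x) := by
    intro y w p1 p2 p3
    rw [show h + -1 * u y = h - u y by ring] at p3
    have m := Real.log_le_log (by positivity) (hm y w (by linarith))
    rw [Real.log_mul (by positivity) (by positivity), Real.log_mul (by positivity) (by positivity),
      Real.log_mul (by positivity) (by positivity), Real.log_pow, Real.log_pow, Real.log_pow,
      Real.log_pow, Real.log_pow, ← hk] at m
    push_cast at m
    rw [he, hT, Real.log_one, show h + -1 * u y = h - u y by ring,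
      show h + -1 * u x = h - u x by ring]
    linarith
  have hcurve : ∀ b c : Fin n → ℝ, _ := fun b c =>
    log_max (a := 2) (b := -3) (c := k) (Jet.tensor3 hu x b e c) (Jet.tensor2 hu x b e c)
      ((Jet.const h).add ((Jet.line hu x b).smul (-1))) (by rw [hT]; exact hτ)
      (by rw [he]; exact one_pos) (by linarith)
      (Eventually.of_forall fun s p1 p2 p3 => hlog _ _ p1 p2 p3)
  have hfirst : ∀ w, dd e (dd e (dd w u)) x = τ * dd e (dd w u) x := by
    intro w
    have := (hcurve 0 w).1
    simp only [dd_zero_dir, Pi.zero_apply, he, hT] at this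
    have e1 : dd e (dd e (dd w u)) x / τ = dd e (dd w u) x := by
      linear_combination this / 6
    rw [div_eq_iff hτ.ne'] at e1
    linarith
  have hsecond : ∀ w, dd e (dd w u) x = 0 →
      dd e (dd w (dd w u)) x ≤ τ / 2 * dd w (dd w u) x := by
    intro w hw
    have := (hcurve 0 w).2
    simp only [dd_zero_dir, dd_zero_fun, Pi.zero_apply, he, hT, hfirst, hw] at this
    have e1 : dd e (dd w (dd w u)) x / τ * 12 ≤ dd w (dd w u) x * 6 := by
      refine le_of_sub_nonpos (le_trans (le_of_eq ?_) this)
      ring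
    rw [div_mul_eq_mul_div, div_le_iff₀ hτ] at e1
    linarith
  obtain ⟨b, lam, c1, c2, c3, k1, k2, k3⟩ := hS.frame x e
  rw [dd_zero_dir, dd_zero_fun] at k1 k2 k3
  simp only [dd_zero_fun, Pi.zero_apply, neg_zero, sub_zero] at k1 k2 k3
  have hdd : ∀ f : (Fin n → ℝ) → ℝ, dd e f x = ∑ i, dd (b i) (dd e u) x * dd (b i) f x := by
    intro f
    conv_lhs => rw [c3 e]
    rw [dd_sum_dir]
  have q1 : ∀ i, dd (b i) (dd (b i) u) x = 1 := fun i => by rw [c1 i i, if_pos rfl]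
  have q2 : ∀ i, dd (b i) (dd (b i) (dd e u)) x = lam i := fun i => by rw [c2 i i, if_pos rfl]
  have q3 : ∀ i, dd (b i) (dd e (dd (b i) u)) x = lam i := fun i => by
    rw [dd_comm hu e, q2]
  have q4 : ∀ i, dd e (dd (b i) (dd (b i) u)) x = lam i := fun i => by
    rw [dd_comm (hu.dd _) e, q3]
  have q5 : ∀ i, dd (b i) (dd e (dd e u)) x = dd (b i) (dd e u) x * lam i := by
    intro i
    rw [dd_comm (hu.dd _), hdd]
    simp [c2]
  have q6 : ∀ i, dd e (dd e (dd (b i) u)) x = dd (b i) (dd e u) x * lam i := by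
    intro i
    rw [dd_comm hu e (b i), dd_comm (hu.dd e) e (b i), q5]
  have q7 : ∀ i, dd e (dd (b i) u) x = dd (b i) (dd e u) x := fun i => by rw [dd_comm hu]
  have heq : ∀ i, dd (b i) (dd e u) x ≠ 0 → lam i = τ := by
    intro i hi
    have := hfirst (b i)
    rw [q6, q7, mul_comm τ] at this
    exact mul_left_cancel₀ hi this
  have hle : ∀ i, lam i ≤ τ := by
    intro i
    by_cases hi : dd (b i) (dd e u) x = 0
    · have := hsecond (b i) (by rw [q7, hi])
      rw [q4, q1] at this
      linarith
    · exact (heq i hi).le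
  have cs : ∀ i, dd ((-(1/2) * lam i) • b i) u = (-(1/2) * lam i) • dd (b i) u :=
    fun i => dd_smul_dir _ _ _
  have q8 : ∀ i, dd (b i) (dd e (dd e (dd (b i) u))) x =
      dd (b i) (dd (b i) (dd e (dd e u))) x := fun i => by
    rw [dd_comm hu e (b i), dd_comm (hu.dd e) e (b i)]
  have hfin := algT (fun i => dd (b i) (dd e u) x) (fun i => dd (b i) u x) lam
    (fun i => dd (b i) (dd (b i) (dd e (dd e u))) x)
    (fun i => dd (b i) (dd (b i) (dd e (dd e (dd e u)))) x)
    (fun i => dd (b i) (dd e (dd e (dd e u))) x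
      + 3 * dd e (dd e (dd ((-(1/2) * lam i) • b i) u)) x) (k := k) hτ hr
    (by rw [← hdd, he]) k2 k3 hle heq ?_ ?_
  · obtain ⟨P, hP⟩ : ∃ P, P = ∑ i, dd (b i) u x * dd (b i) u x := ⟨_, rfl⟩
    simp only [← hP] at hfin
    have hPB : (h - u x) ^ n * P ≤ B := by
      have h1 : dd (∑ i, dd (b i) u x • b i) u x = P := by rw [dd_sum_dir, hP]
      have h2 : dd (∑ i, dd (b i) u x • b i) (dd (∑ i, dd (b i) u x • b i) u) x = P := by
        rw [dd_sum_dir, hP]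
        refine Finset.sum_congr rfl fun i _ => ?_
        rw [dd_comm hu, dd_sum_dir]
        simp [c1]
      have h3 := hB (∑ i, dd (b i) u x • b i)
      rw [h1, h2] at h3
      have hP0 : 0 ≤ P := by rw [hP]; exact Finset.sum_nonneg fun i _ => mul_self_nonneg _
      rcases hP0.eq_or_lt with h0 | h0
      · rw [← h0, mul_zero]; exact hB0
      · refine le_of_mul_le_mul_right ?_ h0
        linarith
    rw [← hk]
    have hk0 : 0 ≤ k := by rw [hk]; positivity
    calc (h - u x) ^ (n + 2) * τ ^ 2 ≤ (h - u x) ^ (n + 2) *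
          ((k ^ 2 + 2 * k) * P / (h - u x) ^ 2 + 2 * k * n / (h - u x)) :=
          mul_le_mul_of_nonneg_left hfin (by positivity)
      _ = (k ^ 2 + 2 * k) * ((h - u x) ^ n * P) + 2 * k * n * (h - u x) ^ (n + 1) := by
          rw [pow_succ, pow_succ]; field_simp; try ring
      _ ≤ _ := by
          have := mul_le_mul_of_nonneg_left hPB (show 0 ≤ k ^ 2 + 2 * k by positivity)
          linarith
  · intro i
    have := (hcurve (b i) ((-(1/2) * lam i) • b i)).1
    have e1 : dd (b i) (dd e (dd e u)) x + 2 * dd e (dd ((-(1/2) * lam i) • b i) u) x = 0 := by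
      rw [cs, dd_smul_fun (hu.dd _), Pi.smul_apply, smul_eq_mul, q5, q7]; ring
    rw [e1, hT, show h + -1 * u x = h - u x by ring] at this
    rw [← this]; ring
  · intro i
    have := (hcurve (b i) ((-(1/2) * lam i) • b i)).2
    have e1 : dd (b i) (dd e (dd e u)) x + 2 * dd e (dd ((-(1/2) * lam i) • b i) u) x = 0 := by
      rw [cs, dd_smul_fun (hu.dd _), Pi.smul_apply, smul_eq_mul, q5, q7]; ring
    have e2 : dd (b i) (dd e (dd ((-(1/2) * lam i) • b i) u)) x = -(1/2) * lam i ^ 2 := by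
      rw [cs, dd_smul_fun (hu.dd _), dd_smul_fun ((hu.dd _).dd _), Pi.smul_apply, smul_eq_mul, q3]
      ring
    have e3 : dd ((-(1/2) * lam i) • b i) (dd ((-(1/2) * lam i) • b i) u) x
        = 1/4 * lam i ^ 2 := by
      rw [scale2 hu, q1]; ring
    have e4 : dd (b i) (dd e (dd e (dd ((-(1/2) * lam i) • b i) u))) x =
        -(1/2) * lam i * dd (b i) (dd (b i) (dd e (dd e u))) x := by
      rw [cs, dd_smul_fun (hu.dd _), dd_smul_fun ((hu.dd _).dd _),
        dd_smul_fun (((hu.dd _).dd _).dd _), Pi.smul_apply, smul_eq_mul, q8]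
    have e5 : dd e (dd ((-(1/2) * lam i) • b i) (dd ((-(1/2) * lam i) • b i) u)) x
        = 1/4 * lam i ^ 3 := by
      have : dd ((-(1/2) * lam i) • b i) (dd ((-(1/2) * lam i) • b i) u) =
          (1/4 * lam i ^ 2) • dd (b i) (dd (b i) u) := by
        funext y; rw [scale2 hu, Pi.smul_apply, smul_eq_mul]; ring
      rw [this, dd_smul_fun ((hu.dd _).dd _), Pi.smul_apply, smul_eq_mul, q4]; ring
    rw [e1, e2, e3, e4, e5, he, hT, q1, show h + -1 * u x = h - u x by ring] at this
    refine le_trans (le_of_eq ?_) this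
    ring

theorem NSol.third {u : (Fin n → ℝ) → ℝ} {d0 : ℝ} {x0 : Fin n → ℝ}
    (hN : NSol u 0 d0 x0) (hn : 2 ≤ n) (v : Fin n → ℝ) : dd v (dd v (dd v u)) x0 = 0 := by
  have hS := hN.sol
  have hu := hS.sm
  by_cases hv : v = 0
  · rw [hv, dd_zero_dir]; rfl
  obtain ⟨C, hC⟩ : ∃ C : ℝ, C = (((n + 2 : ℕ) : ℝ) ^ 2 + 2 * ((n + 2 : ℕ) : ℝ)) *
    (n * (n + 3)) + 2 * ((n + 2 : ℕ) : ℝ) * n := ⟨_, rfl⟩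
  have hC0 : 0 ≤ C := by rw [hC]; positivity
  have key : ∀ h : ℝ, 0 < h →
      h * (dd v (dd v (dd v u)) x0) ^ 2 ≤ C * (dd v (dd v u) x0) ^ 3 := by
    intro h hh
    have hx0 : u x0 ≤ h := by rw [hN.val]; exact hh.le
    obtain ⟨x, hx, e, he, hmax⟩ := exists_max (by omega) (hN.compact h)
      ⟨x0, hx0⟩
      (fun x e => (h - u x) ^ (n + 2) * (dd e (dd e (dd e u)) x) ^ 2 / (dd e (dd e u) x) ^ 3) (by
        have a1 := hu.continuous
        have a2 := cont3 hu
        have a3 := cont2 hu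
        refine ContinuousOn.div (Continuous.continuousOn ?_) (a3.pow 3).continuousOn ?_
        · exact ((continuous_const.sub (a1.comp continuous_fst)).pow _).mul (a2.pow 2)
        rintro ⟨x, e⟩ he
        exact (pow_pos (hS.pos x e he) 3).ne') (by
        intro x e c hc
        rw [scale2 hu, scale3 hu]
        by_cases h0 : dd e (dd e u) x = 0
        · rw [h0]; simp
        · field_simp)
    have hx : u x ≤ h := hx
    have hpe := hS.pos x e he
    obtain ⟨M, hM⟩ : ∃ M, M = (h - u x) ^ (n + 2) * (dd e (dd e (dd e u)) x) ^ 2 /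
      (dd e (dd e u) x) ^ 3 := ⟨_, rfl⟩
    have hall : ∀ y w, u y ≤ h → (h - u y) ^ (n + 2) * (dd w (dd w (dd w u)) y) ^ 2 ≤
        M * (dd w (dd w u) y) ^ 3 := by
      intro y w hy
      by_cases hw : w = 0
      · rw [hw, dd_zero_dir, dd_zero_dir]; simp
      · have := hmax y hy w hw
        rw [← hM, div_le_iff₀ (pow_pos (hS.pos y w hw) 3)] at this
        exact this
    suffices hMC : M ≤ C * h ^ (n + 1) by
      have h1 := hall x0 v hx0
      have h2 := mul_le_mul_of_nonneg_right hMC (pow_pos (hS.pos x0 v hv) 3).le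
      have h3 := h1.trans h2
      rw [hN.val, sub_zero, pow_succ] at h3
      have hp : 0 < h ^ (n + 1) := by positivity
      refine le_of_mul_le_mul_left ?_ hp
      linarith
    by_cases hM0 : M ≤ 0
    · exact hM0.trans (by positivity)
    push Not at hM0
    have hr : 0 < h - u x := by
      rcases hx.lt_or_eq with h1 | h1
      · linarith
      · rw [hM, h1, sub_self, zero_pow (by omega), zero_mul, zero_div] at hM0
        exact absurd hM0 (lt_irrefl _)
    have hde : dd e (dd e (dd e u)) x ≠ 0 := by
      intro h0
      rw [hM, h0] at hM0; simp at hM0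
    have hrh : h - u x ≤ h := by linarith [hN.nonneg x]
    -- a normalised maximising direction
    obtain ⟨c, hc0, hc2, hc3⟩ : ∃ c : ℝ, c ≠ 0 ∧ c ^ 2 * dd e (dd e u) x = 1 ∧
        0 < c ^ 3 * dd e (dd e (dd e u)) x := by
      have hs := Real.sqrt_pos.2 hpe
      have hs2 : Real.sqrt (dd e (dd e u) x) ^ 2 = dd e (dd e u) x := Real.sq_sqrt hpe.le
      rcases lt_or_gt_of_ne hde with hneg | hpos
      · refine ⟨-(Real.sqrt (dd e (dd e u) x))⁻¹, by simpa using hs.ne', ?_, ?_⟩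
        · rw [neg_sq, inv_pow, hs2, inv_mul_cancel₀ hpe.ne']
        · have : 0 < ((Real.sqrt (dd e (dd e u) x))⁻¹) ^ 3 := by positivity
          rw [neg_pow, show (-1:ℝ) ^ 3 = -1 by norm_num]
          nlinarith
      · refine ⟨(Real.sqrt (dd e (dd e u) x))⁻¹, inv_ne_zero hs.ne', ?_, ?_⟩
        · rw [inv_pow, hs2, inv_mul_cancel₀ hpe.ne']
        · positivity
    have hMτ : M = (h - u x) ^ (n + 2) * (c ^ 3 * dd e (dd e (dd e u)) x) ^ 2 := by
      have : (c ^ 2) ^ 3 * (dd e (dd e u) x) ^ 3 = 1 := by rw [← mul_pow, hc2, one_pow]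
      rw [hM, div_eq_iff (by positivity)]
      linear_combination (-(h - u x) ^ (n + 2) * (dd e (dd e (dd e u)) x) ^ 2) * this
    have := hS.pointT (h := h) (B := n * (n + 3) * h ^ (n + 1)) x (c • e) (by linarith) hc3
      (by rw [scale2 hu, hc2]) (by rw [scale3 hu])
      (by intro y w hy; rw [← hMτ]; exact hall y w hy.le) (by positivity)
      (fun w => hN.estP hn hh x w hx)
    rw [← hMτ] at this
    refine this.trans ?_
    have h5 : (h - u x) ^ (n + 1) ≤ h ^ (n + 1) := pow_le_pow_left₀ hr.le hrh _
    have h6 := mul_le_mul_of_nonneg_left h5 (show (0:ℝ) ≤ 2 * ((n + 2 : ℕ) : ℝ) * n by positivity)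
    rw [hC]
    linarith
  by_contra hne
  have hp : 0 < (dd v (dd v (dd v u)) x0) ^ 2 := by positivity
  have hp2 := pow_pos (hS.pos x0 v hv) 3
  have := key ((C * (dd v (dd v u) x0) ^ 3 + 1) / (dd v (dd v (dd v u)) x0) ^ 2) (by positivity)
  rw [div_mul_cancel₀ _ hp.ne'] at this
  linarith

theorem Sol.third {u : (Fin n → ℝ) → ℝ} {d : Fin n → ℝ} {d0 : ℝ} (hS : Sol u d d0)
    (hn : 2 ≤ n) (x v : Fin n → ℝ) : dd v (dd v (dd v u)) x = 0 := by
  obtain ⟨u', d0', hN, h2⟩ := hS.normalize x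
  have hd := hN.d_zero (by omega)
  subst hd
  rw [← h2 v v]
  exact hN.third hn v

/-- Taylor expansion along rays from the origin. -/
theorem taylor {u : (Fin n → ℝ) → ℝ} (hu : Sm u)
    (h3 : ∀ x v, dd v (dd v (dd v u)) x = 0) (v : Fin n → ℝ) :
    u v = u 0 + dd v u 0 + 1 / 2 * dd v (dd v u) 0 := by
  have c2 : ∀ s : ℝ, dd v (dd v u) (0 + s • v) = dd v (dd v u) 0 := by
    intro s
    have := is_const_of_deriv_eq_zero (f := fun s : ℝ => dd v (dd v u) (0 + s • v))
      (fun s => (hasDerivAt_line ((hu.dd v).dd v) 0 v s).differentiableAt)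
      (fun s => by rw [(hasDerivAt_line ((hu.dd v).dd v) 0 v s).deriv, h3]) s 0
    simpa using this
  have c1 : ∀ s : ℝ, dd v u (0 + s • v) = dd v u 0 + s * dd v (dd v u) 0 := by
    intro s
    have hder : ∀ s : ℝ, HasDerivAt (fun s : ℝ => dd v u (0 + s • v) - s * dd v (dd v u) 0) 0 s := by
      intro s
      have := (hasDerivAt_line (hu.dd v) 0 v s).sub ((hasDerivAt_id s).mul_const (dd v (dd v u) 0))
      refine this.congr_deriv ?_
      rw [c2]; ring
    have := is_const_of_deriv_eq_zero (fun s => (hder s).differentiableAt)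
      (fun s => (hder s).deriv) s 0
    simp only [zero_smul, add_zero, zero_mul, sub_zero] at this
    linarith
  have hder : ∀ s : ℝ, HasDerivAt (fun s : ℝ => u (0 + s • v) -
      (s * dd v u 0 + s ^ 2 * (1 / 2 * dd v (dd v u) 0))) 0 s := by
    intro s
    have := (hasDerivAt_line hu 0 v s).sub (((hasDerivAt_id s).mul_const (dd v u 0)).add
      ((hasDerivAt_pow 2 s).mul_const (1 / 2 * dd v (dd v u) 0)))
    refine this.congr_deriv ?_
    rw [c1]; simp; ring
  have := is_const_of_deriv_eq_zero (fun s => (hder s).differentiableAt)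
      (fun s => (hder s).deriv) 1 0
  simp only [one_smul, zero_smul, add_zero, zero_add] at this
  linarith

end JCP

theorem quadratic_of_global_solution (n : ℕ) (hn : 2 ≤ n)
    (u : (Fin n → ℝ) → ℝ) (hu : ContDiff ℝ (⊤ : ℕ∞) u)
    (hconv : ∀ x : Fin n → ℝ, (hess u x).PosDef)
    (d : Fin n → ℝ) (d0 : ℝ)
    (hpde : ∀ ξ : Fin n → ℝ,
      (hess u ξ).det = Real.exp (-(∑ i : Fin n, d i * pd i u ξ) - d0)) :
    ∃ (Q : Matrix (Fin n) (Fin n) ℝ) (b : Fin n → ℝ) (c : ℝ),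
      ∀ ξ : Fin n → ℝ,
        u ξ = (∑ i : Fin n, ∑ j : Fin n, Q i j * ξ i * ξ j)
          + (∑ i : Fin n, b i * ξ i) + c := by
  have hsm : JCP.Sm u := hu
  have hS : JCP.Sol u d d0 := by
    refine ⟨hsm, ?_, hconv, ?_⟩
    · intro x v hv
      rw [JCP.hess_form hsm]
      have := (hconv x).dotProduct_mulVec_pos hv
      simp only [dotProduct, Matrix.mulVec, star_trivial, Finset.mul_sum] at this
      refine lt_of_lt_of_eq this ?_
      exact Finset.sum_congr rfl fun i _ => Finset.sum_congr rfl fun j _ => by ring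
    · intro x
      rw [hpde, JCP.dd_eq_sum]
  refine ⟨Matrix.of fun i j => 1 / 2 * hess u 0 i j, fun i => pd i u 0, u 0, fun ξ => ?_⟩
  rw [JCP.taylor hsm (fun x v => hS.third hn x v) ξ, JCP.hess_form hsm, JCP.dd_eq_sum,
    Finset.mul_sum]
  have e1 : ∑ i, ξ i * pd i u 0 = ∑ i, pd i u 0 * ξ i :=
    Finset.sum_congr rfl fun i _ => mul_comm _ _
  have e2 : ∑ i, 1 / 2 * ∑ j, ξ i * hess u 0 i j * ξ j =
      ∑ i, ∑ j, (Matrix.of fun i j => 1 / 2 * hess u 0 i j) i j * ξ i * ξ j := by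
    refine Finset.sum_congr rfl fun i _ => ?_
    rw [Finset.mul_sum]
    refine Finset.sum_congr rfl fun j _ => ?_
    rw [Matrix.of_apply]; ring
  rw [e1, e2]; ring
end
end

section
/- (Lemma 6.2) Let n ≥ 2, let Ω ⊂ ℝⁿ be a bounded open set, and let u be a smooth strictly convex function on a neighborhood of the closure of Ω with inf_Ω u = 0 and u ≡ C > 0 on ∂Ω. Let m > 0, let Q > 0, H and K be smooth functions on the closure of Ω, and set h = m/(C−u)², h' = 2m/(C−u)³. Suppose the function F = exp(−m/(C−u) + H) · Q · ‖∇K‖² attains its supremum over Ω at an interior point p* with ∇K(p*) ≠ 0, and let v = ∇K/‖∇K‖ at p*. Then for every δ with 0 < δ < 1, the following inequality holds at p*: 2(1/(n−1) − δ − 1)(Hess K(v,v))² + 2⟨∇K, ∇(ΔK)⟩ + 2(1−δ)‖A(v,·,·)‖² ‖∇K‖² − ((n+2)²/(8δ)) Φ ‖∇K‖² − (2/(δ(n−1)²))(ΔK)² + (−h' ‖∇u‖² − h Δu + ΔH + ΔQ/Q − ‖∇Q‖²/Q²) ‖∇K‖² ≤ 0, where all metric quantities are those of the Calabi metric G = D²u.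 -/
noncomputable section

/-- `ρ = (det D²u)^{1/(n+2)}`. -/
def rhoU {n : ℕ} (u : (Fin n → ℝ) → ℝ) (x : Fin n → ℝ) : ℝ :=
  (hess u x).det ^ ((1 : ℝ) / (n + 2))

/-- `⟨∇φ, ∇ψ⟩ = Σ u^{ij} φ_i ψ_j`, the Calabi-metric inner product of gradients. -/
def calInner {n : ℕ} (u φ ψ : (Fin n → ℝ) → ℝ) (x : Fin n → ℝ) : ℝ :=
  ∑ i : Fin n, ∑ j : Fin n, (hess u x)⁻¹ i j * pd i φ x * pd j ψ x

/-- `Φ = ‖∇ρ‖²/ρ²`. -/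
def PhiU {n : ℕ} (u : (Fin n → ℝ) → ℝ) (x : Fin n → ℝ) : ℝ :=
  calInner u (rhoU u) (rhoU u) x / (rhoU u x) ^ 2

/-- The Laplace–Beltrami operator of the Calabi metric `G = D²u`:
`Δφ = Σ u^{ij} ∂²φ/∂ξ_i∂ξ_j − ((n+2)/2)(1/ρ) Σ u^{ij} ρ_j φ_i`. -/
def calLap {n : ℕ} (u φ : (Fin n → ℝ) → ℝ) (x : Fin n → ℝ) : ℝ :=
  (∑ i : Fin n, ∑ j : Fin n, (hess u x)⁻¹ i j * pd i (pd j φ) x)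
    - (((n : ℝ) + 2) / 2) * (1 / rhoU u x) *
        ∑ i : Fin n, ∑ j : Fin n, (hess u x)⁻¹ i j * pd j (rhoU u) x * pd i φ x

/-- The gradient vector of `φ` for the Calabi metric: `(∇φ)^i = Σ u^{ij} φ_j`. -/
def calGrad {n : ℕ} (u φ : (Fin n → ℝ) → ℝ) (x : Fin n → ℝ) : Fin n → ℝ :=
  fun i => ∑ j : Fin n, (hess u x)⁻¹ i j * pd j φ x

/-- The Christoffel symbols `Γ^k_{ij} = (1/2) Σ_l u^{kl} ∂³u/∂ξ_i∂ξ_j∂ξ_l`. -/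
def christof {n : ℕ} (u : (Fin n → ℝ) → ℝ) (x : Fin n → ℝ) (k i j : Fin n) : ℝ :=
  (1 / 2) * ∑ l : Fin n, (hess u x)⁻¹ k l * pd i (pd j (pd l u)) x

/-- The covariant Hessian `Hess φ(v,v)` with respect to the Calabi metric. -/
def covHess {n : ℕ} (u φ : (Fin n → ℝ) → ℝ) (x : Fin n → ℝ) (v : Fin n → ℝ) : ℝ :=
  ∑ i : Fin n, ∑ j : Fin n,
    (pd i (pd j φ) x - ∑ k : Fin n, christof u x k i j * pd k φ x) * v i * v j

/-- The Fubini–Pick form `A_{ijk} = (1/2) ∂³u/∂ξ_i∂ξ_j∂ξ_k`. -/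
def fubiniPick {n : ℕ} (u : (Fin n → ℝ) → ℝ) (x : Fin n → ℝ) (i j k : Fin n) : ℝ :=
  (1 / 2) * pd i (pd j (pd k u)) x

/-- `‖A(v,·,·)‖² = Σ u^{ik} u^{jl} (Σ_p A_{ijp} v^p)(Σ_q A_{klq} v^q)`. -/
def fubiniPickSq {n : ℕ} (u : (Fin n → ℝ) → ℝ) (x : Fin n → ℝ) (v : Fin n → ℝ) : ℝ :=
  ∑ i : Fin n, ∑ j : Fin n, ∑ k : Fin n, ∑ l : Fin n,
    (hess u x)⁻¹ i k * (hess u x)⁻¹ j l *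
      (∑ p : Fin n, fubiniPick u x i j p * v p) *
      (∑ q : Fin n, fubiniPick u x k l q * v q)

open scoped ContDiff

section Calc
variable {n : ℕ} {Ω : Set (Fin n → ℝ)} {f g : (Fin n → ℝ) → ℝ} {x : Fin n → ℝ}

theorem sm_pd (hΩ : IsOpen Ω) (hf : ContDiffOn ℝ (⊤ : ℕ∞) f Ω) (i : Fin n) :
    ContDiffOn ℝ (⊤ : ℕ∞) (pd i f) Ω := by
  have h := hf.fderiv_of_isOpen (m := (⊤ : ℕ∞)) hΩ (by exact_mod_cast le_top)
  exact h.clm_apply contDiffOn_const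

theorem sm_da (hΩ : IsOpen Ω) (hf : ContDiffOn ℝ (⊤ : ℕ∞) f Ω) (hx : x ∈ Ω) :
    DifferentiableAt ℝ f x :=
  (hf.contDiffAt (hΩ.mem_nhds hx)).differentiableAt (by simp)

theorem pd_congr (hΩ : IsOpen Ω) (h : ∀ y ∈ Ω, f y = g y) (hx : x ∈ Ω) (i : Fin n) :
    pd i f x = pd i g x := by
  have : f =ᶠ[nhds x] g := Filter.eventually_of_mem (hΩ.mem_nhds hx) h
  simp only [pd, this.fderiv_eq]

theorem pd_add (hf : DifferentiableAt ℝ f x) (hg : DifferentiableAt ℝ g x) (i : Fin n) :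
    pd i (fun y => f y + g y) x = pd i f x + pd i g x := by
  simp only [pd, fderiv_fun_add hf hg, add_apply]

theorem pd_sub (hf : DifferentiableAt ℝ f x) (hg : DifferentiableAt ℝ g x) (i : Fin n) :
    pd i (fun y => f y - g y) x = pd i f x - pd i g x := by
  simp only [pd, fderiv_fun_sub hf hg, sub_apply]

theorem pd_mul (hf : DifferentiableAt ℝ f x) (hg : DifferentiableAt ℝ g x) (i : Fin n) :
    pd i (fun y => f y * g y) x = f x * pd i g x + g x * pd i f x := by
  simp [pd, fderiv_fun_mul hf hg]

theorem pd_const (c : ℝ) (i : Fin n) : pd i (fun _ => c) x = 0 := by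
  simp [pd]

theorem pd_cmul (c : ℝ) (hf : DifferentiableAt ℝ f x) (i : Fin n) :
    pd i (fun y => c * f y) x = c * pd i f x := by
  rw [pd_mul (differentiableAt_const c) hf, pd_const]; ring

theorem pd_sum {ι : Type*} (s : Finset ι) (F : ι → (Fin n → ℝ) → ℝ)
    (hF : ∀ a ∈ s, DifferentiableAt ℝ (F a) x) (i : Fin n) :
    pd i (fun y => ∑ a ∈ s, F a y) x = ∑ a ∈ s, pd i (F a) x := by
  simp [pd, fderiv_fun_sum hF]

theorem pd_comp {φ : ℝ → ℝ} {φ' : ℝ} (hf : DifferentiableAt ℝ f x)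
    (hφ : HasDerivAt φ φ' (f x)) (i : Fin n) :
    pd i (fun y => φ (f y)) x = φ' * pd i f x := by
  have := (hφ.comp_hasFDerivAt x hf.hasFDerivAt).fderiv
  simp only [pd]
  change fderiv ℝ (φ ∘ f) x _ = _
  rw [this]; simp

theorem pd_symm (hΩ : IsOpen Ω) (hf : ContDiffOn ℝ (⊤ : ℕ∞) f Ω) (hx : x ∈ Ω) (i j : Fin n) :
    pd i (pd j f) x = pd j (pd i f) x := by
  have hc := hf.contDiffAt (hΩ.mem_nhds hx)
  have h := hc.isSymmSndFDerivAt (by simp only [minSmoothness_of_isRCLikeNormedField]; exact WithTop.coe_le_coe.2 (le_top : (2 : ℕ∞) ≤ ⊤))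
  have hd : DifferentiableAt ℝ (fderiv ℝ f) x :=
    ((hf.fderiv_of_isOpen (m := (⊤ : ℕ∞)) hΩ (by exact_mod_cast le_top)).contDiffAt
      (hΩ.mem_nhds hx)).differentiableAt (by simp)
  have key : ∀ a b : Fin n, pd a (pd b f) x =
      fderiv ℝ (fderiv ℝ f) x (Pi.single a 1) (Pi.single b 1) := by
    intro a b
    unfold pd
    rw [fderiv_clm_apply hd (differentiableAt_const _)]
    simp
  rw [key, key]; exact h _ _

theorem fderiv_pd (w : Fin n → ℝ) : fderiv ℝ f x w = ∑ i, w i * pd i f x := by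
  conv_lhs => rw [← Finset.univ_sum_single w, map_sum]
  refine Finset.sum_congr rfl fun i _ => ?_
  have : (Pi.single i (w i) : Fin n → ℝ) = w i • Pi.single i 1 := by
    rw [← Pi.single_smul]; simp
  rw [this, map_smul]; rfl

/-- first order condition -/
theorem pd_max (h : IsLocalMax f x) (i : Fin n) : pd i f x = 0 := by
  simp [pd, h.fderiv_eq_zero]

/-- second order condition -/
theorem pd_pd_max (hΩ : IsOpen Ω) (hf : ContDiffOn ℝ (⊤ : ℕ∞) f Ω) (hx : x ∈ Ω)
    (h : IsLocalMax f x) (w : Fin n → ℝ) :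
    ∑ i, ∑ j, w i * w j * pd i (pd j f) x ≤ 0 := by
  by_contra! hpos
  set G : ℝ → ℝ := fun s => f (x + s • w) with hG
  have hl : ∀ s : ℝ, HasDerivAt (fun s : ℝ => x + s • w) w s := by
    intro s
    simpa using ((hasDerivAt_id s).smul_const w).const_add x
  have hlc : Continuous (fun s : ℝ => x + s • w) := by fun_prop
  have hx0 : x + (0:ℝ) • w = x := by simp
  have hev : ∀ᶠ s : ℝ in nhds 0, x + s • w ∈ Ω := by
    apply hlc.continuousAt.eventually_mem
    rw [hx0]; exact hΩ.mem_nhds hx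
  have hder : ∀ (F : (Fin n → ℝ) → ℝ), ContDiffOn ℝ (⊤ : ℕ∞) F Ω → ∀ s : ℝ, x + s • w ∈ Ω →
      HasDerivAt (fun s : ℝ => F (x + s • w)) (∑ i, w i * pd i F (x + s • w)) s := by
    intro F hF s hs
    have := (sm_da hΩ hF hs).hasFDerivAt.comp_hasDerivAt s (hl s)
    rwa [fderiv_pd] at this
  have h1 : deriv G =ᶠ[nhds 0] fun s => ∑ i, w i * pd i f (x + s • w) := by
    filter_upwards [hev] with s hs
    exact (hder f hf s hs).deriv
  have h2 : deriv (deriv G) 0 = ∑ i, ∑ j, w i * w j * pd i (pd j f) x := by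
    rw [h1.deriv_eq]
    have : HasDerivAt (fun s : ℝ => ∑ j, w j * pd j f (x + s • w))
        (∑ j, w j * ∑ i, w i * pd i (pd j f) (x + (0:ℝ) • w)) 0 := by
      apply HasDerivAt.fun_sum
      intro j _
      exact (hder (pd j f) (sm_pd hΩ hf j) 0 (by rwa [hx0])).const_mul _
    rw [this.deriv, hx0, Finset.sum_comm]
    refine Finset.sum_congr rfl fun i _ => ?_
    rw [Finset.mul_sum]
    refine Finset.sum_congr rfl fun j _ => ?_
    ring
  have hmaxG : IsLocalMax G 0 := by
    have := hlc.continuousAt.tendsto (x := (0:ℝ))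
    rw [hx0] at this
    have h3 := this.eventually h
    filter_upwards [h3] with s hs
    simpa [hG] using hs
  have hd0 : deriv G 0 = 0 := hmaxG.deriv_eq_zero
  have hGc : ContinuousAt G 0 := (hder f hf 0 (by rwa [hx0])).continuousAt
  have hmin := isLocalMin_of_deriv_deriv_pos (by rw [h2]; exact hpos) hd0 hGc
  have hcst : G =ᶠ[nhds 0] fun _ => G 0 := by
    filter_upwards [hmaxG, hmin] with s a b
    exact le_antisymm a b
  have hcst' : deriv G =ᶠ[nhds 0] fun _ => 0 := by
    have := hcst.deriv
    simpa using this
  rw [← h2, hcst'.deriv_eq] at hpos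
  simp at hpos

end Calc

section Mat
variable {n : ℕ} {Ω : Set (Fin n → ℝ)} {x : Fin n → ℝ}

theorem sm_det {ι : Type*} [Fintype ι] [DecidableEq ι] {g : (Fin n → ℝ) → Matrix ι ι ℝ}
    (hg : ∀ i j, ContDiffOn ℝ (⊤ : ℕ∞) (fun y => g y i j) Ω) :
    ContDiffOn ℝ (⊤ : ℕ∞) (fun y => (g y).det) Ω := by
  simp only [Matrix.det_apply']
  apply ContDiffOn.sum
  intro σ _
  apply contDiffOn_const.mul
  apply contDiffOn_prod
  intro i _
  exact hg _ _

theorem sm_inv {g : (Fin n → ℝ) → Matrix (Fin n) (Fin n) ℝ}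
    (hg : ∀ i j, ContDiffOn ℝ (⊤ : ℕ∞) (fun y => g y i j) Ω)
    (hd : ∀ y ∈ Ω, (g y).det ≠ 0) (i j : Fin n) :
    ContDiffOn ℝ (⊤ : ℕ∞) (fun y => (g y)⁻¹ i j) Ω := by
  have : ∀ y, (g y)⁻¹ i j = ((g y).det)⁻¹ * ((g y).updateRow j (Pi.single i 1)).det := by
    intro y
    rw [Matrix.inv_def, Matrix.smul_apply, Matrix.adjugate_apply]
    simp
  simp only [this]
  apply ((sm_det hg).inv hd).mul
  apply sm_det
  intro a b
  by_cases h : a = j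
  · subst h; simpa using contDiffOn_const
  · simpa [Matrix.updateRow_ne h] using hg a b

theorem pd_det {g : (Fin n → ℝ) → Matrix (Fin n) (Fin n) ℝ}
    (hg : ∀ i j, DifferentiableAt ℝ (fun y => g y i j) x)
    (hd : (g x).det ≠ 0) (a : Fin n) :
    pd a (fun y => (g y).det) x =
      (g x).det * ∑ i, ∑ j, (g x)⁻¹ i j * pd a (fun y => g y j i) x := by
  have h1 : pd a (fun y => (g y).det) x =
      ∑ σ : Equiv.Perm (Fin n), ((Equiv.Perm.sign σ : ℤ) : ℝ) *
        ∑ i, (∏ j ∈ Finset.univ.erase i, g x (σ j) j) * pd a (fun y => g y (σ i) i) x := by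
    simp only [Matrix.det_apply']
    have hp : ∀ σ : Equiv.Perm (Fin n), HasFDerivAt (fun y => ∏ i, g y (σ i) i)
        (∑ i, (∏ j ∈ Finset.univ.erase i, g x (σ j) j) • fderiv ℝ (fun y => g y (σ i) i) x) x := by
      intro σ
      exact HasFDerivAt.finsetProd (fun i _ => (hg (σ i) i).hasFDerivAt)
    rw [pd_sum]
    · refine Finset.sum_congr rfl fun σ _ => ?_
      rw [pd_cmul _ (hp σ).differentiableAt]
      congr 1
      simp [pd, (hp σ).fderiv]
    · intro σ _
      exact ((hp σ).differentiableAt).const_mul _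
  have h2 : ∀ i : Fin n, ((g x).updateCol i (fun r => pd a (fun y => g y r i) x)).det =
      ∑ σ : Equiv.Perm (Fin n), ((Equiv.Perm.sign σ : ℤ) : ℝ) *
        ((∏ j ∈ Finset.univ.erase i, g x (σ j) j) * pd a (fun y => g y (σ i) i) x) := by
    intro i
    rw [Matrix.det_apply']
    refine Finset.sum_congr rfl fun σ _ => ?_
    congr 1
    rw [← Finset.prod_erase_mul _ _ (Finset.mem_univ i)]
    congr 1
    · refine Finset.prod_congr rfl fun j hj => ?_
      rw [Matrix.updateCol_ne (Finset.ne_of_mem_erase hj)]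
    · simp
  rw [h1]
  simp only [Finset.mul_sum]
  rw [Finset.sum_comm]
  refine Finset.sum_congr rfl fun i _ => ?_
  rw [← h2, ← Matrix.cramer_apply, Matrix.cramer_eq_adjugate_mulVec]
  simp only [Matrix.mulVec, dotProduct]
  refine Finset.sum_congr rfl fun j _ => ?_
  rw [Matrix.inv_def, Matrix.smul_apply, Ring.inverse_eq_inv', smul_eq_mul]
  field_simp

theorem pd_inv (hΩ : IsOpen Ω) {g : (Fin n → ℝ) → Matrix (Fin n) (Fin n) ℝ}
    (hg : ∀ i j, ContDiffOn ℝ (⊤ : ℕ∞) (fun y => g y i j) Ω)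
    (hd : ∀ y ∈ Ω, (g y).det ≠ 0) (hx : x ∈ Ω) (a i j : Fin n) :
    pd a (fun y => (g y)⁻¹ i j) x =
      - ∑ k, ∑ l, (g x)⁻¹ i k * pd a (fun y => g y k l) x * (g x)⁻¹ l j := by
  have hI := sm_inv hg hd
  set D : Matrix (Fin n) (Fin n) ℝ := Matrix.of fun k l => pd a (fun y => g y k l) x with hD
  set E : Matrix (Fin n) (Fin n) ℝ := Matrix.of fun k l => pd a (fun y => (g y)⁻¹ k l) x with hE
  have h1 : (g x)⁻¹ * D + E * g x = 0 := by
    ext k l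
    have : pd a (fun y => ∑ r, (g y)⁻¹ k r * g y r l) x = 0 := by
      rw [pd_congr (g := fun _ => (1 : Matrix (Fin n) (Fin n) ℝ) k l) hΩ _ hx, pd_const]
      intro y hy
      rw [← Matrix.mul_apply, Matrix.nonsing_inv_mul _ (isUnit_iff_ne_zero.2 (hd y hy))]
    rw [pd_sum _ _ (fun r _ => (sm_da hΩ (hI k r) hx).fun_mul (sm_da hΩ (hg r l) hx))] at this
    simp only [pd_mul (sm_da hΩ (hI k _) hx) (sm_da hΩ (hg _ l) hx), Finset.sum_add_distrib] at this
    simp only [Matrix.add_apply, Matrix.mul_apply, Matrix.zero_apply, hD, hE, Matrix.of_apply]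
    rw [← this]
    congr 1
    exact Finset.sum_congr rfl fun _ _ => mul_comm _ _
  have hu := isUnit_iff_ne_zero.2 (hd x hx)
  have h2 : E = - ((g x)⁻¹ * D * (g x)⁻¹) := by
    have h3 : E * g x = - ((g x)⁻¹ * D) := by
      rw [eq_neg_iff_add_eq_zero, add_comm]; exact h1
    calc E = E * g x * (g x)⁻¹ := by rw [Matrix.mul_assoc, Matrix.mul_nonsing_inv _ hu, mul_one]
      _ = _ := by rw [h3, neg_mul]
  have h4 := congrFun (congrFun h2 i) j
  simp only [hE, Matrix.of_apply] at h4
  rw [h4, Matrix.neg_apply, Matrix.mul_apply, Finset.sum_comm]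
  simp only [Matrix.mul_apply, Finset.sum_mul, hD, Matrix.of_apply]

end Mat

section Geo
variable {n : ℕ} {Ω : Set (Fin n → ℝ)} {x : Fin n → ℝ} {u K : (Fin n → ℝ) → ℝ}

/-- `T_a = u^{ij} u_{ija}` -/
def trT (u : (Fin n → ℝ) → ℝ) (y : Fin n → ℝ) (a : Fin n) : ℝ :=
  ∑ i, ∑ j, (hess u y)⁻¹ i j * pd a (pd i (pd j u)) y

theorem sm_hess (hΩ : IsOpen Ω) (hu : ContDiffOn ℝ (⊤ : ℕ∞) u Ω) (i j : Fin n) :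
    ContDiffOn ℝ (⊤ : ℕ∞) (fun y => hess u y i j) Ω :=
  sm_pd hΩ (sm_pd hΩ hu j) i

theorem det_ne (hc : ∀ y ∈ Ω, (hess u y).PosDef) : ∀ y ∈ Ω, (hess u y).det ≠ 0 :=
  fun y hy => (hc y hy).det_pos.ne'

theorem sm_P (hΩ : IsOpen Ω) (hu : ContDiffOn ℝ (⊤ : ℕ∞) u Ω)
    (hc : ∀ y ∈ Ω, (hess u y).PosDef) (i j : Fin n) :
    ContDiffOn ℝ (⊤ : ℕ∞) (fun y => (hess u y)⁻¹ i j) Ω :=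
  sm_inv (sm_hess hΩ hu) (det_ne hc) i j

theorem P_symm (hc : ∀ y ∈ Ω, (hess u y).PosDef) (hx : x ∈ Ω) (i j : Fin n) :
    (hess u x)⁻¹ i j = (hess u x)⁻¹ j i := by
  have := (hc x hx).inv.isHermitian.apply i j
  simpa using this.symm

theorem pd_P (hΩ : IsOpen Ω) (hu : ContDiffOn ℝ (⊤ : ℕ∞) u Ω)
    (hc : ∀ y ∈ Ω, (hess u y).PosDef) (hx : x ∈ Ω) (a i j : Fin n) :
    pd a (fun y => (hess u y)⁻¹ i j) x =
      - ∑ k, ∑ l, (hess u x)⁻¹ i k * pd a (pd k (pd l u)) x * (hess u x)⁻¹ l j :=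
  pd_inv hΩ (sm_hess hΩ hu) (det_ne hc) hx a i j

theorem t_swap12 (hΩ : IsOpen Ω) (hu : ContDiffOn ℝ (⊤ : ℕ∞) u Ω) (hx : x ∈ Ω) (i j k : Fin n) :
    pd i (pd j (pd k u)) x = pd j (pd i (pd k u)) x :=
  pd_symm hΩ (sm_pd hΩ hu k) hx i j

theorem t_swap23 (hΩ : IsOpen Ω) (hu : ContDiffOn ℝ (⊤ : ℕ∞) u Ω) (hx : x ∈ Ω) (i j k : Fin n) :
    pd i (pd j (pd k u)) x = pd i (pd k (pd j u)) x :=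
  pd_congr hΩ (fun _ hy => pd_symm hΩ hu hy j k) hx i

theorem rho_pos (hc : ∀ y ∈ Ω, (hess u y).PosDef) (hx : x ∈ Ω) : 0 < rhoU u x :=
  Real.rpow_pos_of_pos (hc x hx).det_pos _

theorem pd_rho (hΩ : IsOpen Ω) (hu : ContDiffOn ℝ (⊤ : ℕ∞) u Ω)
    (hc : ∀ y ∈ Ω, (hess u y).PosDef) (hx : x ∈ Ω) (a : Fin n) :
    pd a (rhoU u) x = rhoU u x / (n + 2) * trT u x a := by
  have hd := (hc x hx).det_pos
  have h1 := Real.hasDerivAt_rpow_const (x := (hess u x).det) (p := (1:ℝ)/(n+2)) (Or.inl hd.ne')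
  have h2 : pd a (rhoU u) x = _ :=
    pd_comp (f := fun y => (hess u y).det) (sm_da hΩ (sm_det (sm_hess hΩ hu)) hx) h1 a
  rw [h2, pd_det (fun i j => sm_da hΩ (sm_hess hΩ hu i j) hx) hd.ne']
  have h3 : ∑ i, ∑ j, (hess u x)⁻¹ i j * pd a (fun y => hess u y j i) x = trT u x a := by
    unfold trT
    refine Finset.sum_congr rfl fun i _ => Finset.sum_congr rfl fun j _ => ?_
    congr 1
    exact t_swap23 hΩ hu hx a j i
  rw [h3, Real.rpow_sub hd, Real.rpow_one]
  unfold rhoU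
  field_simp

theorem calLap_eq (hΩ : IsOpen Ω) (hu : ContDiffOn ℝ (⊤ : ℕ∞) u Ω)
    (hc : ∀ y ∈ Ω, (hess u y).PosDef) (hx : x ∈ Ω) (φ : (Fin n → ℝ) → ℝ) :
    calLap u φ x = (∑ i, ∑ j, (hess u x)⁻¹ i j * pd i (pd j φ) x)
      - 1 / 2 * ∑ j, trT u x j * calGrad u φ x j := by
  have hr := (rho_pos hc hx).ne'
  unfold calLap
  congr 1
  simp only [pd_rho hΩ hu hc hx, calGrad, Finset.mul_sum]
  rw [Finset.sum_comm]
  refine Finset.sum_congr rfl fun i _ => Finset.sum_congr rfl fun j _ => ?_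
  rw [P_symm hc hx j i]
  field_simp

theorem Phi_eq (hΩ : IsOpen Ω) (hu : ContDiffOn ℝ (⊤ : ℕ∞) u Ω)
    (hc : ∀ y ∈ Ω, (hess u y).PosDef) (hx : x ∈ Ω) :
    PhiU u x = (∑ i, ∑ j, (hess u x)⁻¹ i j * trT u x i * trT u x j) / ((n:ℝ) + 2) ^ 2 := by
  have hr := (rho_pos hc hx).ne'
  unfold PhiU calInner
  simp only [pd_rho hΩ hu hc hx, Finset.sum_div]
  refine Finset.sum_congr rfl fun i _ => Finset.sum_congr rfl fun j _ => ?_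
  field_simp

theorem sm_calGrad (hΩ : IsOpen Ω) (hu : ContDiffOn ℝ (⊤ : ℕ∞) u Ω)
    (hc : ∀ y ∈ Ω, (hess u y).PosDef) (hK : ContDiffOn ℝ (⊤ : ℕ∞) K Ω) (i : Fin n) :
    ContDiffOn ℝ (⊤ : ℕ∞) (fun y => calGrad u K y i) Ω := by
  unfold calGrad
  exact ContDiffOn.sum fun j _ => (sm_P hΩ hu hc i j).mul (sm_pd hΩ hK j)

theorem sm_trT (hΩ : IsOpen Ω) (hu : ContDiffOn ℝ (⊤ : ℕ∞) u Ω)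
    (hc : ∀ y ∈ Ω, (hess u y).PosDef) (a : Fin n) :
    ContDiffOn ℝ (⊤ : ℕ∞) (fun y => trT u y a) Ω := by
  unfold trT
  exact ContDiffOn.sum fun i _ => ContDiffOn.sum fun j _ => (sm_P hΩ hu hc i j).mul
    (sm_pd hΩ (sm_pd hΩ (sm_pd hΩ hu j) i) a)

theorem calInner_eq (φ ψ : (Fin n → ℝ) → ℝ) (hc : ∀ y ∈ Ω, (hess u y).PosDef) (hx : x ∈ Ω) :
    calInner u φ ψ x = ∑ i, calGrad u φ x i * pd i ψ x := by
  unfold calInner calGrad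
  rw [Finset.sum_comm]
  simp only [Finset.sum_mul]
  refine Finset.sum_congr rfl fun i _ => Finset.sum_congr rfl fun j _ => ?_
  rw [P_symm hc hx j i]

theorem sm_calInner (hΩ : IsOpen Ω) (hu : ContDiffOn ℝ (⊤ : ℕ∞) u Ω)
    (hc : ∀ y ∈ Ω, (hess u y).PosDef) (hK : ContDiffOn ℝ (⊤ : ℕ∞) K Ω) :
    ContDiffOn ℝ (⊤ : ℕ∞) (calInner u K K) Ω := by
  refine ContDiffOn.congr (f := fun x => ∑ i, calGrad u K x i * pd i K x) ?_
    (fun y hy => calInner_eq K K hc hy)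
  exact ContDiffOn.sum fun j _ => (sm_calGrad hΩ hu hc hK j).mul (sm_pd hΩ hK j)

theorem pd_calGrad (hΩ : IsOpen Ω) (hu : ContDiffOn ℝ (⊤ : ℕ∞) u Ω)
    (hc : ∀ y ∈ Ω, (hess u y).PosDef) (hK : ContDiffOn ℝ (⊤ : ℕ∞) K Ω) (hx : x ∈ Ω)
    (b i : Fin n) :
    pd b (fun y => calGrad u K y i) x =
      ∑ j, (hess u x)⁻¹ i j * (pd b (pd j K) x - ∑ l, pd b (pd j (pd l u)) x * calGrad u K x l) := by
  unfold calGrad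
  rw [pd_sum _ _ (fun r _ => (sm_da hΩ (sm_P hΩ hu hc i r) hx).fun_mul
    (sm_da hΩ (sm_pd hΩ hK r) hx))]
  simp only [pd_mul (sm_da hΩ (sm_P hΩ hu hc i _) hx) (sm_da hΩ (sm_pd hΩ hK _) hx),
    pd_P hΩ hu hc hx, mul_sub, Finset.sum_sub_distrib, mul_neg, ← sub_eq_add_neg]
  congr 1
  simp only [Finset.mul_sum]
  rw [Finset.sum_comm]
  refine Finset.sum_congr rfl fun k _ => ?_
  rw [Finset.sum_comm]
  refine Finset.sum_congr rfl fun l _ => ?_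
  refine Finset.sum_congr rfl fun j _ => ?_
  ring

theorem pd_calInner (hΩ : IsOpen Ω) (hu : ContDiffOn ℝ (⊤ : ℕ∞) u Ω)
    (hc : ∀ y ∈ Ω, (hess u y).PosDef) (hK : ContDiffOn ℝ (⊤ : ℕ∞) K Ω) (hx : x ∈ Ω)
    (a : Fin n) :
    pd a (calInner u K K) x =
      2 * (∑ i, pd a (pd i K) x * calGrad u K x i) -
        ∑ i, ∑ j, pd a (pd i (pd j u)) x * (calGrad u K x i * calGrad u K x j) := by
  rw [pd_congr hΩ (fun y hy => calInner_eq K K hc hy) hx a]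
  rw [pd_sum _ _ (fun r _ => (sm_da hΩ (sm_calGrad hΩ hu hc hK r) hx).fun_mul
    (sm_da hΩ (sm_pd hΩ hK r) hx))]
  simp only [pd_mul (sm_da hΩ (sm_calGrad hΩ hu hc hK _) hx) (sm_da hΩ (sm_pd hΩ hK _) hx),
    pd_calGrad hΩ hu hc hK hx, Finset.sum_add_distrib]
  have h0 : ∀ Y : Fin n → ℝ, ∑ i, pd i K x * ∑ j, (hess u x)⁻¹ i j * Y j =
      ∑ j, calGrad u K x j * Y j := by
    intro Y
    simp only [calGrad, Finset.sum_mul, Finset.mul_sum]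
    rw [Finset.sum_comm]
    refine Finset.sum_congr rfl fun k _ => Finset.sum_congr rfl fun l _ => ?_
    rw [P_symm hc hx k l]
    ring
  have h1 : ∑ i, pd i K x * ∑ j, (hess u x)⁻¹ i j *
        (pd a (pd j K) x - ∑ l, pd a (pd j (pd l u)) x * calGrad u K x l) =
      ∑ j, calGrad u K x j *
        (pd a (pd j K) x - ∑ l, pd a (pd j (pd l u)) x * calGrad u K x l) := by
    exact h0 (fun j => pd a (pd j K) x - ∑ l, pd a (pd j (pd l u)) x * calGrad u K x l)
  rw [h1]
  simp only [mul_sub, Finset.sum_sub_distrib, two_mul, ← Finset.sum_add_distrib]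
  rw [← add_sub_assoc, ← Finset.sum_add_distrib]
  congr 1
  · refine Finset.sum_congr rfl fun k _ => ?_
    ring
  · simp only [Finset.mul_sum]
    refine Finset.sum_congr rfl fun k _ => Finset.sum_congr rfl fun l _ => ?_
    ring

theorem pd_pd_calInner (hΩ : IsOpen Ω) (hu : ContDiffOn ℝ (⊤ : ℕ∞) u Ω)
    (hc : ∀ y ∈ Ω, (hess u y).PosDef) (hK : ContDiffOn ℝ (⊤ : ℕ∞) K Ω) (hx : x ∈ Ω)
    (b a : Fin n) :
    pd b (pd a (calInner u K K)) x =
      2 * (∑ i, (pd a (pd i K) x * pd b (fun y => calGrad u K y i) x +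
          calGrad u K x i * pd b (pd a (pd i K)) x)) -
        ∑ i, ∑ j, (pd a (pd i (pd j u)) x *
          (calGrad u K x i * pd b (fun y => calGrad u K y j) x +
            calGrad u K x j * pd b (fun y => calGrad u K y i) x)
          + (calGrad u K x i * calGrad u K x j) * pd b (pd a (pd i (pd j u))) x) := by
  rw [pd_congr hΩ (fun y hy => pd_calInner hΩ hu hc hK hy a) hx b]
  have hk := fun i => sm_da hΩ (sm_calGrad hΩ hu hc hK i) hx
  have hK2 := fun i => sm_da hΩ (sm_pd hΩ (sm_pd hΩ hK i) a) hx
  have ht := fun i j => sm_da hΩ (sm_pd hΩ (sm_pd hΩ (sm_pd hΩ hu j) i) a) hx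
  have d1 : ∀ i, DifferentiableAt ℝ (fun y => pd a (pd i K) y * calGrad u K y i) x :=
    fun i => (hK2 i).fun_mul (hk i)
  have d2 : ∀ i j, DifferentiableAt ℝ (fun y => calGrad u K y i * calGrad u K y j) x :=
    fun i j => (hk i).fun_mul (hk j)
  have d3 : ∀ i j, DifferentiableAt ℝ (fun y => pd a (pd i (pd j u)) y *
      (calGrad u K y i * calGrad u K y j)) x :=
    fun i j => (ht i j).fun_mul (d2 i j)
  have d4 : ∀ i, DifferentiableAt ℝ (fun y => ∑ j, pd a (pd i (pd j u)) y *
      (calGrad u K y i * calGrad u K y j)) x :=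
    fun i => DifferentiableAt.fun_sum fun j _ => d3 i j
  rw [pd_sub ((DifferentiableAt.fun_sum fun i _ => d1 i).const_mul 2)
    (DifferentiableAt.fun_sum fun i _ => d4 i)]
  rw [pd_cmul _ (DifferentiableAt.fun_sum fun i _ => d1 i), pd_sum _ _ (fun i _ => d1 i),
    pd_sum _ _ (fun i _ => d4 i)]
  congr 1
  · congr 1
    refine Finset.sum_congr rfl fun i _ => ?_
    rw [pd_mul (hK2 i) (hk i)]
  · refine Finset.sum_congr rfl fun i _ => ?_
    rw [pd_sum _ _ (fun j _ => d3 i j)]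
    refine Finset.sum_congr rfl fun j _ => ?_
    rw [pd_mul (ht i j) (d2 i j), pd_mul (hk i) (hk j)]

theorem pd_calLap (hΩ : IsOpen Ω) (hu : ContDiffOn ℝ (⊤ : ℕ∞) u Ω)
    (hc : ∀ y ∈ Ω, (hess u y).PosDef) (hK : ContDiffOn ℝ (⊤ : ℕ∞) K Ω) (hx : x ∈ Ω)
    (c : Fin n) :
    pd c (calLap u K) x =
      (∑ i, ∑ j, ((hess u x)⁻¹ i j * pd c (pd i (pd j K)) x +
          pd i (pd j K) x * pd c (fun y => (hess u y)⁻¹ i j) x))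
      - 1 / 2 * ∑ j, (trT u x j * pd c (fun y => calGrad u K y j) x +
          calGrad u K x j * ∑ k, ∑ l, ((hess u x)⁻¹ k l * pd c (pd j (pd k (pd l u))) x +
          pd j (pd k (pd l u)) x * pd c (fun y => (hess u y)⁻¹ k l) x)) := by
  rw [pd_congr hΩ (fun y hy => calLap_eq hΩ hu hc hy K) hx c]
  have hP := fun i j => sm_da hΩ (sm_P hΩ hu hc i j) hx
  have hk := fun i => sm_da hΩ (sm_calGrad hΩ hu hc hK i) hx
  have hT := fun i => sm_da hΩ (sm_trT hΩ hu hc i) hx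
  have hK2 := fun i j => sm_da hΩ (sm_pd hΩ (sm_pd hΩ hK j) i) hx
  have ht := fun a i j => sm_da hΩ (sm_pd hΩ (sm_pd hΩ (sm_pd hΩ hu j) i) a) hx
  have d1 : ∀ i j, DifferentiableAt ℝ (fun y => (hess u y)⁻¹ i j * pd i (pd j K) y) x :=
    fun i j => (hP i j).fun_mul (hK2 i j)
  have d2 : ∀ i, DifferentiableAt ℝ (fun y => ∑ j, (hess u y)⁻¹ i j * pd i (pd j K) y) x :=
    fun i => DifferentiableAt.fun_sum fun j _ => d1 i j
  have d3 : ∀ i, DifferentiableAt ℝ (fun y => trT u y i * calGrad u K y i) x :=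
    fun i => (hT i).fun_mul (hk i)
  have d4 : ∀ a i j, DifferentiableAt ℝ (fun y => (hess u y)⁻¹ i j * pd a (pd i (pd j u)) y) x :=
    fun a i j => (hP i j).fun_mul (ht a i j)
  have d5 : ∀ a i, DifferentiableAt ℝ
      (fun y => ∑ j, (hess u y)⁻¹ i j * pd a (pd i (pd j u)) y) x :=
    fun a i => DifferentiableAt.fun_sum fun j _ => d4 a i j
  rw [pd_sub (DifferentiableAt.fun_sum fun i _ => d2 i)
    ((DifferentiableAt.fun_sum fun i _ => d3 i).const_mul _)]
  rw [pd_cmul _ (DifferentiableAt.fun_sum fun i _ => d3 i), pd_sum _ _ (fun i _ => d3 i),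
    pd_sum _ _ (fun i _ => d2 i)]
  congr 1
  · refine Finset.sum_congr rfl fun i _ => ?_
    rw [pd_sum _ _ (fun j _ => d1 i j)]
    refine Finset.sum_congr rfl fun j _ => ?_
    rw [pd_mul (hP i j) (hK2 i j)]
  · congr 1
    refine Finset.sum_congr rfl fun j _ => ?_
    rw [pd_mul (hT j) (hk j)]
    congr 2
    unfold trT
    rw [pd_sum _ _ (fun k _ => d5 j k)]
    refine Finset.sum_congr rfl fun k _ => ?_
    rw [pd_sum _ _ (fun l _ => d4 j k l)]
    refine Finset.sum_congr rfl fun l _ => ?_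
    rw [pd_mul (hP k l) (ht j k l)]

end Geo

section Alg
open Matrix
variable {n : ℕ}

theorem sum_eq_trace (P Z : Matrix (Fin n) (Fin n) ℝ) :
    ∑ a, ∑ b, P a b * Z b a = trace (P * Z) := by
  simp [trace, mul_apply]

/-- Algebraic core of the Bochner formula. -/
theorem bochner_alg (P B : Matrix (Fin n) (Fin n) ℝ) (hP : ∀ i j, P i j = P j i)
    (hB : ∀ i j, B i j = B j i) (t : Fin n → Fin n → Fin n → ℝ)
    (ht12 : ∀ i j k, t i j k = t j i k) (ht23 : ∀ i j k, t i j k = t i k j)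
    (κ T : Fin n → ℝ) (q : Fin n → Fin n → Fin n → Fin n → ℝ)
    (hq : ∀ a b i j, q a b i j = q i j a b)
    (K3 : Fin n → Fin n → Fin n → ℝ) (hK3 : ∀ a b i, K3 a b i = K3 i a b)
    (M : Matrix (Fin n) (Fin n) ℝ) (hM : ∀ a b, M a b = ∑ l, t a b l * κ l)
    (E : Fin n → Fin n → ℝ) (hE : ∀ b i, E b i = ∑ j, P i j * (B b j - ∑ l, t b j l * κ l))
    (dP : Fin n → Fin n → Fin n → ℝ)
    (hdP : ∀ c i j, dP c i j = -∑ k, ∑ l, P i k * t c k l * P l j)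
    (f1 : Fin n → ℝ)
    (hf1 : ∀ a, f1 a = 2 * (∑ i, B a i * κ i) - ∑ i, ∑ j, t a i j * (κ i * κ j))
    (f2 : Fin n → Fin n → ℝ)
    (hf2 : ∀ b a, f2 b a = 2 * (∑ i, (B a i * E b i + κ i * K3 b a i)) -
        ∑ i, ∑ j, (t a i j * (κ i * E b j + κ j * E b i) + (κ i * κ j) * q b a i j))
    (dL : Fin n → ℝ)
    (hdL : ∀ c, dL c = (∑ i, ∑ j, (P i j * K3 c i j + B i j * dP c i j))
      - 1 / 2 * ∑ j, (T j * E c j +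
          κ j * ∑ k, ∑ l, (P k l * q c j k l + t j k l * dP c k l))) :
    (∑ a, ∑ b, P a b * f2 a b) - 1 / 2 * ∑ j, T j * ∑ a, P j a * f1 a =
      2 * (∑ c, κ c * dL c)
        + 2 * trace ((B - (1/2 : ℝ) • M) * P * (B - (1/2 : ℝ) • M) * P)
        + 1 / 2 * trace (M * P * M * P) - 1 / 2 * (T ⬝ᵥ (P *ᵥ (M *ᵥ κ))) := by
  have hMs : ∀ i j, M i j = M j i := fun i j => by
    rw [hM, hM]; exact Finset.sum_congr rfl fun l _ => by rw [ht12]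
  have hMt : ∀ i j, ∑ l, t l i j * κ l = M i j := fun i j => by
    rw [hM]; exact Finset.sum_congr rfl fun l _ => by rw [ht12, ht23]
  have hMt2 : ∀ i j, ∑ l, t i l j * κ l = M i j := fun i j => by
    rw [hM]; exact Finset.sum_congr rfl fun l _ => by rw [ht23]
  have hE' : ∀ b i, E b i = (P * (B - M)) i b := fun b i => by
    rw [hE, mul_apply]
    refine Finset.sum_congr rfl fun j _ => ?_
    rw [Matrix.sub_apply, hB j b, hMs j b, hM]
  have hf1' : ∀ a, f1 a = 2 * (B *ᵥ κ) a - (M *ᵥ κ) a := fun a => by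
    rw [hf1]; simp only [mulVec, dotProduct]
    congr 1
    refine Finset.sum_congr rfl fun i _ => ?_
    rw [hM, Finset.sum_mul]
    exact Finset.sum_congr rfl fun j _ => by ring
  have hf2' : ∀ b a, f2 b a = 2 * (∑ i, κ i * K3 b a i) - (∑ i, ∑ j, (κ i * κ j) * q b a i j)
      + 2 * ((B - M) * P * (B - M)) a b := fun b a => by
    rw [hf2]
    have e1 : ∑ i, B a i * E b i = (B * (P * (B - M))) a b := by
      rw [mul_apply]; exact Finset.sum_congr rfl fun i _ => by rw [hE']
    have e2 : ∑ i, ∑ j, t a i j * (κ i * E b j) = (M * (P * (B - M))) a b := by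
      rw [mul_apply, Finset.sum_comm]
      refine Finset.sum_congr rfl fun j _ => ?_
      rw [← hE', ← hMt2, Finset.sum_mul]
      exact Finset.sum_congr rfl fun i _ => by ring
    have e3 : ∑ i, ∑ j, t a i j * (κ j * E b i) = (M * (P * (B - M))) a b := by
      rw [mul_apply]
      refine Finset.sum_congr rfl fun j _ => ?_
      rw [← hE', hM, Finset.sum_mul]
      exact Finset.sum_congr rfl fun i _ => by ring
    simp only [Finset.sum_add_distrib, mul_add, e1, e2, e3]
    rw [sub_mul, sub_mul, Matrix.sub_apply, mul_assoc, mul_assoc]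
    ring
  have hdPs : ∀ i j, ∑ c, κ c * dP c i j = - (P * M * P) i j := fun i j => by
    simp only [hdP, mul_apply, Finset.sum_mul, mul_neg, Finset.sum_neg_distrib, Finset.mul_sum]
    congr 1
    rw [Finset.sum_comm]
    rw [Finset.sum_comm (s := Finset.univ) (t := Finset.univ)
      (f := fun l k => P i k * M k l * P l j)]
    refine Finset.sum_congr rfl fun k _ => ?_
    rw [Finset.sum_comm]
    refine Finset.sum_congr rfl fun l _ => ?_
    rw [← hMt k l, Finset.mul_sum, Finset.sum_mul]
    exact Finset.sum_congr rfl fun c _ => by ring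
  -- left-hand side
  have L1 : ∑ a, ∑ b, P a b * f2 a b =
      2 * (∑ a, ∑ b, P a b * ∑ i, κ i * K3 a b i)
        - (∑ a, ∑ b, P a b * ∑ i, ∑ j, (κ i * κ j) * q a b i j)
        + 2 * trace (P * ((B - M) * P * (B - M))) := by
    rw [← sum_eq_trace]
    have per : ∀ a b, P a b * f2 a b = 2 * (P a b * ∑ i, κ i * K3 a b i)
        - P a b * (∑ i, ∑ j, (κ i * κ j) * q a b i j)
        + 2 * (P a b * ((B - M) * P * (B - M)) b a) := fun a b => by
      rw [hf2']; ring
    simp only [per, Finset.sum_add_distrib, Finset.sum_sub_distrib,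
      ← Finset.mul_sum (a := (2:ℝ))]
  have L2 : ∑ j, T j * ∑ a, P j a * f1 a =
      2 * (T ⬝ᵥ (P *ᵥ (B *ᵥ κ))) - T ⬝ᵥ (P *ᵥ (M *ᵥ κ)) := by
    have : f1 = (2:ℝ) • (B *ᵥ κ) - M *ᵥ κ := by
      ext a; simp [hf1']
    change T ⬝ᵥ (P *ᵥ f1) = _
    rw [this, mulVec_sub, mulVec_smul, dotProduct_sub, dotProduct_smul, smul_eq_mul]
  have R1 : ∑ c, κ c * dL c = (∑ a, ∑ b, P a b * ∑ i, κ i * K3 a b i)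
      - trace (B * (P * M * P)) - 1 / 2 * (T ⬝ᵥ ((P * (B - M)) *ᵥ κ))
      - 1 / 2 * ((∑ a, ∑ b, P a b * ∑ i, ∑ j, (κ i * κ j) * q a b i j)
        - trace (M * (P * M * P))) := by
    have s1 : ∑ c, κ c * ∑ i, ∑ j, P i j * K3 c i j = ∑ a, ∑ b, P a b * ∑ i, κ i * K3 a b i := by
      simp only [Finset.mul_sum]
      rw [Finset.sum_comm]
      refine Finset.sum_congr rfl fun a _ => ?_
      rw [Finset.sum_comm]
      refine Finset.sum_congr rfl fun b _ => Finset.sum_congr rfl fun c _ => ?_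
      rw [hK3 a b c]; ring
    have hsym : ∀ i j, (P * M * P) i j = (P * M * P) j i := by
      intro i j
      have : (P * M * P)ᵀ = P * M * P := by
        have h1 : Pᵀ = P := by ext a b; exact hP b a
        have h2 : Mᵀ = M := by ext a b; exact hMs b a
        rw [transpose_mul, transpose_mul, h1, h2, mul_assoc]
      exact (congrFun (congrFun this i) j).symm
    have s2g : ∀ Y : Matrix (Fin n) (Fin n) ℝ,
        ∑ c, κ c * ∑ i, ∑ j, Y i j * dP c i j = - trace (Y * (P * M * P)) := by
      intro Y
      rw [← sum_eq_trace]
      simp only [Finset.mul_sum]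
      rw [Finset.sum_comm, ← Finset.sum_neg_distrib]
      refine Finset.sum_congr rfl fun i _ => ?_
      rw [Finset.sum_comm, ← Finset.sum_neg_distrib]
      refine Finset.sum_congr rfl fun j _ => ?_
      rw [hsym j i, ← mul_neg, ← hdPs, Finset.mul_sum]
      exact Finset.sum_congr rfl fun c _ => by ring
    have s3 : ∑ c, κ c * ∑ j, T j * E c j = T ⬝ᵥ ((P * (B - M)) *ᵥ κ) := by
      simp only [Finset.mul_sum, dotProduct, mulVec]
      rw [Finset.sum_comm]
      refine Finset.sum_congr rfl fun i _ => Finset.sum_congr rfl fun j _ => ?_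
      rw [hE']; ring
    have s4 : ∑ c, κ c * ∑ j, κ j * ∑ k, ∑ l, P k l * q c j k l =
        ∑ a, ∑ b, P a b * ∑ i, ∑ j, (κ i * κ j) * q a b i j := by
      simp only [Finset.mul_sum]
      conv_rhs =>
        enter [2, a]
        rw [Finset.sum_comm]
      rw [Finset.sum_comm (s := Finset.univ) (t := Finset.univ)
        (f := fun a i => ∑ b, ∑ j, P a b * (κ i * κ j * q a b i j))]
      refine Finset.sum_congr rfl fun c _ => ?_
      rw [Finset.sum_comm]
      refine Finset.sum_congr rfl fun a _ => ?_
      rw [Finset.sum_comm]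
      refine Finset.sum_congr rfl fun b _ => Finset.sum_congr rfl fun j _ => ?_
      rw [hq a b c j]; ring
    have s5 : ∑ c, κ c * ∑ j, κ j * ∑ k, ∑ l, t j k l * dP c k l = - trace (M * (P * M * P)) := by
      rw [← s2g]
      refine Finset.sum_congr rfl fun c _ => ?_
      congr 1
      simp only [Finset.mul_sum]
      rw [Finset.sum_comm]
      refine Finset.sum_congr rfl fun k _ => ?_
      rw [Finset.sum_comm]
      refine Finset.sum_congr rfl fun l _ => ?_
      rw [← hMt, Finset.sum_mul]
      exact Finset.sum_congr rfl fun j _ => by ring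
    have : ∀ c, κ c * dL c = κ c * (∑ i, ∑ j, P i j * K3 c i j)
        + κ c * (∑ i, ∑ j, B i j * dP c i j) - 1 / 2 * (κ c * ∑ j, T j * E c j)
        - 1 / 2 * (κ c * ∑ j, κ j * ∑ k, ∑ l, P k l * q c j k l)
        - 1 / 2 * (κ c * ∑ j, κ j * ∑ k, ∑ l, t j k l * dP c k l) := by
      intro c
      rw [hdL]
      simp only [Finset.sum_add_distrib, mul_add]
      ring
    simp only [this, Finset.sum_sub_distrib, Finset.sum_add_distrib, ← Finset.mul_sum (a := (1/2:ℝ))]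
    rw [s1, s2g, s3, s4, s5]
    ring
  rw [L1, L2, R1]
  have c1 : trace (P * ((B - M) * P * (B - M))) =
      trace (B * P * B * P) - 2 * trace (B * P * M * P) + trace (M * P * M * P) := by
    rw [trace_mul_comm]
    have : trace (M * P * B * P) = trace (B * P * M * P) := by
      rw [mul_assoc (M * P), trace_mul_comm, ← mul_assoc]
    simp only [sub_mul, mul_sub, trace_sub, this]
    ring
  have c2 : trace ((B - (1/2 : ℝ) • M) * P * (B - (1/2 : ℝ) • M) * P) =
      trace (B * P * B * P) - trace (B * P * M * P) + 1 / 4 * trace (M * P * M * P) := by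
    have : trace (M * P * B * P) = trace (B * P * M * P) := by
      rw [mul_assoc (M * P), trace_mul_comm, ← mul_assoc]
    simp only [sub_mul, mul_sub, trace_sub, smul_mul_assoc, mul_smul_comm, trace_smul, this,
      smul_eq_mul]
    ring
  have c3 : T ⬝ᵥ ((P * (B - M)) *ᵥ κ) = T ⬝ᵥ (P *ᵥ (B *ᵥ κ)) - T ⬝ᵥ (P *ᵥ (M *ᵥ κ)) := by
    rw [← mulVec_mulVec, sub_mulVec, mulVec_sub, dotProduct_sub]
  rw [c1, c2, c3]
  simp only [← mul_assoc]
  ring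

theorem euc1 (hn : 2 ≤ n) (N : Matrix (Fin n) (Fin n) ℝ) (hN : Nᵀ = N) (e : Fin n → ℝ)
    (he : e ⬝ᵥ e = 1) :
    (trace N - e ⬝ᵥ (N *ᵥ e)) ^ 2 ≤
      ((n:ℝ) - 1) * (trace (N * N) - 2 * ((N *ᵥ e) ⬝ᵥ (N *ᵥ e)) + (e ⬝ᵥ (N *ᵥ e)) ^ 2) := by
  set s := e ⬝ᵥ (N *ᵥ e) with hs
  set R := vecMulVec e e with hR
  have hRR : R * R = R := by rw [hR, vecMulVec_mul_vecMulVec, he]; simp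
  have hRt : Rᵀ = R := by rw [hR, transpose_vecMulVec]
  have htr : ∀ A : Matrix (Fin n) (Fin n) ℝ, trace (A * R) = e ⬝ᵥ (A *ᵥ e) := by
    intro A
    rw [hR, mul_vecMulVec, trace_vecMulVec, dotProduct_comm]
  have hRNR : R * N * R = s • R := by
    rw [hR, mul_assoc, mul_vecMulVec, vecMulVec_mul_vecMulVec, vecMulVec_smul]
  set Q := 1 - R with hQ
  have hQQ : Q * Q = Q := by
    rw [hQ, sub_mul, one_mul, mul_sub, hRR]; simp
  have hQt : Qᵀ = Q := by rw [hQ, transpose_sub, hRt, transpose_one]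
  clear_value Q
  have hn1 : (0:ℝ) < (n:ℝ) - 1 := by
    have : (2:ℝ) ≤ n := by exact_mod_cast hn
    linarith
  set τ := (trace N - s) / ((n:ℝ) - 1) with hτ
  set X := Q * N * Q - τ • Q with hX
  have hXt : Xᵀ = X := by
    rw [hX, transpose_sub, transpose_mul, transpose_mul, transpose_smul, hQt, hN, mul_assoc]
  have h0 : 0 ≤ trace (X * X) := by
    nth_rewrite 1 [← hXt]
    simp only [trace, diag, mul_apply, transpose_apply]
    exact Finset.sum_nonneg fun i _ => Finset.sum_nonneg fun j _ => mul_self_nonneg _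
  have hXX : X * X = Q * N * Q * N * Q - (2 * τ) • (Q * N * Q) + (τ ^ 2) • Q := by
    have a1 : Q * N * Q * (Q * N * Q) = Q * N * Q * N * Q := by
      rw [mul_assoc (Q * N) Q, ← mul_assoc Q (Q * N) Q, ← mul_assoc Q Q N, hQQ]
      simp only [mul_assoc]
    have a2 : Q * N * Q * Q = Q * N * Q := by rw [mul_assoc, hQQ]
    have a3 : Q * (Q * N * Q) = Q * N * Q := by rw [← mul_assoc, ← mul_assoc, hQQ]
    rw [hX, sub_mul, mul_sub, mul_sub, a1, mul_smul_comm, smul_mul_assoc, a2, a3, smul_mul_assoc,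
      mul_smul_comm, hQQ, smul_smul, two_mul, add_smul, sq]
    abel
  have t1 : trace (Q * N * Q) = trace N - s := by
    rw [trace_mul_comm, ← mul_assoc, hQQ, trace_mul_comm, hQ, mul_sub, trace_sub, mul_one, htr]
  have t2 : trace Q = (n:ℝ) - 1 := by
    have := htr 1
    rw [one_mul, one_mulVec, he] at this
    rw [hQ, trace_sub, this]; simp
  have t3 : trace (Q * N * Q * N * Q) = trace (N * N) - 2 * ((N *ᵥ e) ⬝ᵥ (N *ᵥ e)) + s ^ 2 := by
    have b1 : trace (Q * N * Q * N * Q) = trace (N * Q * N * Q) := by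
      rw [trace_mul_comm]
      simp only [← mul_assoc]
      rw [hQQ]
      rw [mul_assoc (Q * N) Q N, mul_assoc, trace_mul_comm]
      simp only [← mul_assoc]
    have b2 : N * Q * N * Q = N * N - N * R * N - N * N * R + N * (R * N * R) := by
      rw [hQ]; noncomm_ring
    have b3 : trace (N * R * N) = trace (N * N * R) := by
      rw [trace_mul_comm, ← mul_assoc]
    have b4 : trace (N * N * R) = (N *ᵥ e) ⬝ᵥ (N *ᵥ e) := by
      rw [htr, ← mulVec_mulVec, dotProduct_mulVec, ← mulVec_transpose, hN]
    rw [b1, b2, trace_add, trace_sub, trace_sub, b3, b4, hRNR, mul_smul_comm, trace_smul, htr,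
      smul_eq_mul, ← hs]
    ring
  rw [hXX, trace_add, trace_sub, trace_smul, trace_smul, t1, t2, t3] at h0
  simp only [smul_eq_mul] at h0
  have e1 : τ * ((n:ℝ) - 1) = trace N - s := by rw [hτ]; field_simp
  set Y := trace (N * N) - 2 * ((N *ᵥ e) ⬝ᵥ (N *ᵥ e)) + s ^ 2
  rw [← e1] at h0 ⊢
  nlinarith

theorem euc2 (M : Matrix (Fin n) (Fin n) ℝ) (hM : Mᵀ = M) (k T : Fin n → ℝ) (hk : 0 < k ⬝ᵥ k)
    (δ : ℝ) (hδ : 0 < δ) :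
    1 / 2 * (T ⬝ᵥ (M *ᵥ k)) ≤ δ / 2 * trace (M * M) + 1 / (8 * δ) * (T ⬝ᵥ T) * (k ⬝ᵥ k) := by
  set f := k ⬝ᵥ k with hf
  have h1 : (M *ᵥ k) ⬝ᵥ (M *ᵥ k) ≤ trace (M * M) * f := by
    nth_rewrite 3 [← hM]
    simp only [trace, diag, mul_apply, transpose_apply]
    rw [Finset.sum_comm, Finset.sum_mul]
    simp only [dotProduct, mulVec] at hf ⊢
    refine Finset.sum_le_sum fun i _ => ?_
    have := Finset.sum_mul_sq_le_sq_mul_sq Finset.univ (fun j => M i j) k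
    rw [hf]
    simpa only [sq] using this
  have h2 : T ⬝ᵥ (M *ᵥ k) ≤ f / (4 * δ) * (T ⬝ᵥ T) + δ / f * ((M *ᵥ k) ⬝ᵥ (M *ᵥ k)) := by
    simp only [dotProduct, Finset.mul_sum, ← Finset.sum_add_distrib]
    refine Finset.sum_le_sum fun i _ => ?_
    have : f / (4 * δ) * (T i * T i) + δ / f * ((M *ᵥ k) i * (M *ᵥ k) i) - T i * (M *ᵥ k) i
        = (f * T i - 2 * δ * (M *ᵥ k) i) ^ 2 / (4 * δ * f) := by
      field_simp; ring
    have h3 : 0 ≤ (f * T i - 2 * δ * (M *ᵥ k) i) ^ 2 / (4 * δ * f) := by positivity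
    linarith
  have h3 : δ / f * ((M *ᵥ k) ⬝ᵥ (M *ᵥ k)) ≤ δ * trace (M * M) := by
    calc _ ≤ δ / f * (trace (M * M) * f) := by gcongr
      _ = _ := by field_simp
  have h4 : f / (4 * δ) * (T ⬝ᵥ T) = 2 * (1 / (8 * δ) * (T ⬝ᵥ T) * f) := by field_simp; ring
  linarith

theorem final_alg (hn : 2 ≤ n) (P L N M : Matrix (Fin n) (Fin n) ℝ) (hPL : P = Lᵀ * L)
    (hN : Nᵀ = N) (hM : Mᵀ = M) (k κ T v : Fin n → ℝ) (hκ : κ = P *ᵥ k) (f : ℝ)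
    (hf : f = k ⬝ᵥ κ) (hfp : 0 < f) (hv : v = (Real.sqrt f)⁻¹ • κ) (δ : ℝ) (hδ : 0 < δ) :
    2 * (1 / ((n : ℝ) - 1) - δ - 1) * (v ⬝ᵥ (N *ᵥ v)) ^ 2
      + (1 - δ) / 2 * trace (M * P * M * P) - 1 / (8 * δ) * (T ⬝ᵥ (P *ᵥ T)) * f
      - (2 / (δ * ((n : ℝ) - 1) ^ 2)) * (trace (P * N)) ^ 2 ≤
    2 * trace (N * P * N * P) - 4 * ((N *ᵥ κ) ⬝ᵥ (P *ᵥ (N *ᵥ κ))) / f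
      + 1 / 2 * trace (M * P * M * P) - 1 / 2 * (T ⬝ᵥ (P *ᵥ (M *ᵥ κ))) := by
  have hn1 : (0:ℝ) < (n:ℝ) - 1 := by
    have : (2:ℝ) ≤ n := by exact_mod_cast hn
    linarith
  set k' := L *ᵥ k with hk'
  have hκ' : κ = Lᵀ *ᵥ k' := by rw [hκ, hPL, hk', mulVec_mulVec]
  have hmv : ∀ a b : Fin n → ℝ, a ⬝ᵥ (P *ᵥ b) = (L *ᵥ a) ⬝ᵥ (L *ᵥ b) := by
    intro a b
    rw [hPL, ← mulVec_mulVec, dotProduct_mulVec a, ← mulVec_transpose, transpose_transpose]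
  have hfk : f = k' ⬝ᵥ k' := by rw [hf, hκ, hmv]
  have htr : ∀ A : Matrix (Fin n) (Fin n) ℝ,
      trace (A * P * A * P) = trace ((L * A * Lᵀ) * (L * A * Lᵀ)) := by
    intro A
    rw [hPL, trace_mul_comm (L * A * Lᵀ)]
    have : A * (Lᵀ * L) * A * (Lᵀ * L) = (A * Lᵀ * L * A * Lᵀ) * L := by
      simp only [mul_assoc]
    rw [this, trace_mul_comm]
    simp only [mul_assoc]
  have hsy : ∀ A : Matrix (Fin n) (Fin n) ℝ, Aᵀ = A → (L * A * Lᵀ)ᵀ = L * A * Lᵀ := by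
    intro A hA
    rw [transpose_mul, transpose_mul, hA, transpose_transpose, mul_assoc]
  set r := (Real.sqrt f)⁻¹ with hr
  have hr2 : r * r * f = 1 := by
    have := Real.mul_self_sqrt hfp.le
    have h0 : Real.sqrt f ≠ 0 := (Real.sqrt_pos.2 hfp).ne'
    rw [hr]
    field_simp
    rw [sq, this]
  set e := r • k' with he
  have hee : e ⬝ᵥ e = 1 := by
    rw [he, smul_dotProduct, dotProduct_smul, ← hfk, smul_eq_mul, smul_eq_mul, ← mul_assoc, hr2]
  have hve : v = Lᵀ *ᵥ e := by rw [hv, he, mulVec_smul, hκ']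
  have hvv : v ⬝ᵥ (N *ᵥ v) = e ⬝ᵥ ((L * N * Lᵀ) *ᵥ e) := by
    rw [hve, ← mulVec_mulVec, ← mulVec_mulVec, dotProduct_mulVec e, ← mulVec_transpose]
  have hk2 : (N *ᵥ κ) ⬝ᵥ (P *ᵥ (N *ᵥ κ)) =
      f * (((L * N * Lᵀ) *ᵥ e) ⬝ᵥ ((L * N * Lᵀ) *ᵥ e)) := by
    rw [hmv, hκ', he, mulVec_smul, smul_dotProduct, dotProduct_smul, smul_eq_mul, smul_eq_mul,
      ← mul_assoc, ← mul_assoc]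
    rw [show f * r * r = 1 by rw [← hr2]; ring, one_mul]
    simp only [mulVec_mulVec, mul_assoc]
  have htrN : trace (P * N) = trace (L * N * Lᵀ) := by
    rw [hPL, mul_assoc, trace_mul_comm]
  have hTT : T ⬝ᵥ (P *ᵥ (M *ᵥ κ)) = (L *ᵥ T) ⬝ᵥ ((L * M * Lᵀ) *ᵥ k') := by
    rw [hmv, hκ']; simp only [mulVec_mulVec, mul_assoc]
  have E1 := euc1 hn _ (hsy N hN) e hee
  have E2 := euc2 _ (hsy M hM) k' (L *ᵥ T) (by rw [← hfk]; exact hfp) δ hδ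
  rw [hvv, htr, htr, hk2, htrN, hTT, hmv T T]
  rw [← hfk] at E2
  set s := e ⬝ᵥ ((L * N * Lᵀ) *ᵥ e)
  set Y := trace (L * N * Lᵀ)
  set Z := trace ((L * N * Lᵀ) * (L * N * Lᵀ))
  set W := ((L * N * Lᵀ) *ᵥ e) ⬝ᵥ ((L * N * Lᵀ) *ᵥ e)
  have h5 : 4 * (f * W) / f = 4 * W := by field_simp
  rw [h5]
  have h6 : 2 * (1 / ((n : ℝ) - 1) - δ - 1) * s ^ 2 - (2 / (δ * ((n : ℝ) - 1) ^ 2)) * Y ^ 2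
      ≤ 2 * Z - 4 * W := by
    set d := (n:ℝ) - 1
    have h7 : (Y - s) ^ 2 / d ≤ Z - 2 * W + s ^ 2 := by
      rw [div_le_iff₀ hn1]; linarith
    have h8 : (Y - s) ^ 2 / d - (1 / d * s ^ 2 - δ * s ^ 2 - 1 / (δ * d ^ 2) * Y ^ 2) =
        Y ^ 2 / d + (δ * d * s - Y) ^ 2 / (δ * d ^ 2) := by
      field_simp; ring
    have h9 : 0 ≤ Y ^ 2 / d + (δ * d * s - Y) ^ 2 / (δ * d ^ 2) := by positivity
    have h10 : 2 / (δ * d ^ 2) * Y ^ 2 = 2 * (1 / (δ * d ^ 2) * Y ^ 2) := by ring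
    rw [h10]
    linarith
  linarith

end Alg

section Assemble
open Matrix
variable {n : ℕ} {Ω : Set (Fin n → ℝ)} {x : Fin n → ℝ} {u K : (Fin n → ℝ) → ℝ}

theorem posdef_factor (A : Matrix (Fin n) (Fin n) ℝ) (hA : A.PosDef) :
    ∃ L : Matrix (Fin n) (Fin n) ℝ, A = Lᵀ * L := by
  open scoped MatrixOrder in
  obtain ⟨L, hL⟩ := CStarAlgebra.nonneg_iff_eq_star_mul_self.1 hA.posSemidef.nonneg
  exact ⟨L, by rw [hL, star_eq_conjTranspose, conjTranspose_eq_transpose_of_trivial]⟩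

theorem lap_add (hΩ : IsOpen Ω) (hu : ContDiffOn ℝ (⊤ : ℕ∞) u Ω)
    (hc : ∀ y ∈ Ω, (hess u y).PosDef) (hx : x ∈ Ω) {φ ψ : (Fin n → ℝ) → ℝ}
    (hφ : ContDiffOn ℝ (⊤ : ℕ∞) φ Ω) (hψ : ContDiffOn ℝ (⊤ : ℕ∞) ψ Ω) :
    calLap u (fun y => φ y + ψ y) x = calLap u φ x + calLap u ψ x := by
  have h1 : ∀ y ∈ Ω, ∀ j, pd j (fun y => φ y + ψ y) y = pd j φ y + pd j ψ y :=
    fun y hy j => pd_add (sm_da hΩ hφ hy) (sm_da hΩ hψ hy) j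
  have h2 : ∀ i j, pd i (pd j (fun y => φ y + ψ y)) x = pd i (pd j φ) x + pd i (pd j ψ) x := by
    intro i j
    rw [pd_congr hΩ (fun y hy => h1 y hy j) hx i,
      pd_add (sm_da hΩ (sm_pd hΩ hφ j) hx) (sm_da hΩ (sm_pd hΩ hψ j) hx)]
  simp only [calLap_eq hΩ hu hc hx, calGrad, h2, h1 x hx, mul_add, Finset.sum_add_distrib]
  ring

theorem lap_comp (hΩ : IsOpen Ω) (hu : ContDiffOn ℝ (⊤ : ℕ∞) u Ω)
    (hc : ∀ y ∈ Ω, (hess u y).PosDef) (hx : x ∈ Ω) {w : (Fin n → ℝ) → ℝ}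
    (hw : ContDiffOn ℝ (⊤ : ℕ∞) w Ω) {ψ ψ' : ℝ → ℝ} {ψ2 : ℝ}
    (h1 : ∀ y ∈ Ω, HasDerivAt ψ (ψ' (w y)) (w y)) (h2 : HasDerivAt ψ' ψ2 (w x)) :
    calLap u (fun y => ψ (w y)) x = ψ' (w x) * calLap u w x + ψ2 * calInner u w w x := by
  have e1 : ∀ y ∈ Ω, ∀ j, pd j (fun y => ψ (w y)) y = ψ' (w y) * pd j w y :=
    fun y hy j => pd_comp (sm_da hΩ hw hy) (h1 y hy) j
  have e2 : ∀ i j, pd i (pd j (fun y => ψ (w y))) x =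
      ψ' (w x) * pd i (pd j w) x + ψ2 * (pd i w x * pd j w x) := by
    intro i j
    have hd : DifferentiableAt ℝ (fun y => ψ' (w y)) x :=
      (h2.comp_hasFDerivAt x (sm_da hΩ hw hx).hasFDerivAt).differentiableAt
    rw [pd_congr hΩ (fun y hy => e1 y hy j) hx i, pd_mul hd (sm_da hΩ (sm_pd hΩ hw j) hx),
      pd_comp (sm_da hΩ hw hx) h2]
    ring
  have e3 : ∀ i j, (hess u x)⁻¹ i j * (ψ' (w x) * pd i (pd j w) x + ψ2 * (pd i w x * pd j w x)) =
      ψ' (w x) * ((hess u x)⁻¹ i j * pd i (pd j w) x) +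
        ψ2 * ((hess u x)⁻¹ i j * pd i w x * pd j w x) := fun i j => by ring
  have e4 : ∀ j, trT u x j * ∑ i, (hess u x)⁻¹ j i * (ψ' (w x) * pd i w x) =
      ψ' (w x) * (trT u x j * ∑ i, (hess u x)⁻¹ j i * pd i w x) := by
    intro j
    simp only [Finset.mul_sum]
    exact Finset.sum_congr rfl fun i _ => by ring
  simp only [calLap_eq hΩ hu hc hx, calGrad, calInner, e2, e1 x hx, e3, e4,
    Finset.sum_add_distrib, ← Finset.mul_sum (a := ψ' (w x)), ← Finset.mul_sum (a := ψ2)]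
  ring

theorem lap_max (hΩ : IsOpen Ω) (hu : ContDiffOn ℝ (⊤ : ℕ∞) u Ω)
    (hc : ∀ y ∈ Ω, (hess u y).PosDef) (hx : x ∈ Ω) {φ : (Fin n → ℝ) → ℝ}
    (hφ : ContDiffOn ℝ (⊤ : ℕ∞) φ Ω) (hm : IsLocalMax φ x) : calLap u φ x ≤ 0 := by
  obtain ⟨L, hL⟩ := posdef_factor _ (hc x hx).inv
  rw [calLap_eq hΩ hu hc hx]
  simp only [calGrad, pd_max hm, mul_zero, Finset.sum_const_zero, sub_zero]
  have : ∑ i, ∑ j, (hess u x)⁻¹ i j * pd i (pd j φ) x =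
      ∑ r, ∑ i, ∑ j, L r i * L r j * pd i (pd j φ) x := by
    rw [Finset.sum_comm]
    conv_rhs =>
      rw [Finset.sum_comm]
      enter [2, i]
      rw [Finset.sum_comm]
    rw [Finset.sum_comm]
    refine Finset.sum_congr rfl fun i _ => Finset.sum_congr rfl fun j _ => ?_
    rw [hL, mul_apply, Finset.sum_mul]
    rfl
  rw [this]
  exact Finset.sum_nonpos fun r _ => pd_pd_max hΩ hφ hx hm (L r)

theorem u_lt (hn : 2 ≤ n) (hΩo : IsOpen Ω) (hΩb : Bornology.IsBounded Ω)
    {U : Set (Fin n → ℝ)} (hΩU : closure Ω ⊆ U)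
    (hu : ContDiffOn ℝ (⊤ : ℕ∞) u U)
    (hconv : ∀ x ∈ U, (hess u x).PosDef) {C : ℝ} (hbdry : ∀ ξ ∈ frontier Ω, u ξ = C) :
    ∀ y ∈ Ω, u y < C := by
  have hΩΩ : Ω ⊆ U := subset_closure.trans hΩU
  have huΩ := hu.mono hΩΩ
  have nomax : ∀ y ∈ Ω, ¬ IsLocalMax u y := by
    intro y hy hm
    have i0 : Fin n := ⟨0, by omega⟩
    have h1 := pd_pd_max hΩo huΩ hy hm (Pi.single i0 1)
    have h2 := (hconv y (hΩΩ hy)).diag_pos (i := i0)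
    simp [Pi.single_apply] at h1
    have h3 : hess u y i0 i0 = pd i0 (pd i0 u) y := rfl
    linarith
  have hcomp : IsCompact (closure Ω) := hΩb.isCompact_closure
  intro y hy
  obtain ⟨z, hz, hzm⟩ := hcomp.exists_isMaxOn ⟨y, subset_closure hy⟩ (hu.continuousOn.mono hΩU)
  have hmaxloc : ∀ w ∈ Ω, u w = u z → False := by
    intro w hw he
    apply nomax w hw
    filter_upwards [hΩo.mem_nhds hw] with a ha
    rw [he]; exact hzm (subset_closure ha)
  have hzf : z ∈ frontier Ω := by
    rw [hΩo.frontier_eq]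
    exact ⟨hz, fun h => hmaxloc z h rfl⟩
  rw [← hbdry z hzf]
  exact lt_of_le_of_ne (hzm (subset_closure hy)) (fun h => hmaxloc y hy h)

theorem bochner_final (hn : 2 ≤ n) (hΩ : IsOpen Ω) (hu : ContDiffOn ℝ (⊤ : ℕ∞) u Ω)
    (hc : ∀ y ∈ Ω, (hess u y).PosDef) (hK : ContDiffOn ℝ (⊤ : ℕ∞) K Ω) (hx : x ∈ Ω)
    (hfp : 0 < calInner u K K x) (v : Fin n → ℝ)
    (hv : v = (Real.sqrt (calInner u K K x))⁻¹ • calGrad u K x) (δ : ℝ) (hδ : 0 < δ) :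
    2 * (1 / ((n : ℝ) - 1) - δ - 1) * (covHess u K x v) ^ 2
        + 2 * calInner u K (fun ξ => calLap u K ξ) x
        + 2 * (1 - δ) * fubiniPickSq u x v * calInner u K K x
        - (((n : ℝ) + 2) ^ 2 / (8 * δ)) * PhiU u x * calInner u K K x
        - (2 / (δ * ((n : ℝ) - 1) ^ 2)) * (calLap u K x) ^ 2 ≤
      calLap u (calInner u K K) x
        - calInner u (calInner u K K) (calInner u K K) x / calInner u K K x := by
  obtain ⟨L, hL⟩ := posdef_factor _ (hc x hx).inv
  set f := calInner u K K with hfdef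
  set κ := calGrad u K x with hκdef
  set P := (hess u x)⁻¹ with hPdef
  set B : Matrix (Fin n) (Fin n) ℝ := Matrix.of fun i j => pd i (pd j K) x with hBdef
  set t : Fin n → Fin n → Fin n → ℝ := fun i j k => pd i (pd j (pd k u)) x with htdef
  set M : Matrix (Fin n) (Fin n) ℝ := Matrix.of fun a b => ∑ l, t a b l * κ l with hMdef
  set T := trT u x with hTdef
  set N := B - (1/2 : ℝ) • M with hNdef
  have hP : ∀ i j, P i j = P j i := fun i j => P_symm hc hx i j
  have hB : ∀ i j, B i j = B j i := fun i j => pd_symm hΩ hK hx i j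
  have ht12 : ∀ i j k, t i j k = t j i k := fun i j k => t_swap12 hΩ hu hx i j k
  have ht23 : ∀ i j k, t i j k = t i k j := fun i j k => t_swap23 hΩ hu hx i j k
  have q12 : ∀ a b i j, pd a (pd b (pd i (pd j u))) x = pd b (pd a (pd i (pd j u))) x :=
    fun a b i j => t_swap12 hΩ (sm_pd hΩ hu j) hx a b i
  have q23 : ∀ a b i j, pd a (pd b (pd i (pd j u))) x = pd a (pd i (pd b (pd j u))) x :=
    fun a b i j => t_swap23 hΩ (sm_pd hΩ hu j) hx a b i
  have q34 : ∀ a b i j, pd a (pd b (pd i (pd j u))) x = pd a (pd b (pd j (pd i u))) x :=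
    fun a b i j => pd_congr hΩ (fun y hy => t_swap23 hΩ hu hy b i j) hx a
  have hboch := bochner_alg P B hP hB t ht12 ht23 κ T
    (fun a b i j => pd a (pd b (pd i (pd j u))) x)
    (fun a b i j => by rw [q23, q12, q34, q23])
    (fun a b i => pd a (pd b (pd i K)) x)
    (fun a b i => by rw [t_swap23 hΩ hK hx, t_swap12 hΩ hK hx])
    M (fun a b => rfl)
    (fun b i => pd b (fun y => calGrad u K y i) x)
    (fun b i => pd_calGrad hΩ hu hc hK hx b i)
    (fun c i j => pd c (fun y => (hess u y)⁻¹ i j) x)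
    (fun c i j => pd_P hΩ hu hc hx c i j)
    (fun a => pd a f x) (fun a => pd_calInner hΩ hu hc hK hx a)
    (fun b a => pd b (pd a f) x) (fun b a => pd_pd_calInner hΩ hu hc hK hx b a)
    (fun c => pd c (calLap u K) x) (fun c => pd_calLap hΩ hu hc hK hx c)
  have hMs : Mᵀ = M := by
    ext a b
    simp only [transpose_apply, hMdef, of_apply]
    exact Finset.sum_congr rfl fun l _ => by rw [ht12]
  have hBs : Bᵀ = B := by ext a b; exact hB b a
  have hNs : Nᵀ = N := by rw [hNdef, transpose_sub, transpose_smul, hMs, hBs]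
  have hfin := final_alg hn P L N M hL hNs hMs (fun i => pd i K x) κ T v rfl (f x)
    (by rw [hfdef, calInner_eq K K hc hx, dotProduct_comm]; rfl) hfp hv δ hδ
  have hlapf : calLap u f x = (∑ a, ∑ b, P a b * pd a (pd b f) x)
      - 1 / 2 * ∑ j, T j * ∑ a, P j a * pd a f x := calLap_eq hΩ hu hc hx f
  have hin : calInner u K (fun ξ => calLap u K ξ) x = ∑ c, κ c * pd c (calLap u K) x :=
    calInner_eq K (calLap u K) hc hx
  have hf1 : (fun a => pd a f x) = (2:ℝ) • (N *ᵥ κ) := by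
    ext a
    rw [pd_calInner hΩ hu hc hK hx a]
    simp only [hNdef, sub_mulVec, smul_mulVec, Pi.smul_apply, Pi.sub_apply, smul_eq_mul, mulVec,
      dotProduct, hMdef, hBdef, of_apply, mul_sub, Finset.sum_mul]
    congr 1
    rw [← mul_assoc]
    norm_num
    exact Finset.sum_congr rfl fun i _ => Finset.sum_congr rfl fun j _ => by ring
  have hff : calInner u f f x = 4 * ((N *ᵥ κ) ⬝ᵥ (P *ᵥ (N *ᵥ κ))) := by
    have : calInner u f f x = (fun a => pd a f x) ⬝ᵥ (P *ᵥ (fun a => pd a f x)) := by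
      simp only [calInner, dotProduct, mulVec, Finset.mul_sum]
      exact Finset.sum_congr rfl fun i _ => Finset.sum_congr rfl fun j _ => by ring
    rw [this, hf1, mulVec_smul, smul_dotProduct, dotProduct_smul, smul_eq_mul, smul_eq_mul]
    ring
  have hlapK : calLap u K x = trace (P * N) := by
    rw [calLap_eq hΩ hu hc hx, hNdef, mul_sub, trace_sub, mul_smul_comm, trace_smul, smul_eq_mul,
      ← sum_eq_trace, ← sum_eq_trace]
    congr 1
    · refine Finset.sum_congr rfl fun i _ => Finset.sum_congr rfl fun j _ => ?_
      rw [hB j i]; rfl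
    · congr 1
      simp only [trT, hMdef, of_apply, Finset.mul_sum, Finset.sum_mul]
      rw [Finset.sum_comm]
      refine Finset.sum_congr rfl fun i _ => ?_
      rw [Finset.sum_comm]
      refine Finset.sum_congr rfl fun j _ => Finset.sum_congr rfl fun l _ => ?_
      rw [ht23 j i l, ht12 j l i, ht23 l j i]
      simp only [htdef]
      ring
  have hcov : covHess u K x v = v ⬝ᵥ (N *ᵥ v) := by
    simp only [covHess, dotProduct, mulVec, Finset.mul_sum]
    refine Finset.sum_congr rfl fun i _ => Finset.sum_congr rfl fun j _ => ?_
    have : ∑ k, christof u x k i j * pd k K x = 1 / 2 * M i j := by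
      simp only [christof, hMdef, of_apply, hκdef, calGrad, Finset.mul_sum, Finset.sum_mul]
      rw [Finset.sum_comm]
      refine Finset.sum_congr rfl fun k _ => Finset.sum_congr rfl fun l _ => ?_
      rw [P_symm hc hx k l]
      simp only [htdef]
      ring
    rw [this]
    simp only [hNdef, Matrix.sub_apply, Matrix.smul_apply, smul_eq_mul, hBdef, of_apply]
    ring
  have hfub : fubiniPickSq u x v * f x = 1 / 4 * trace (M * P * M * P) := by
    set r := (Real.sqrt (f x))⁻¹ with hr
    have hr2 : r * r * f x = 1 := by
      have := Real.mul_self_sqrt hfp.le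
      have h0 : Real.sqrt (f x) ≠ 0 := (Real.sqrt_pos.2 hfp).ne'
      rw [hr]
      field_simp
      rw [sq, this]
    have hA : ∀ i j, ∑ p, fubiniPick u x i j p * v p = 1 / 2 * r * M i j := by
      intro i j
      simp only [fubiniPick, hv, Pi.smul_apply, smul_eq_mul, hMdef, of_apply, Finset.mul_sum]
      exact Finset.sum_congr rfl fun p _ => by simp only [htdef]; ring
    have h1 : fubiniPickSq u x v = 1 / 4 * (r * r) * trace (M * P * M * P) := by
      have h2 : trace (M * P * M * P) =
          ∑ i, ∑ j, ∑ k, ∑ l, P i k * P j l * M i j * M k l := by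
        rw [← sum_eq_trace]
        refine Finset.sum_congr rfl fun i _ => ?_
        simp only [mul_apply, Finset.sum_mul]
        have hMM : ∀ a b, M a b = M b a := fun a b => congrFun (congrFun hMs b) a
        -- ∑ k ∑ l ∑ j
        conv_lhs =>
          enter [2, k]
          rw [Finset.sum_comm]
        rw [Finset.sum_comm]
        refine Finset.sum_congr rfl fun j _ => Finset.sum_congr rfl fun k _ =>
          Finset.sum_congr rfl fun l _ => ?_
        rw [hMM k l, hP k i]
        ring
      rw [h2]
      simp only [fubiniPickSq, hA, Finset.mul_sum]
      refine Finset.sum_congr rfl fun i _ => Finset.sum_congr rfl fun j _ =>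
        Finset.sum_congr rfl fun k _ => Finset.sum_congr rfl fun l _ => ?_
      ring
    rw [h1]
    calc _ = 1 / 4 * (r * r * f x) * trace (M * P * M * P) := by ring
      _ = _ := by rw [hr2]; ring
  have hPhi : ((n:ℝ) + 2) ^ 2 * PhiU u x = T ⬝ᵥ (P *ᵥ T) := by
    rw [Phi_eq hΩ hu hc hx, mul_div_cancel₀ _ (by positivity)]
    simp only [dotProduct, mulVec, Finset.mul_sum]
    exact Finset.sum_congr rfl fun i _ => Finset.sum_congr rfl fun j _ => by ring
  rw [hlapf, hboch, hin, hff, hlapK, hcov]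
  have e1 : 2 * (1 - δ) * fubiniPickSq u x v * f x = (1 - δ) / 2 * trace (M * P * M * P) := by
    rw [mul_assoc, hfub]; ring
  have e2 : (((n : ℝ) + 2) ^ 2 / (8 * δ)) * PhiU u x * f x =
      1 / (8 * δ) * (T ⬝ᵥ (P *ᵥ T)) * f x := by
    rw [← hPhi]; ring
  rw [e1, e2]
  linarith

end Assemble

theorem der1 (m C s : ℝ) (h : C - s ≠ 0) :
    HasDerivAt (fun s => -m / (C - s)) (-m / (C - s) ^ 2) s := by
  have h1 : HasDerivAt (fun s : ℝ => C - s) (-1) s := by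
    simpa using (hasDerivAt_id s).const_sub C
  refine ((hasDerivAt_const s (-m)).fun_div h1 h).congr_deriv ?_
  ring
theorem der2 (m C s : ℝ) (h : C - s ≠ 0) :
    HasDerivAt (fun s => -m / (C - s) ^ 2) (-(2 * m / (C - s) ^ 3)) s := by
  have h1 : HasDerivAt (fun s : ℝ => C - s) (-1) s := by
    simpa using (hasDerivAt_id s).const_sub C
  refine ((hasDerivAt_const s (-m)).fun_div (h1.fun_pow 2) (pow_ne_zero 2 h)).congr_deriv ?_
  field_simp
  norm_num
  ring

/-- Lemma 6.2: if `F = exp(−m/(C−u) + H) Q ‖∇K‖²` attains its supremum over `Ω`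
at an interior point `p*` with `∇K(p*) ≠ 0` and `v = ∇K/‖∇K‖` there, then for
every `0 < δ < 1`, at `p*`:
`2(1/(n−1)−δ−1)(Hess K(v,v))² + 2⟨∇K, ∇(ΔK)⟩ + 2(1−δ)‖A(v,·,·)‖²‖∇K‖²
 − ((n+2)²/(8δ))Φ‖∇K‖² − (2/(δ(n−1)²))(ΔK)²
 + (−h'‖∇u‖² − hΔu + ΔH + ΔQ/Q − ‖∇Q‖²/Q²)‖∇K‖² ≤ 0`. -/
theorem lemma_6_2 (n : ℕ) (hn : 2 ≤ n)
    (Ω : Set (Fin n → ℝ)) (hΩo : IsOpen Ω) (hΩb : Bornology.IsBounded Ω)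
    (U : Set (Fin n → ℝ)) (hUo : IsOpen U) (hΩU : closure Ω ⊆ U)
    (u : (Fin n → ℝ) → ℝ) (hu : ContDiffOn ℝ (⊤ : ℕ∞) u U)
    (hconv : ∀ x ∈ U, (hess u x).PosDef)
    (hinf : sInf (u '' Ω) = 0)
    (C : ℝ) (hC : 0 < C) (hbdry : ∀ ξ ∈ frontier Ω, u ξ = C)
    (m : ℝ) (hm : 0 < m)
    (Q H K : (Fin n → ℝ) → ℝ)
    (hQ : ContDiffOn ℝ (⊤ : ℕ∞) Q (closure Ω))
    (hH : ContDiffOn ℝ (⊤ : ℕ∞) H (closure Ω))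
    (hK : ContDiffOn ℝ (⊤ : ℕ∞) K (closure Ω))
    (hQpos : ∀ ξ ∈ closure Ω, 0 < Q ξ)
    (pstar : Fin n → ℝ) (hpstar : pstar ∈ Ω)
    (hmax : ∀ ξ ∈ Ω,
      Real.exp (-m / (C - u ξ) + H ξ) * Q ξ * calInner u K K ξ ≤
        Real.exp (-m / (C - u pstar) + H pstar) * Q pstar * calInner u K K pstar)
    (hgrad : calGrad u K pstar ≠ 0)
    (v : Fin n → ℝ)
    (hv : v = (Real.sqrt (calInner u K K pstar))⁻¹ • calGrad u K pstar) :
    ∀ δ : ℝ, 0 < δ → δ < 1 →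
      2 * (1 / ((n : ℝ) - 1) - δ - 1) * (covHess u K pstar v) ^ 2
        + 2 * calInner u K (fun ξ => calLap u K ξ) pstar
        + 2 * (1 - δ) * fubiniPickSq u pstar v * calInner u K K pstar
        - (((n : ℝ) + 2) ^ 2 / (8 * δ)) * PhiU u pstar * calInner u K K pstar
        - (2 / (δ * ((n : ℝ) - 1) ^ 2)) * (calLap u K pstar) ^ 2
        + (-(2 * m / (C - u pstar) ^ 3) * calInner u u u pstar
            - (m / (C - u pstar) ^ 2) * calLap u u pstar
            + calLap u H pstar
            + calLap u Q pstar / Q pstar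
            - calInner u Q Q pstar / (Q pstar) ^ 2) * calInner u K K pstar
        ≤ 0 := by
  intro δ hδ hδ1
  have hΩΩ : Ω ⊆ U := subset_closure.trans hΩU
  have huΩ := hu.mono hΩΩ
  have hc : ∀ y ∈ Ω, (hess u y).PosDef := fun y hy => hconv y (hΩΩ hy)
  have hQ0 := hQ.mono subset_closure
  have hH0 := hH.mono subset_closure
  have hK0 := hK.mono subset_closure
  have hult := u_lt hn hΩo hΩb hΩU hu hconv hbdry
  set f := calInner u K K with hf
  have hfs : ContDiffOn ℝ (⊤ : ℕ∞) f Ω := sm_calInner hΩo huΩ hc hK0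
  have hfp : 0 < f pstar := by
    have hk : (fun i => pd i K pstar) ≠ 0 := by
      intro h
      apply hgrad
      ext i
      have : ∀ j, pd j K pstar = 0 := fun j => congrFun h j
      simp [calGrad, this]
    have h1 := (hc pstar hpstar).inv.dotProduct_mulVec_pos hk
    have h2 : f pstar = star (fun i => pd i K pstar) ⬝ᵥ
        ((hess u pstar)⁻¹.mulVec (fun i => pd i K pstar)) := by
      simp only [hf, calInner, dotProduct, Matrix.mulVec, Finset.mul_sum, Pi.star_apply,
        star_trivial]
      exact Finset.sum_congr rfl fun i _ => Finset.sum_congr rfl fun j _ => by ring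
    rw [h2]; exact h1
  have hb := bochner_final hn hΩo huΩ hc hK0 hpstar hfp v hv δ hδ
  -- pass to the set where `f > 0`
  set Ω' := Ω ∩ f ⁻¹' Set.Ioi 0 with hΩ'
  have hΩ'o : IsOpen Ω' := hfs.continuousOn.isOpen_inter_preimage hΩo isOpen_Ioi
  have hsub : Ω' ⊆ Ω := Set.inter_subset_left
  have hp' : pstar ∈ Ω' := ⟨hpstar, hfp⟩
  have hc' : ∀ y ∈ Ω', (hess u y).PosDef := fun y hy => hc y (hsub hy)
  have hu' := huΩ.mono hsub
  have hQ' := hQ0.mono hsub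
  have hH' := hH0.mono hsub
  have hf' := hfs.mono hsub
  have hCu : ∀ y ∈ Ω', C - u y ≠ 0 := fun y hy => (sub_pos.2 (hult y (hsub hy))).ne'
  have hQp : ∀ y ∈ Ω', 0 < Q y := fun y hy => hQpos y (subset_closure (hsub hy))
  have s1 : ContDiffOn ℝ (⊤ : ℕ∞) (fun y => -m / (C - u y)) Ω' :=
    contDiffOn_const.div (contDiffOn_const.sub hu') hCu
  have s3 : ContDiffOn ℝ (⊤ : ℕ∞) (fun y => Real.log (Q y)) Ω' :=
    hQ'.log fun y hy => (hQp y hy).ne'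
  have s4 : ContDiffOn ℝ (⊤ : ℕ∞) (fun y => Real.log (f y)) Ω' :=
    hf'.log fun y hy => (show 0 < f y from hy.2).ne'
  have hmaxφ : IsLocalMax (fun y => ((-m / (C - u y) + H y) + Real.log (Q y)) + Real.log (f y))
      pstar := by
    have key : ∀ y ∈ Ω', ((-m / (C - u y) + H y) + Real.log (Q y)) + Real.log (f y) =
        Real.log (Real.exp (-m / (C - u y) + H y) * Q y * f y) := by
      intro y hy
      have h1 := hQp y hy
      have h2 : 0 < f y := hy.2
      rw [Real.log_mul (by positivity) h2.ne', Real.log_mul (by positivity) h1.ne', Real.log_exp]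
    filter_upwards [hΩ'o.mem_nhds hp'] with y hy
    rw [key y hy, key pstar hp']
    have h1 := hQp y hy
    have h2 : 0 < f y := hy.2
    exact Real.log_le_log (by positivity) (hmax y (hsub hy))
  have hlap := lap_max hΩ'o hu' hc' hp' (((s1.add hH').add s3).add s4) hmaxφ
  rw [lap_add hΩ'o hu' hc' hp' ((s1.add hH').add s3) s4,
    lap_add hΩ'o hu' hc' hp' (s1.add hH') s3, lap_add hΩ'o hu' hc' hp' s1 hH'] at hlap
  have L1 := lap_comp hΩ'o hu' hc' hp' hu' (ψ := fun s => -m / (C - s))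
    (ψ' := fun s => -m / (C - s) ^ 2) (ψ2 := -(2 * m / (C - u pstar) ^ 3))
    (fun y hy => der1 m C (u y) (hCu y hy)) (der2 m C (u pstar) (hCu pstar hp'))
  have hlog : ∀ (w : (Fin n → ℝ) → ℝ), ContDiffOn ℝ (⊤ : ℕ∞) w Ω' → (∀ y ∈ Ω', 0 < w y) →
      calLap u (fun y => Real.log (w y)) pstar =
        (w pstar)⁻¹ * calLap u w pstar + -((w pstar ^ 2)⁻¹) * calInner u w w pstar := by
    intro w hw hpos
    exact lap_comp hΩ'o hu' hc' hp' hw (ψ := Real.log) (ψ' := fun s => s⁻¹)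
      (fun y hy => Real.hasDerivAt_log (hpos y hy).ne') (hasDerivAt_inv (hpos _ hp').ne')
  rw [L1, hlog Q hQ' hQp, hlog f hf' (fun y hy => hy.2)] at hlap
  have hmul := mul_nonpos_of_nonpos_of_nonneg hlap hfp.le
  have hQ1 := (hQp pstar hp').ne'
  have e1 : (f pstar)⁻¹ * calLap u f pstar * f pstar = calLap u f pstar := by
    field_simp
  have e2 : (f pstar ^ 2)⁻¹ * calInner u f f pstar * f pstar = calInner u f f pstar / f pstar := by
    field_simp
  have e3 : (-m / (C - u pstar) ^ 2) * calLap u u pstar =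
      - ((m / (C - u pstar) ^ 2) * calLap u u pstar) := by ring
  have e4 : calLap u Q pstar / Q pstar = (Q pstar)⁻¹ * calLap u Q pstar := by
    rw [div_eq_inv_mul]
  have e5 : calInner u Q Q pstar / Q pstar ^ 2 = (Q pstar ^ 2)⁻¹ * calInner u Q Q pstar := by
    rw [div_eq_inv_mul]
  rw [e4, e5]
  simp only [e3] at hmul
  linarith
end
end
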